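/- arXiv:1704.08398 — 4 statements merged into one kernel-verified Lean document; each statement's English description precedes it below -/
import Mathlib

section
/- For every λ > 0, μ > 0 and every integer n ≥ 1 with 1 ≤ R < n (where R = λ/μ), the Wasserstein distance between the scaled stationary Erlang-C customer count and its diffusion approximation satisfies d_W(X̃(∞), Y(∞)) = sup over 1-Lipschitz h : ℝ → ℝ of |E h(X̃(∞)) − E h(Y(∞))| ≤ 190/√R. -/
open MeasureTheory Set

namespace ErlangC

/-- Potential. -/
noncomputable def B (z x : ℝ) : ℝ := ∫ y in (0:ℝ)..x, min y z

/-- Unnormalised density. -/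
noncomputable def w (z x : ℝ) : ℝ := Real.exp (-B z x)

lemma cont_min (z : ℝ) : Continuous fun y : ℝ => min y z := by fun_prop

lemma B_deriv (z x : ℝ) : HasDerivAt (B z) (min x z) x :=
  intervalIntegral.integral_hasDerivAt_right ((cont_min z).intervalIntegrable _ _)
    (cont_min z).stronglyMeasurable.stronglyMeasurableAtFilter (cont_min z).continuousAt

lemma B_sub (z x y : ℝ) : B z y - B z x = ∫ s in x..y, min s z := by
  unfold B
  rw [intervalIntegral.integral_interval_sub_left] <;> exact (cont_min z).intervalIntegrable _ _

lemma B_convex (z x y : ℝ) : B z x + min x z * (y - x) ≤ B z y := by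
  have h := B_sub z x y
  have hc : ∫ s in x..y, min x z = (y - x) * min x z := by simp
  rcases le_total x y with hxy | hxy
  · have := intervalIntegral.integral_mono_on (μ := volume) (f := fun _ => min x z)
      (g := fun s => min s z) hxy (by simp) ((cont_min z).intervalIntegrable _ _)
      (fun s hs => min_le_min_right z hs.1)
    linarith
  · have := intervalIntegral.integral_mono_on (μ := volume) (g := fun _ => min x z)
      (f := fun s => min s z) hxy ((cont_min z).intervalIntegrable _ _) (by simp)
      (fun s hs => min_le_min_right z hs.2)
    rw [intervalIntegral.integral_symm] at h hc
    linarith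

lemma B_left {z x : ℝ} (hz : 0 < z) (hx : x ≤ z) : B z x = x ^ 2 / 2 := by
  unfold B
  have : ∫ y in (0:ℝ)..x, min y z = ∫ y in (0:ℝ)..x, y := by
    apply intervalIntegral.integral_congr
    intro y hy
    have : y ≤ z := by
      rcases le_total 0 x with h | h
      · rw [uIcc_of_le h] at hy; linarith [hy.2]
      · rw [uIcc_of_ge h] at hy; linarith [hy.2]
    simp [this]
  rw [this, integral_id]; ring

lemma B_right {z x s : ℝ} (hx : z ≤ x) (hs : 0 ≤ s) : B z (x + s) = B z x + z * s := by
  have h := B_sub z x (x + s)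
  have : ∫ y in x..(x + s), min y z = ∫ y in x..(x + s), z := by
    apply intervalIntegral.integral_congr
    intro y hy
    rw [uIcc_of_le (by linarith)] at hy
    have : z ≤ y := by linarith [hy.1]
    simp [this]
  rw [this] at h
  simp at h
  linarith

lemma w_pos (z x : ℝ) : 0 < w z x := Real.exp_pos _

lemma w_deriv (z x : ℝ) : HasDerivAt (w z) (-(min x z) * w z x) x := by
  have := (B_deriv z x).neg.exp
  convert! this using 1
  rw [Pi.neg_apply]; unfold w; ring

lemma w_cont (z : ℝ) : Continuous (w z) :=
  continuous_iff_continuousAt.2 fun x => (w_deriv z x).continuousAt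

lemma w_ratio (z x y : ℝ) : w z y ≤ w z x * Real.exp (-(min x z * (y - x))) := by
  unfold w
  rw [← Real.exp_add, Real.exp_le_exp]
  linarith [B_convex z x y]

lemma w_bound {z : ℝ} (hz : 0 < z) : ∃ c > 0, ∃ C > 0, ∀ y, w z y ≤ C * Real.exp (-(c * |y|)) := by
  refine ⟨min z 1, by positivity, Real.exp ((min z 1)^2/2), Real.exp_pos _, fun y => ?_⟩
  set c := min z 1
  have hc : 0 < c := by positivity
  have hcz : c ≤ z := min_le_left _ _
  unfold w
  rw [← Real.exp_add, Real.exp_le_exp]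
  have h1 := B_convex z c y
  have h2 := B_convex z (-c) y
  rw [B_left hz hcz, min_eq_left hcz] at h1
  rw [B_left hz (by linarith), min_eq_left (by linarith)] at h2
  rcases abs_cases y with h | h <;> rw [h.1] <;> nlinarith

lemma int_exp {c : ℝ} (hc : 0 < c) : IntegrableOn (fun s : ℝ => Real.exp (-(c * s))) (Ioi 0) := by
  simpa using exp_neg_integrableOn_Ioi 0 hc

lemma int_mul_exp {c : ℝ} (hc : 0 < c) :
    IntegrableOn (fun s : ℝ => s * Real.exp (-(c * s))) (Ioi 0) := by
  have := integrableOn_rpow_mul_exp_neg_mul_rpow (p := 1) (s := 1) (b := c) (by norm_num) (by norm_num) hc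
  simpa using this

lemma integral_exp {c : ℝ} (hc : 0 < c) : ∫ s in Ioi (0:ℝ), Real.exp (-(c * s)) = 1 / c := by
  have := Real.integral_rpow_mul_exp_neg_mul_Ioi (a := 1) (r := c) (by norm_num) hc
  simpa using this

lemma integral_mul_exp {c : ℝ} (hc : 0 < c) :
    ∫ s in Ioi (0:ℝ), s * Real.exp (-(c * s)) = 1 / c ^ 2 := by
  have := Real.integral_rpow_mul_exp_neg_mul_Ioi (a := 2) (r := c) (by norm_num) hc
  norm_num at this
  simpa using this

lemma int_abs {f : ℝ → ℝ} (hf : IntegrableOn f (Ioi 0)) : Integrable fun x => f |x| := by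
  have h1 : IntegrableOn (fun x => f |x|) (Ioi 0) :=
    hf.congr_fun (fun x hx => by simp [abs_of_pos (show (0:ℝ) < x from hx)]) measurableSet_Ioi
  have h2 : IntegrableOn (fun x => f |x|) (Iic 0) := by
    have h3 : IntegrableOn (fun x => f |x|) (Iio 0) := by
      have := h1.comp_neg
      simpa using this
    exact h3.congr_set_ae Iio_ae_eq_Iic.symm
  rw [← integrableOn_univ, ← Iic_union_Ioi (a := (0:ℝ))]
  exact h2.union h1

lemma int_lin {z : ℝ} (hz : 0 < z) (f : ℝ → ℝ) (hf : Continuous f) (a : ℝ)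
    (hfa : ∀ y, |f y| ≤ |y| + a) : Integrable fun y => f y * w z y := by
  obtain ⟨c, hc, C, hC, hw⟩ := w_bound hz
  have hi : Integrable fun y : ℝ => C * (|y| * Real.exp (-(c * |y|))) + C * (a * Real.exp (-(c * |y|))) :=
    ((int_abs (int_mul_exp hc)).const_mul C).add (((int_abs (int_exp hc)).const_mul a).const_mul C)
  refine hi.mono' (hf.mul (w_cont z)).aestronglyMeasurable (Filter.Eventually.of_forall fun y => ?_)
  rw [Real.norm_eq_abs, abs_mul, abs_of_pos (w_pos z y)]
  have h0 := hfa y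
  calc |f y| * w z y ≤ (|y| + a) * (C * Real.exp (-(c * |y|))) :=
        mul_le_mul h0 (hw y) (w_pos z y).le ((abs_nonneg _).trans h0)
    _ = _ := by ring

lemma int_w {z : ℝ} (hz : 0 < z) : Integrable (w z) := by
  simpa using int_lin hz (fun _ => 1) continuous_const 1 (fun y => by simp)

lemma int_min {z : ℝ} (hz : 0 < z) : Integrable fun y => min y z * w z y := by
  refine int_lin hz _ (cont_min z) z (fun y => ?_)
  rcases le_total y z with h | h
  · rw [min_eq_left h]; linarith
  · rw [min_eq_right h, abs_of_pos hz]; linarith [abs_nonneg y]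

lemma w_top {z : ℝ} (hz : 0 < z) : Filter.Tendsto (w z) Filter.atTop (nhds 0) := by
  obtain ⟨c, hc, C, hC, hw⟩ := w_bound hz
  have h1 : Filter.Tendsto (fun y : ℝ => C * Real.exp (-(c * |y|))) Filter.atTop (nhds (C * 0)) :=
    (Real.tendsto_exp_neg_atTop_nhds_zero.comp
      (Filter.tendsto_abs_atTop_atTop.const_mul_atTop hc)).const_mul C
  rw [mul_zero] at h1
  exact squeeze_zero (fun y => (w_pos z y).le) hw h1

lemma w_bot {z : ℝ} (hz : 0 < z) : Filter.Tendsto (w z) Filter.atBot (nhds 0) := by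
  obtain ⟨c, hc, C, hC, hw⟩ := w_bound hz
  have h1 : Filter.Tendsto (fun y : ℝ => C * Real.exp (-(c * |y|))) Filter.atBot (nhds (C * 0)) :=
    (Real.tendsto_exp_neg_atTop_nhds_zero.comp
      (Filter.tendsto_abs_atBot_atTop.const_mul_atTop hc)).const_mul C
  rw [mul_zero] at h1
  exact squeeze_zero (fun y => (w_pos z y).le) hw h1

lemma K1 {z : ℝ} (hz : 0 < z) (x : ℝ) : ∫ y in Ioi x, min y z * w z y = w z x := by
  have := integral_Ioi_of_hasDerivAt_of_tendsto' (a := x) (f := fun y => - w z y)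
    (f' := fun y => min y z * w z y) (m := 0)
    (fun y _ => by convert! (w_deriv z y).neg using 1; ring) (int_min hz).integrableOn
    (by simpa using (w_top hz).neg)
  simpa using this

lemma K2 {z : ℝ} (hz : 0 < z) (x : ℝ) : ∫ y in Iic x, min y z * w z y = - w z x := by
  have := integral_Iic_of_hasDerivAt_of_tendsto' (a := x) (f := fun y => - w z y)
    (f' := fun y => min y z * w z y) (m := 0)
    (fun y _ => by convert! (w_deriv z y).neg using 1; ring) (int_min hz).integrableOn
    (by simpa using (w_bot hz).neg)
  simpa using this

lemma shiftR (f : ℝ → ℝ) (x : ℝ) : ∫ y in Ioi x, f y = ∫ s in Ioi (0:ℝ), f (x + s) := by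
  have := (measurePreserving_add_left volume x).setIntegral_preimage_emb
    (measurableEmbedding_addLeft x) f (Ioi x)
  rw [← this]; simp

lemma shiftL (f : ℝ → ℝ) (x : ℝ) : ∫ y in Iic x, f y = ∫ s in Ioi (0:ℝ), f (x - s) := by
  have h := integral_comp_neg_Ioi (-x) f
  rw [neg_neg] at h
  rw [← h, shiftR]
  congr 1; ext s; congr 1; ring

end ErlangC
namespace ErlangC

/-- Half-line estimate behind the gradient bounds. -/
lemma half_line {t A φ0 : ℝ} (ht : 1 ≤ t) (hA : 0 ≤ A) (v φ r : ℝ → ℝ)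
    (hv : Continuous v) (hφ : Continuous φ) (hr : Continuous r)
    (hv0 : ∀ s, 0 < s → 0 ≤ v s) (hv1 : ∀ s, 0 < s → v s ≤ Real.exp (-(t * s)))
    (hφ1 : ∀ s, 0 < s → |φ s - φ0| ≤ s) (hφ0 : |φ0| ≤ t + A)
    (hr0 : ∀ s, 0 < s → 0 ≤ r s)
    (hr1 : ∀ s, 0 < s → r s ≤ t + s) (hrv : ∫ s in Ioi (0:ℝ), r s * v s = 1) :
    |∫ s in Ioi (0:ℝ), φ s * v s| ≤ 2 + A ∧
      t * |φ0 - t * ∫ s in Ioi (0:ℝ), φ s * v s| ≤ 2 + A := by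
  have ht0 : 0 < t := by linarith
  have iv : IntegrableOn v (Ioi 0) := by
    refine (int_exp ht0).mono' hv.aestronglyMeasurable ?_
    refine (ae_restrict_iff' measurableSet_Ioi).2 (Filter.Eventually.of_forall fun s hs => ?_)
    rw [Real.norm_eq_abs, abs_of_nonneg (hv0 s hs)]; exact hv1 s hs
  have isv : IntegrableOn (fun s => s * v s) (Ioi 0) := by
    refine (int_mul_exp ht0).mono' (continuous_id.mul hv).aestronglyMeasurable ?_
    refine (ae_restrict_iff' measurableSet_Ioi).2 (Filter.Eventually.of_forall fun s hs => ?_)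
    have hs' : 0 < s := hs
    rw [Real.norm_eq_abs, abs_of_nonneg (mul_nonneg hs'.le (hv0 s hs))]
    exact mul_le_mul_of_nonneg_left (hv1 s hs) hs'.le
  have idv : IntegrableOn (fun s => (φ s - φ0) * v s) (Ioi 0) := by
    refine isv.mono' ((hφ.sub continuous_const).mul hv).aestronglyMeasurable ?_
    refine (ae_restrict_iff' measurableSet_Ioi).2 (Filter.Eventually.of_forall fun s hs => ?_)
    rw [Real.norm_eq_abs, abs_mul, abs_of_nonneg (hv0 s hs)]
    exact mul_le_mul_of_nonneg_right (hφ1 s hs) (hv0 s hs)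
  set J := ∫ s in Ioi (0:ℝ), φ s * v s with hJ
  set I0 := ∫ s in Ioi (0:ℝ), v s with hI0
  set I1 := ∫ s in Ioi (0:ℝ), s * v s with hI1
  have I0n : 0 ≤ I0 := setIntegral_nonneg measurableSet_Ioi hv0
  have I1n : 0 ≤ I1 := setIntegral_nonneg measurableSet_Ioi
    fun s hs => mul_nonneg (le_of_lt hs) (hv0 s hs)
  have I0b : I0 ≤ 1 / t := by
    rw [← integral_exp ht0]
    exact setIntegral_mono_on iv (int_exp ht0) measurableSet_Ioi hv1
  have I1b : I1 ≤ 1 / t ^ 2 := by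
    rw [← integral_mul_exp ht0]
    exact setIntegral_mono_on isv (int_mul_exp ht0) measurableSet_Ioi
      fun s hs => mul_le_mul_of_nonneg_left (hv1 s hs) (le_of_lt hs)
  have hone : 1 ≤ t * I0 + I1 := by
    have h2 : ∫ s in Ioi (0:ℝ), (t * v s + s * v s) = t * I0 + I1 := by
      rw [integral_add (iv.const_mul t) isv, integral_const_mul]
    rw [← h2, ← hrv]
    have irv : IntegrableOn (fun s => r s * v s) (Ioi 0) := by
      refine ((iv.const_mul t).add isv).mono' (hr.mul hv).aestronglyMeasurable ?_
      refine (ae_restrict_iff' measurableSet_Ioi).2 (Filter.Eventually.of_forall fun s hs => ?_)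
      rw [Real.norm_eq_abs, abs_of_nonneg (mul_nonneg (hr0 s hs) (hv0 s hs))]
      have := mul_le_mul_of_nonneg_right (hr1 s hs) (hv0 s hs)
      simp only [Pi.add_apply]; linarith
    refine setIntegral_mono_on irv ((iv.const_mul t).add isv) measurableSet_Ioi fun s hs => ?_
    have := mul_le_mul_of_nonneg_right (hr1 s hs) (hv0 s hs)
    linarith
  have hJ1 : |J - φ0 * I0| ≤ I1 := by
    have h3 : J - φ0 * I0 = ∫ s in Ioi (0:ℝ), (φ s - φ0) * v s := by
      have h4 : ∫ s in Ioi (0:ℝ), ((φ s - φ0) * v s + φ0 * v s) =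
          (∫ s in Ioi (0:ℝ), (φ s - φ0) * v s) + φ0 * I0 := by
        rw [integral_add idv (iv.const_mul φ0), integral_const_mul]
      have h5 : J = ∫ s in Ioi (0:ℝ), ((φ s - φ0) * v s + φ0 * v s) := by
        rw [hJ]; congr 1; ext s; ring
      rw [h5, h4]; ring
    rw [h3, ← Real.norm_eq_abs]
    refine norm_integral_le_of_norm_le isv ?_
    refine (ae_restrict_iff' measurableSet_Ioi).2 (Filter.Eventually.of_forall fun s hs => ?_)
    rw [Real.norm_eq_abs, abs_mul, abs_of_nonneg (hv0 s hs)]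
    exact mul_le_mul_of_nonneg_right (hφ1 s hs) (hv0 s hs)
  have tI0 : t * I0 ≤ 1 := by rwa [le_div_iff₀' ht0] at I0b
  have tI1 : t ^ 2 * I1 ≤ 1 := by rwa [le_div_iff₀' (by positivity)] at I1b
  have I0le : I0 ≤ 1 := by nlinarith
  have tI1' : t * I1 ≤ 1 := by nlinarith [mul_nonneg ht0.le I1n]
  have I1le : I1 ≤ 1 := by nlinarith
  constructor
  · have : |J| ≤ |J - φ0 * I0| + |φ0| * I0 := by
      calc |J| = |(J - φ0 * I0) + φ0 * I0| := by ring_nf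
        _ ≤ |J - φ0 * I0| + |φ0 * I0| := abs_add_le _ _
        _ = _ := by rw [abs_mul, abs_of_nonneg I0n]
    have h6 : |φ0| * I0 ≤ (t + A) * I0 := mul_le_mul_of_nonneg_right hφ0 I0n
    nlinarith
  · have h7 : |φ0 - t * J| ≤ |φ0| * (1 - t * I0) + t * |J - φ0 * I0| := by
      calc |φ0 - t * J| = |φ0 * (1 - t * I0) - t * (J - φ0 * I0)| := by ring_nf
        _ ≤ |φ0 * (1 - t * I0)| + |t * (J - φ0 * I0)| := abs_sub _ _
        _ = _ := by rw [abs_mul, abs_mul, abs_of_pos ht0, abs_of_nonneg (sub_nonneg.2 tI0)]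
    have h8 : |φ0| * (1 - t * I0) ≤ (t + A) * I1 :=
      mul_le_mul hφ0 (by linarith) (by linarith) (by linarith)
    have h9 : t * |J - φ0 * I0| ≤ t * I1 := mul_le_mul_of_nonneg_left hJ1 ht0.le
    have h10 : |φ0 - t * J| ≤ 2 * (t * I1) + A * I1 := by nlinarith
    have h11 := mul_le_mul_of_nonneg_left h10 ht0.le
    have h12 : A * (t * I1) ≤ A := by nlinarith
    nlinarith

/-- Derivative of the Stein solution. -/
noncomputable def g (z : ℝ) (f : ℝ → ℝ) (x : ℝ) : ℝ := (∫ y in Iic x, f y * w z y) / w z x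

structure Adm (z : ℝ) (f : ℝ → ℝ) (A : ℝ) : Prop where
  hz : 0 < z
  hA : 0 ≤ A
  lip : ∀ x y, |f x - f y| ≤ |x - y|
  bd : ∀ y, |f y| ≤ |y| + A
  zero : ∫ y, f y * w z y = 0

variable {z A : ℝ} {f : ℝ → ℝ}

lemma Adm.cont (H : Adm z f A) : Continuous f :=
  (LipschitzWith.of_dist_le_mul (K := 1) (fun x y => by
    simpa [Real.dist_eq] using H.lip x y)).continuous

lemma Adm.int (H : Adm z f A) : Integrable fun y => f y * w z y :=
  int_lin H.hz f H.cont A H.bd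

lemma g_deriv (H : Adm z f A) (x : ℝ) : HasDerivAt (g z f) (f x + min x z * g z f x) x := by
  have hc : Continuous fun y => f y * w z y := H.cont.mul (w_cont z)
  have h1 : HasDerivAt (fun x => ∫ y in Iic x, f y * w z y) (f x * w z x) x := by
    have h2 : (fun x => ∫ y in Iic x, f y * w z y) =
        fun x => (∫ y in Iic (0:ℝ), f y * w z y) + ∫ y in (0:ℝ)..x, f y * w z y := by
      ext x
      rw [← intervalIntegral.integral_Iic_sub_Iic H.int.integrableOn H.int.integrableOn]; ring
    rw [h2]
    exact (intervalIntegral.integral_hasDerivAt_right (hc.intervalIntegrable _ _)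
      hc.stronglyMeasurable.stronglyMeasurableAtFilter hc.continuousAt).const_add _
  have hw := (w_pos z x).ne'
  convert! h1.div (w_deriv z x) hw using 1
  unfold g
  field_simp
  ring

lemma g_left (x : ℝ) : g z f x = ∫ s in Ioi (0:ℝ), f (x - s) * (w z (x - s) / w z x) := by
  unfold g
  rw [shiftL, ← integral_div]
  congr 1; ext s; ring

lemma g_right (H : Adm z f A) (x : ℝ) :
    g z f x = -∫ s in Ioi (0:ℝ), f (x + s) * (w z (x + s) / w z x) := by
  unfold g
  have h1 : (∫ y in Iic x, f y * w z y) + ∫ y in Ioi x, f y * w z y = 0 := by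
    rw [intervalIntegral.integral_Iic_add_Ioi H.int.integrableOn H.int.integrableOn, H.zero]
  rw [eq_neg_of_add_eq_zero_left h1, shiftR, neg_div, ← integral_div]
  congr 2; ext s; ring

lemma bound_neg (H : Adm z f A) {x : ℝ} (hx : x ≤ -1) :
    |g z f x| ≤ 2 + A ∧ |x| * |f x + min x z * g z f x| ≤ 2 + A := by
  have hz := H.hz
  have hm : min x z = x := min_eq_left (by linarith)
  have hwx := w_pos z x
  have wc := w_cont z
  have fc := H.cont
  have := half_line (t := -x) (A := A) (φ0 := f x) (by linarith) H.hA
    (fun s => w z (x - s) / w z x) (fun s => f (x - s)) (fun s => -(x - s))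
    (by fun_prop) (by fun_prop) (by fun_prop)
    (fun s _ => div_nonneg (w_pos _ _).le hwx.le)
    (fun s _ => by
      rw [div_le_iff₀' hwx]
      refine (w_ratio z x (x - s)).trans_eq ?_
      rw [hm]; ring_nf)
    (fun s hs => (H.lip _ _).trans (by simp [abs_of_pos hs]))
    (by have := H.bd x; rwa [abs_of_neg (show x < 0 by linarith)] at this)
    (fun s hs => by linarith) (fun s hs => by linarith)
    (by
      have k := K2 hz x
      rw [shiftL] at k
      have : ∀ s ∈ Ioi (0:ℝ), -(x - s) * (w z (x - s) / w z x) =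
          -(min (x - s) z * w z (x - s)) / w z x := by
        intro s hs
        have hs' : 0 < s := hs
        rw [min_eq_left (by linarith)]; ring
      rw [setIntegral_congr_fun measurableSet_Ioi this, integral_div, integral_neg, k, neg_neg,
        div_self hwx.ne'])
  rw [← g_left] at this
  rw [hm, abs_of_neg (show x < 0 by linarith)]
  refine ⟨this.1, ?_⟩
  have h2 := this.2
  rwa [neg_mul x (g z f x), sub_neg_eq_add] at h2

lemma bound_pos (H : Adm z f A) {x : ℝ} (hx : 1 ≤ x) (hxz : x ≤ z) :
    |g z f x| ≤ 2 + A ∧ |x| * |f x + min x z * g z f x| ≤ 2 + A := by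
  have hz := H.hz
  have hm : min x z = x := min_eq_left (by linarith)
  have hwx := w_pos z x
  have wc := w_cont z
  have fc := H.cont
  have := half_line (t := x) (A := A) (φ0 := f x) (by linarith) H.hA
    (fun s => w z (x + s) / w z x) (fun s => f (x + s)) (fun s => min (x + s) z)
    (by fun_prop) (by fun_prop) (by fun_prop)
    (fun s _ => div_nonneg (w_pos _ _).le hwx.le)
    (fun s _ => by
      rw [div_le_iff₀' hwx]
      refine (w_ratio z x (x + s)).trans_eq ?_
      rw [hm]; ring_nf)
    (fun s hs => (H.lip _ _).trans (by simp [abs_of_pos hs]))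
    (by have := H.bd x; rwa [abs_of_pos (show 0 < x by linarith)] at this)
    (fun s hs => le_min (by linarith) hz.le) (fun s hs => min_le_left _ _)
    (by
      have k := K1 hz x
      rw [shiftR] at k
      simp_rw [← mul_div_assoc]
      rw [integral_div, k, div_self hwx.ne'])
  rw [← neg_eq_iff_eq_neg.2 (g_right H x)] at this
  rw [hm, abs_of_pos (show 0 < x by linarith)]
  refine ⟨by simpa using this.1, ?_⟩
  have h2 := this.2
  rwa [mul_neg, sub_neg_eq_add] at h2

lemma bound_mid (H : Adm z f A) {x : ℝ} (hx : |x| ≤ 1) (hxz : x ≤ z) :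
    |g z f x| ≤ 6 * (1 + A) := by
  have hz := H.hz
  have hA := H.hA
  have hwx := w_pos z x
  have i1 : Integrable fun y : ℝ => |y| * Real.exp (-(1 * |y|)) := int_abs (int_mul_exp one_pos)
  have i2 : Integrable fun y : ℝ => Real.exp (-(1 * |y|)) := int_abs (int_exp one_pos)
  have e1 : ∫ y : ℝ, |y| * Real.exp (-(1 * |y|)) = 2 := by
    have := integral_comp_abs (f := fun y : ℝ => y * Real.exp (-(1 * y)))
    rw [integral_mul_exp one_pos] at this
    rw [this]; norm_num
  have e2 : ∫ y : ℝ, Real.exp (-(1 * |y|)) = 2 := by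
    have := integral_comp_abs (f := fun y : ℝ => Real.exp (-(1 * y)))
    rw [integral_exp one_pos] at this
    rw [this]; norm_num
  set E := Real.exp (1 / 2) with hE
  have hE0 : 0 < E := Real.exp_pos _
  set F : ℝ → ℝ := fun y => E * (|y| * Real.exp (-(1 * |y|)) + A * Real.exp (-(1 * |y|))) with hF
  have iF : Integrable F := (i1.add (i2.const_mul A)).const_mul E
  have eF : ∫ y, F y = E * (2 + 2 * A) := by
    rw [hF, integral_const_mul, integral_add i1 (i2.const_mul A), integral_const_mul, e1, e2]; ring
  have hb : |∫ y in Iic x, f y * w z y| ≤ ∫ y in Iic x, F y := by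
    rw [← Real.norm_eq_abs]
    refine norm_integral_le_of_norm_le iF.integrableOn ?_
    refine (ae_restrict_iff' measurableSet_Iic).2 (Filter.Eventually.of_forall fun y hy => ?_)
    have hy' : y ≤ x := hy
    have hwy : w z y ≤ E * Real.exp (-(1 * |y|)) := by
      unfold w
      rw [B_left hz (hy'.trans hxz), hE, ← Real.exp_add, Real.exp_le_exp]
      nlinarith [sq_nonneg (|y| - 1), sq_abs y]
    rw [Real.norm_eq_abs, abs_mul, abs_of_pos (w_pos z y)]
    calc |f y| * w z y ≤ (|y| + A) * (E * Real.exp (-(1 * |y|))) :=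
          mul_le_mul (H.bd y) hwy (w_pos z y).le (by positivity)
      _ = F y := by rw [hF]; ring
  have hb2 : ∫ y in Iic x, F y ≤ ∫ y, F y :=
    setIntegral_le_integral iF (Filter.Eventually.of_forall fun y => by
      simp only [hF, Pi.zero_apply]; positivity)
  have hwl : 1 ≤ E * w z x := by
    unfold w
    rw [B_left hz hxz, hE, ← Real.exp_add]
    apply Real.one_le_exp
    nlinarith [sq_abs x, abs_nonneg x]
  have hEE : E * E ≤ 3 := by
    rw [hE, ← Real.exp_add]; norm_num
    linarith [Real.exp_one_lt_d9]
  unfold g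
  rw [abs_div, abs_of_pos hwx, div_le_iff₀ hwx]
  have h3 : E * (2 + 2 * A) ≤ 6 * (1 + A) * w z x := by
    have h4 : E * (2 + 2 * A) ≤ E * (2 + 2 * A) * (E * w z x) :=
      le_mul_of_one_le_right (by positivity) hwl
    have h5 : E * (2 + 2 * A) * (E * w z x) = (E * E) * ((2 + 2 * A) * w z x) := by ring
    have h6 : (E * E) * ((2 + 2 * A) * w z x) ≤ 3 * ((2 + 2 * A) * w z x) :=
      mul_le_mul_of_nonneg_right hEE (by positivity)
    linarith
  linarith

lemma bound_all (H : Adm z f A) {x : ℝ} (hxz : x ≤ z) :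
    |g z f x| ≤ 6 * (1 + A) ∧ |x| * |f x + min x z * g z f x| ≤ 7 * (1 + A) := by
  have hA := H.hA
  rcases le_total (|x|) 1 with hx | hx
  · have h1 := bound_mid H hx hxz
    refine ⟨h1, ?_⟩
    rw [min_eq_left hxz]
    have h2 : |f x + x * g z f x| ≤ |f x| + |x| * |g z f x| := by
      rw [← abs_mul]; exact abs_add_le _ _
    have h3 := H.bd x
    have h4 := abs_nonneg x
    have h5 : |x| * |g z f x| ≤ 1 * |g z f x| := mul_le_mul_of_nonneg_right hx (abs_nonneg _)
    have h6 : |x| * |f x + x * g z f x| ≤ 1 * |f x + x * g z f x| :=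
      mul_le_mul_of_nonneg_right hx (abs_nonneg _)
    linarith
  · rcases le_abs.1 hx with h | h
    · have := bound_pos H h hxz
      exact ⟨by linarith [this.1], by linarith [this.2]⟩
    · have := bound_neg H (x := x) (by linarith)
      exact ⟨by linarith [this.1], by linarith [this.2]⟩

/-- The derivative of `g`. -/
noncomputable def g1 (z : ℝ) (f : ℝ → ℝ) (x : ℝ) : ℝ := f x + min x z * g z f x

lemma g1_left (H : Adm z f A) {x y : ℝ} (hx : x ≤ z) (hy : y ≤ z) :
    |g1 z f x - g1 z f y| ≤ (14 * (1 + A)) * |x - y| := by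
  have hA := H.hA
  have h1 : |x * g z f x - y * g z f y| ≤ (13 * (1 + A)) * |x - y| := by
    have := Convex.norm_image_sub_le_of_norm_hasDerivWithin_le (s := Iic z)
      (f := fun x => x * g z f x) (f' := fun x => 1 * g z f x + x * (f x + min x z * g z f x))
      (C := 13 * (1 + A)) (x := y) (y := x)
      (fun t _ => ((hasDerivAt_id t).mul (g_deriv H t)).hasDerivWithinAt)
      (fun t ht => by
        have hb := bound_all H (x := t) ht
        rw [Real.norm_eq_abs]
        refine (abs_add_le _ _).trans ?_
        rw [one_mul, abs_mul]; linarith [hb.1, hb.2])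
      (convex_Iic z) hy hx
    simpa [Real.norm_eq_abs] using this
  unfold g1
  rw [min_eq_left hx, min_eq_left hy]
  have h2 := H.lip x y
  have h3 : |f x + x * g z f x - (f y + y * g z f y)| ≤
      |f x - f y| + |x * g z f x - y * g z f y| := by
    rw [show f x + x * g z f x - (f y + y * g z f y) =
      (f x - f y) + (x * g z f x - y * g z f y) by ring]
    exact abs_add_le _ _
  nlinarith [abs_nonneg (x - y), mul_nonneg hA (abs_nonneg (x - y))]

lemma w_right {x s : ℝ} (hx : z ≤ x) (hs : 0 ≤ s) :
    w z (x + s) / w z x = Real.exp (-(z * s)) := by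
  unfold w
  rw [B_right hx hs, ← Real.exp_sub]; congr 1; ring

lemma g_lip_right (H : Adm z f A) {x y : ℝ} (hx : z ≤ x) (hy : z ≤ y) :
    |g z f x - g z f y| ≤ |x - y| / z := by
  have hz := H.hz
  have key : ∀ x, z ≤ x → g z f x = -∫ s in Ioi (0:ℝ), f (x + s) * Real.exp (-(z * s)) := by
    intro x hx
    rw [g_right H x]
    congr 1
    refine setIntegral_congr_fun measurableSet_Ioi fun s hs => ?_
    rw [w_right hx (le_of_lt hs)]
  have hint : ∀ x, IntegrableOn (fun s => f (x + s) * Real.exp (-(z * s))) (Ioi 0) := by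
    intro x
    have fc := H.cont
    refine ((int_mul_exp hz).add ((int_exp hz).const_mul (|x| + A))).mono'
      (Continuous.aestronglyMeasurable (by fun_prop)) ?_
    refine (ae_restrict_iff' measurableSet_Ioi).2 (Filter.Eventually.of_forall fun s hs => ?_)
    have hs' : 0 < s := hs
    rw [Real.norm_eq_abs, abs_mul, Real.abs_exp]
    have h1 := H.bd (x + s)
    have h2 := abs_add_le x s
    rw [abs_of_pos hs'] at h2
    have h3 : |f (x + s)| * Real.exp (-(z * s)) ≤ (s + (|x| + A)) * Real.exp (-(z * s)) :=
      mul_le_mul_of_nonneg_right (by linarith) (Real.exp_pos _).le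
    simp only [Pi.add_apply]; linarith
  rw [key x hx, key y hy, neg_sub_neg, ← integral_sub (hint y) (hint x), ← Real.norm_eq_abs]
  have h5 : |x - y| / z = ∫ s in Ioi (0:ℝ), |x - y| * Real.exp (-(z * s)) := by
    rw [integral_const_mul, integral_exp hz]; ring
  rw [h5]
  refine norm_integral_le_of_norm_le ((int_exp hz).const_mul _) (Filter.Eventually.of_forall fun s => ?_)
  rw [Real.norm_eq_abs, ← sub_mul, abs_mul, Real.abs_exp]
  refine mul_le_mul_of_nonneg_right ?_ (Real.exp_pos _).le
  refine (H.lip _ _).trans_eq ?_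
  rw [abs_sub_comm]; congr 1; ring

lemma g1_right (H : Adm z f A) {x y : ℝ} (hx : z ≤ x) (hy : z ≤ y) :
    |g1 z f x - g1 z f y| ≤ 2 * |x - y| := by
  have hz := H.hz
  unfold g1
  rw [min_eq_right hx, min_eq_right hy]
  have h1 := g_lip_right H hx hy
  rw [le_div_iff₀' hz] at h1
  have h3 : |f x + z * g z f x - (f y + z * g z f y)| ≤
      |f x - f y| + z * |g z f x - g z f y| := by
    rw [show f x + z * g z f x - (f y + z * g z f y) =
      (f x - f y) + z * (g z f x - g z f y) by ring]
    refine (abs_add_le _ _).trans_eq ?_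
    rw [abs_mul, abs_of_pos hz]
  linarith [H.lip x y]

lemma g_mvt (H : Adm z f A) {x d : ℝ} (hd : 0 < d) :
    ∃ y ∈ Ioo x (x + d), g z f (x + d) - g z f x = d * g1 z f y := by
  obtain ⟨c, hc, h⟩ := exists_hasDerivAt_eq_slope (g z f) (g1 z f) (a := x) (b := x + d)
    (by linarith) (fun t _ => (g_deriv H t).continuousAt.continuousWithinAt)
    (fun t _ => g_deriv H t)
  refine ⟨c, hc, ?_⟩
  rw [h, add_sub_cancel_left]; field_simp

lemma diff_left (H : Adm z f A) {x d : ℝ} (hd : 0 < d) (hx : x + d ≤ z) :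
    |g1 z f x - (g z f (x + d) - g z f x) / d| ≤ 14 * (1 + A) * d := by
  have hA := H.hA
  obtain ⟨y, hy, h⟩ := g_mvt H (x := x) hd
  rw [h, mul_div_cancel_left₀ _ hd.ne']
  refine (g1_left H (by linarith) (by linarith [hy.2])).trans ?_
  refine mul_le_mul_of_nonneg_left ?_ (by positivity)
  rw [abs_sub_comm, abs_of_pos (by linarith [hy.1])]; linarith [hy.2]

lemma diff_right (H : Adm z f A) {x d : ℝ} (hd : 0 < d) (hx : z ≤ x) :
    |g1 z f x - (g z f (x + d) - g z f x) / d| ≤ 2 * d := by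
  obtain ⟨y, hy, h⟩ := g_mvt H (x := x) hd
  rw [h, mul_div_cancel_left₀ _ hd.ne']
  refine (g1_right H hx (by linarith [hy.1])).trans ?_
  refine mul_le_mul_of_nonneg_left ?_ (by norm_num)
  rw [abs_sub_comm, abs_of_pos (by linarith [hy.1])]; linarith [hy.2]

end ErlangC
namespace ErlangC

lemma w_zero {z : ℝ} (hz : 0 < z) : w z 0 = 1 := by
  unfold w; rw [B_left hz hz.le]; simp

lemma Z_ge_one {z : ℝ} (hz : 0 < z) : 1 ≤ ∫ y, w z y := by
  have h1 : ∫ y in Iic (0:ℝ), w z y ≤ ∫ y, w z y :=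
    setIntegral_le_integral (int_w hz) (Filter.Eventually.of_forall fun y => (w_pos z y).le)
  have h2 : ∫ y in Iic (0:ℝ), w z y = Real.sqrt (Real.pi / (1/2)) / 2 := by
    rw [← integral_gaussian_Ioi (1/2), shiftL]
    refine setIntegral_congr_fun measurableSet_Ioi fun s hs => ?_
    have hs' : 0 < s := hs
    unfold w
    rw [B_left hz (by linarith)]
    congr 1; ring
  have h3 : 2 ≤ Real.sqrt (Real.pi / (1/2)) := by
    apply Real.le_sqrt_of_sq_le
    linarith [Real.pi_gt_three]
  linarith

lemma Z_ge_tail {z : ℝ} (hz : 0 < z) : w z z / z ≤ ∫ y, w z y := by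
  have h1 : ∫ y in Ioi z, w z y ≤ ∫ y, w z y :=
    setIntegral_le_integral (int_w hz) (Filter.Eventually.of_forall fun y => (w_pos z y).le)
  have h2 : ∫ y in Ioi z, w z y = w z z / z := by
    rw [shiftR]
    have : ∀ s ∈ Ioi (0:ℝ), w z (z + s) = w z z * Real.exp (-(z * s)) := by
      intro s hs
      rw [← w_right le_rfl (le_of_lt hs), mul_div_cancel₀ _ (w_pos z z).ne']
    rw [setIntegral_congr_fun measurableSet_Ioi this, integral_const_mul, integral_exp hz]
    ring
  linarith

lemma abs_moment {z : ℝ} (hz : 0 < z) : ∫ y, |y| * w z y ≤ 2 + w z z / z ^ 2 := by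
  have ia : Integrable fun y => |y| * w z y :=
    int_lin hz _ continuous_abs 0 (fun y => by simp)
  have im : Integrable fun y => max (y - z) 0 * w z y :=
    int_lin hz _ (by fun_prop) z (fun y => by
      rcases le_total (y - z) 0 with h | h
      · rw [max_eq_right h]; simp; positivity
      · rw [max_eq_left h, abs_of_nonneg h]; linarith [le_abs_self y])
  rw [← intervalIntegral.integral_Iic_add_Ioi (b := 0) ia.integrableOn ia.integrableOn]
  have h1 : ∫ y in Iic (0:ℝ), |y| * w z y = 1 := by
    have : ∀ y ∈ Iic (0:ℝ), |y| * w z y = -(min y z * w z y) := by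
      intro y hy
      have hy' : y ≤ 0 := hy
      rw [abs_of_nonpos hy', min_eq_left (by linarith)]; ring
    rw [setIntegral_congr_fun measurableSet_Iic this, integral_neg, K2 hz, w_zero hz, neg_neg]
  have h2 : ∫ y in Ioi (0:ℝ), |y| * w z y = 1 + w z z / z ^ 2 := by
    have : ∀ y ∈ Ioi (0:ℝ), |y| * w z y = min y z * w z y + max (y - z) 0 * w z y := by
      intro y hy
      have hy' : 0 < y := hy
      rw [abs_of_pos hy']
      rcases le_total y z with h | h
      · rw [min_eq_left h, max_eq_right (by linarith)]; ring
      · rw [min_eq_right h, max_eq_left (by linarith)]; ring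
    rw [setIntegral_congr_fun measurableSet_Ioi this,
      integral_add (int_min hz).integrableOn im.integrableOn, K1 hz, w_zero hz]
    congr 1
    have h3 : ∫ y in Ioi (0:ℝ), max (y - z) 0 * w z y = ∫ y in Ioi z, max (y - z) 0 * w z y := by
      refine setIntegral_eq_of_subset_of_forall_sdiff_eq_zero measurableSet_Ioi
        (Ioi_subset_Ioi hz.le) fun y hy => ?_
      have : y ≤ z := not_lt.1 hy.2
      rw [max_eq_right (by linarith), zero_mul]
    rw [h3, shiftR]
    have : ∀ s ∈ Ioi (0:ℝ), max (z + s - z) 0 * w z (z + s) =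
        w z z * (s * Real.exp (-(z * s))) := by
      intro s hs
      have hs' : 0 < s := hs
      rw [← w_right le_rfl (le_of_lt hs), add_sub_cancel_left, max_eq_left hs'.le]
      have := (w_pos z z).ne'
      field_simp
    rw [setIntegral_congr_fun measurableSet_Ioi this, integral_const_mul, integral_mul_exp hz]
    ring
  linarith

lemma adm {z : ℝ} (hz : 0 < z) {h : ℝ → ℝ} (hLip : LipschitzWith 1 h) :
    Adm z (fun y => h y - (∫ x, h x * w z x) / ∫ x, w z x) (2 + 1 / z) := by
  have lip : ∀ x y, |h x - h y| ≤ |x - y| := fun x y => by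
    simpa [Real.dist_eq] using hLip.dist_le_mul x y
  have hc := hLip.continuous
  set Z := ∫ x, w z x with hZ
  have Z1 := Z_ge_one hz
  have Z2 := Z_ge_tail hz
  rw [← hZ] at Z1 Z2
  have ih : Integrable fun y => h y * w z y := int_lin hz h hc (|h 0|) (fun y => by
    have := lip y 0
    rw [sub_zero] at this
    have h2 := abs_add_le (h y - h 0) (h 0)
    rw [sub_add_cancel] at h2
    linarith)
  have ia : Integrable fun y => |y| * w z y :=
    int_lin hz _ continuous_abs 0 (fun y => by simp)
  have key : |h 0 - (∫ x, h x * w z x) / Z| ≤ 2 + 1 / z := by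
    have h1 : h 0 - (∫ x, h x * w z x) / Z = (∫ x, (h 0 - h x) * w z x) / Z := by
      have : ∫ x, (h 0 - h x) * w z x = h 0 * Z - ∫ x, h x * w z x := by
        simp_rw [sub_mul]
        rw [integral_sub ((int_w hz).const_mul _) ih, integral_const_mul]
      rw [this]; field_simp
    rw [h1, abs_div, abs_of_pos (show 0 < Z by linarith), div_le_iff₀ (show 0 < Z by linarith)]
    have h2 : |∫ x, (h 0 - h x) * w z x| ≤ ∫ x, |x| * w z x := by
      rw [← Real.norm_eq_abs]
      refine norm_integral_le_of_norm_le ia (Filter.Eventually.of_forall fun x => ?_)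
      rw [Real.norm_eq_abs, abs_mul, abs_of_pos (w_pos z x)]
      refine mul_le_mul_of_nonneg_right ?_ (w_pos z x).le
      simpa using lip 0 x
    have h3 := abs_moment hz
    have h4 : w z z / z ^ 2 = 1 / z * (w z z / z) := by field_simp
    have h5 : 1 / z * (w z z / z) ≤ 1 / z * Z := mul_le_mul_of_nonneg_left Z2 (by positivity)
    nlinarith
  refine ⟨hz, by positivity, fun x y => by simpa using lip x y, fun y => ?_, ?_⟩
  · have h1 := lip y 0
    rw [sub_zero] at h1
    have h2 := abs_add_le (h y - h 0) (h 0 - (∫ x, h x * w z x) / Z)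
    rw [sub_add_sub_cancel] at h2
    linarith
  · simp_rw [sub_mul]
    rw [integral_sub ih ((int_w hz).const_mul _), integral_const_mul]
    field_simp
    simp [hZ]

section discrete

variable {n : ℕ} {R δ z : ℝ} {pi : ℕ → ℝ}

lemma tele (hδ : 0 < δ) (hδR : δ ^ 2 * R = 1) (hz : z = δ * (n - R))
    (hflow : ∀ k : ℕ, R * pi k = min ((k : ℝ) + 1) (n : ℝ) * pi (k + 1)) (G : ℝ → ℝ) (N : ℕ) :
    ∑ k ∈ Finset.range N, pi k * ((G (δ * (k - R) + δ) - G (δ * (k - R))) / δ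
      - min (δ * (k - R)) z * G (δ * (k - R))) =
    δ * min (N : ℝ) n * pi N * G (δ * (N - R)) := by
  induction N with
  | zero => simp
  | succ N ih =>
    rw [Finset.sum_range_succ, ih]
    have h1 : min (δ * (N - R)) z = δ * (min (N : ℝ) n - R) := by
      rw [hz, ← mul_min_of_nonneg _ _ hδ.le, min_sub_sub_right]
    have h2 : δ * ((N : ℝ) - R) + δ = δ * (((N + 1 : ℕ) : ℝ) - R) := by push_cast; ring
    rw [h1, h2]
    have h3 := hflow N
    push_cast at h3 ⊢
    have h4 : 1 / δ = δ * R := by field_simp; linarith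
    rw [div_eq_mul_one_div, h4]
    linear_combination δ * G (δ * (N + 1 - R)) * h3

lemma tail (hn : 1 ≤ n)
    (hflow : ∀ k : ℕ, R * pi k = min ((k : ℝ) + 1) (n : ℝ) * pi (k + 1)) (j : ℕ) :
    pi (n + j) = pi n * (R / n) ^ j := by
  have hn' : (0:ℝ) < n := by exact_mod_cast hn
  induction j with
  | zero => simp
  | succ j ih =>
    have h := hflow (n + j)
    rw [min_eq_right (by push_cast; linarith [(Nat.cast_nonneg j : (0:ℝ) ≤ j)]), ih] at h
    rw [← add_assoc, pow_succ, ← mul_assoc, ← mul_div_assoc, eq_div_iff hn'.ne']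
    linarith

lemma mass (hn : 1 ≤ n) (hR : 0 < R) (hRn : R < n) (hpi_sum : (∑' k : ℕ, pi k) = 1)
    (hflow : ∀ k : ℕ, R * pi k = min ((k : ℝ) + 1) (n : ℝ) * pi (k + 1)) :
    n * pi n = (n - R) * (1 - ∑ k ∈ Finset.range n, pi k) := by
  have hn' : (0:ℝ) < n := by exact_mod_cast hn
  have hs : Summable pi := by
    by_contra hc
    rw [tsum_eq_zero_of_not_summable hc] at hpi_sum
    norm_num at hpi_sum
  have h1 := hs.sum_add_tsum_nat_add n
  have h2 : ∑' j, pi (j + n) = pi n * (1 - R / n)⁻¹ := by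
    rw [← tsum_geometric_of_lt_one (by positivity) ((div_lt_one hn').2 hRn), ← tsum_mul_left]
    congr 1; ext j
    rw [add_comm j n, tail hn hflow]
  have h3 : 1 - ∑ k ∈ Finset.range n, pi k = pi n * (1 - R / n)⁻¹ := by linarith
  have h4 : (n : ℝ) - R ≠ 0 := by linarith
  have h5 : 1 - R / n = (n - R) / n := by field_simp
  rw [h3, h5, inv_div]
  field_simp

lemma Q_bound (hn : 1 ≤ n) (hR : 0 < R) (hRn : R < n) (hδ : 0 < δ) (hδR : δ ^ 2 * R = 1)
    (hz : z = δ * (n - R)) (hz1 : z ≤ 1)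
    (hpi_nonneg : ∀ k, 0 ≤ pi k) (hpi_sum : (∑' k : ℕ, pi k) = 1)
    (hflow : ∀ k : ℕ, R * pi k = min ((k : ℝ) + 1) (n : ℝ) * pi (k + 1)) :
    ∑ k ∈ Finset.range n, pi k ≤ 3 * z := by
  have hz0 : 0 < z := by rw [hz]; exact mul_pos hδ (by linarith)
  have ht := tele hδ hδR hz hflow (fun x => max x (-1) + 2) n
  have hm := mass hn hR hRn hpi_sum hflow
  set Q := ∑ k ∈ Finset.range n, pi k with hQ
  simp only [min_self] at ht
  rw [← hz, max_eq_left (by linarith)] at ht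
  have h1 : δ * n * pi n * (z + 2) = z * (1 - Q) * (z + 2) := by
    rw [hz]; linear_combination δ * (δ * (n - R) + 2) * hm
  have h2 : Q ≤ ∑ k ∈ Finset.range n, (pi k * ((max (δ * (k - R) + δ) (-1) + 2
      - (max (δ * (k - R)) (-1) + 2)) / δ
      - min (δ * (k - R)) z * (max (δ * (k - R)) (-1) + 2)) + pi k * (3 * z)) := by
    refine Finset.sum_le_sum fun k hk => ?_
    rw [← mul_add]
    refine le_mul_of_one_le_right (hpi_nonneg k) ?_
    have hk' : (k : ℝ) + 1 ≤ n := by exact_mod_cast Finset.mem_range.1 hk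
    set x := δ * ((k : ℝ) - R) with hx
    have hxz : x + δ ≤ z := by rw [hz, hx]; nlinarith
    rw [min_eq_left (by linarith)]
    rcases le_total (-1) x with h | h
    · rw [max_eq_left h, max_eq_left (by linarith)]
      have : (x + δ + 2 - (x + 2)) / δ = 1 := by
        rw [show x + δ + 2 - (x + 2) = δ by ring, div_self hδ.ne']
      rw [this]
      rcases le_total x 0 with h0 | h0 <;> nlinarith
    · rw [max_eq_right h]
      have : 0 ≤ (max (x + δ) (-1) + 2 - (-1 + 2)) / δ :=
        div_nonneg (by linarith [le_max_right (x + δ) (-1)]) hδ.le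
      nlinarith
  rw [Finset.sum_add_distrib, ht, ← Finset.sum_mul, ← hQ, h1] at h2
  have hQ1 : Q ≤ 1 := by
    have h3 : 0 ≤ (n:ℝ) * pi n := mul_nonneg (Nat.cast_nonneg n) (hpi_nonneg n)
    rw [hm] at h3
    have := nonneg_of_mul_nonneg_right h3 (by linarith)
    linarith
  have h4 : z * (1 - Q) * (z + 2) ≤ z * (1 - Q) * 3 :=
    mul_le_mul_of_nonneg_left (by linarith) (mul_nonneg hz0.le (by linarith))
  nlinarith

end discrete

end ErlangC

/-- Erlang-C: Wasserstein distance between the scaled stationary customer count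
and the diffusion approximation is at most `190 / √R`, universally in the
parameters satisfying `1 ≤ R < n`. -/
theorem erlangC_wasserstein
    (lam mu : ℝ) (n : ℕ)
    (hlam : 0 < lam) (hmu : 0 < mu) (hn : 1 ≤ n)
    (R δ ζ : ℝ)
    (hR : R = lam / mu) (hR1 : 1 ≤ R) (hRn : R < (n : ℝ))
    (hδ : δ = 1 / Real.sqrt R) (hζ : ζ = δ * (R - (n : ℝ)))
    (pi : ℕ → ℝ)
    (hpi_nonneg : ∀ k, 0 ≤ pi k)
    (hpi_sum : (∑' k : ℕ, pi k) = 1)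
    (hflow : ∀ k : ℕ, lam * pi k = mu * min ((k : ℝ) + 1) (n : ℝ) * pi (k + 1))
    (b : ℝ → ℝ)
    (hb : ∀ x : ℝ, b x = if x ≤ -ζ then -(mu * x) else mu * ζ)
    (kappa : ℝ) (hkappa : 0 < kappa)
    (nu : ℝ → ℝ)
    (hnu : ∀ x : ℝ, nu x = kappa * Real.exp ((1 / mu) * ∫ y in (0:ℝ)..x, b y))
    (hnu_norm : (∫ x : ℝ, nu x) = 1)
    (h : ℝ → ℝ) (hLip : LipschitzWith 1 h)
    (hsum : Summable fun k : ℕ => pi k * h (δ * ((k : ℝ) - R)))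
    (hint : Integrable fun x : ℝ => h x * nu x) :
    |(∑' k : ℕ, pi k * h (δ * ((k : ℝ) - R))) - (∫ x : ℝ, h x * nu x)|
      ≤ 190 / Real.sqrt R := by
  have hR0 : 0 < R := by linarith
  have hsq : 0 < Real.sqrt R := Real.sqrt_pos.2 hR0
  have hδ0 : 0 < δ := by rw [hδ]; positivity
  have hδR : δ ^ 2 * R = 1 := by
    rw [hδ, div_pow, Real.sq_sqrt hR0.le]; field_simp
  obtain ⟨z, hzdef⟩ : ∃ z, z = -ζ := ⟨_, rfl⟩
  have hz : z = δ * (n - R) := by rw [hzdef, hζ]; ring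
  have hz0 : 0 < z := by rw [hz]; exact mul_pos hδ0 (by linarith)
  have hfl : ∀ k : ℕ, R * pi k = min ((k : ℝ) + 1) (n : ℝ) * pi (k + 1) := by
    intro k
    have := hflow k
    rw [hR, div_mul_eq_mul_div, this]; field_simp
  -- the density
  have hnuw : ∀ x, nu x = kappa * ErlangC.w z x := by
    intro x
    rw [hnu x]
    unfold ErlangC.w ErlangC.B
    congr 2
    have : ∀ y, b y = -mu * min y z := by
      intro y
      rw [hb y, ← hzdef]
      split_ifs with hy
      · rw [min_eq_left hy]; ring
      · rw [min_eq_right (by linarith), hzdef]; ring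
    simp_rw [this]
    rw [intervalIntegral.integral_const_mul]
    field_simp
  have hkZ : kappa * ∫ x, ErlangC.w z x = 1 := by
    rw [← integral_const_mul, ← hnu_norm]
    congr 1; ext x; rw [hnuw]
  have hZ1 := ErlangC.Z_ge_one hz0
  have hH : (∫ x, h x * nu x) = (∫ x, h x * ErlangC.w z x) / ∫ x, ErlangC.w z x := by
    have : (∫ x, h x * nu x) = kappa * ∫ x, h x * ErlangC.w z x := by
      rw [← integral_const_mul]
      congr 1; ext x; rw [hnuw]; ring
    rw [this, eq_div_iff (by linarith)]
    linear_combination (∫ x, h x * ErlangC.w z x) * hkZ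
  have hAdm := ErlangC.adm hz0 hLip
  rw [← hH] at hAdm
  set H := ∫ x, h x * nu x with hHdef
  set f : ℝ → ℝ := fun y => h y - H with hf
  set A := 2 + 1 / z with hA
  have hpis : Summable pi := by
    by_contra hc
    rw [tsum_eq_zero_of_not_summable hc] at hpi_sum
    norm_num at hpi_sum
  set Q := ∑ k ∈ Finset.range n, pi k with hQ
  have hQ1 : Q ≤ 1 := by
    rw [← hpi_sum]; exact hpis.sum_le_tsum _ (fun k _ => hpi_nonneg k)
  have hQ0 : 0 ≤ Q := Finset.sum_nonneg fun k _ => hpi_nonneg k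
  have hAQ : 14 * (1 + A) * Q ≤ 168 := by
    rcases le_total z 1 with h1 | h1
    · have h3 := ErlangC.Q_bound hn hR0 hRn hδ0 hδR hz h1 hpi_nonneg hpi_sum hfl
      have h4 : 1 + A ≤ 4 / z := by
        rw [hA, le_div_iff₀ hz0]; field_simp; linarith
      calc 14 * (1 + A) * Q ≤ 14 * (4 / z) * (3 * z) := by
            refine mul_le_mul (by linarith) h3 hQ0 (by positivity)
        _ = 168 := by field_simp; norm_num
    · have h4 : 1 / z ≤ 1 := by rw [div_le_one hz0]; exact h1
      nlinarith
  -- partial sums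
  set G := ErlangC.g z f with hG
  set D : ℕ → ℝ := fun k => ErlangC.g1 z f (δ * (k - R)) -
    (G (δ * (k - R) + δ) - G (δ * (k - R))) / δ with hD
  have hpart : ∀ N : ℕ, ∑ k ∈ Finset.range N, pi k * f (δ * (k - R)) =
      ∑ k ∈ Finset.range N, pi k * D k + δ * min (N : ℝ) n * pi N * G (δ * (N - R)) := by
    intro N
    rw [← ErlangC.tele hδ0 hδR hz hfl G N, ← Finset.sum_add_distrib]
    refine Finset.sum_congr rfl fun k _ => ?_
    simp only [hD, ErlangC.g1, hG]
    ring
  have hDb : ∀ j : ℕ, |∑ k ∈ Finset.range (n + j), pi k * D k| ≤ 170 * δ := by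
    intro j
    rw [Finset.sum_range_add]
    have h1 : |∑ k ∈ Finset.range n, pi k * D k| ≤ 14 * (1 + A) * δ * Q := by
      rw [hQ, Finset.mul_sum]
      refine (Finset.abs_sum_le_sum_abs _ _).trans (Finset.sum_le_sum fun k hk => ?_)
      rw [abs_mul, abs_of_nonneg (hpi_nonneg k), mul_comm]
      refine mul_le_mul_of_nonneg_right ?_ (hpi_nonneg k)
      have hk' : (k : ℝ) + 1 ≤ n := by exact_mod_cast Finset.mem_range.1 hk
      exact ErlangC.diff_left hAdm hδ0 (by rw [hz]; nlinarith)
    have h2 : |∑ i ∈ Finset.range j, pi (n + i) * D (n + i)| ≤ 2 * δ := by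
      have h3 : ∑ i ∈ Finset.range j, pi (n + i) ≤ 1 := by
        have h4 := hpis.sum_le_tsum (Finset.range (n + j)) (fun k _ => hpi_nonneg k)
        rw [hpi_sum, Finset.sum_range_add] at h4
        linarith
      have h5 : |∑ i ∈ Finset.range j, pi (n + i) * D (n + i)| ≤
          2 * δ * ∑ i ∈ Finset.range j, pi (n + i) := by
        rw [Finset.mul_sum]
        refine (Finset.abs_sum_le_sum_abs _ _).trans (Finset.sum_le_sum fun i _ => ?_)
        rw [abs_mul, abs_of_nonneg (hpi_nonneg _), mul_comm]
        refine mul_le_mul_of_nonneg_right ?_ (hpi_nonneg _)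
        refine ErlangC.diff_right hAdm hδ0 ?_
        rw [hz]; push_cast
        have : (0:ℝ) ≤ i := Nat.cast_nonneg i
        nlinarith
      nlinarith
    have h6 := abs_add_le (∑ k ∈ Finset.range n, pi k * D k)
      (∑ i ∈ Finset.range j, pi (n + i) * D (n + i))
    nlinarith
  -- boundary term
  have hn' : (0:ℝ) < n := by exact_mod_cast hn
  have hbd : Filter.Tendsto (fun j : ℕ => δ * min ((n + j : ℕ) : ℝ) n * pi (n + j) *
      G (δ * ((n + j : ℕ) - R))) Filter.atTop (nhds 0) := by
    have hρ0 : 0 ≤ R / n := by positivity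
    have hρ1 : R / n < 1 := (div_lt_one hn').2 hRn
    have t1 := tendsto_pow_atTop_nhds_zero_of_lt_one hρ0 hρ1
    have t2 := tendsto_self_mul_const_pow_of_lt_one hρ0 hρ1
    have t3 := (t1.const_mul (δ * n * pi n * |G z|)).add (t2.const_mul (δ * n * pi n * (δ / z)))
    rw [mul_zero, mul_zero, add_zero] at t3
    refine squeeze_zero_norm (fun j => ?_) t3
    have hj : (0:ℝ) ≤ j := Nat.cast_nonneg j
    have hx : δ * (((n + j : ℕ) : ℝ) - R) = z + δ * j := by rw [hz]; push_cast; ring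
    rw [min_eq_right (by push_cast; linarith), hx, ErlangC.tail hn hfl j, Real.norm_eq_abs, abs_mul]
    have hc : 0 ≤ δ * n * (pi n * (R / n) ^ j) := by
      have := hpi_nonneg n
      positivity
    rw [abs_of_nonneg hc]
    have hg : |G (z + δ * j)| ≤ |G z| + δ / z * j := by
      have h1 := ErlangC.g_lip_right hAdm (x := z + δ * j) (y := z)
        (by nlinarith) le_rfl
      rw [add_sub_cancel_left, abs_of_nonneg (show 0 ≤ δ * (j:ℝ) by positivity)] at h1
      have h2 := abs_add_le (G (z + δ * j) - G z) (G z)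
      rw [sub_add_cancel] at h2
      have h3 : δ * j / z = δ / z * j := by ring
      linarith
    refine (mul_le_mul_of_nonneg_left hg hc).trans_eq ?_
    ring
  -- passing to the limit
  have hsf : HasSum (fun k : ℕ => pi k * f (δ * ((k : ℝ) - R)))
      ((∑' k : ℕ, pi k * h (δ * ((k : ℝ) - R))) - H) := by
    have h1 := hsum.hasSum.sub (hpis.hasSum.mul_right H)
    rw [hpi_sum, one_mul] at h1
    refine h1.congr_fun fun k => ?_
    simp only [hf]; ring
  have hlim : Filter.Tendsto (fun j : ℕ => ∑ k ∈ Finset.range (n + j), pi k * f (δ * (k - R)))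
      Filter.atTop (nhds ((∑' k : ℕ, pi k * h (δ * ((k : ℝ) - R))) - H)) := by
    have := (Filter.tendsto_add_atTop_iff_nat n).2 hsf.tendsto_sum_nat
    simpa [add_comm] using this
  have hlim2 := (hlim.sub hbd).abs
  rw [sub_zero] at hlim2
  have hfin : |(∑' k : ℕ, pi k * h (δ * ((k : ℝ) - R))) - H| ≤ 170 * δ := by
    refine le_of_tendsto hlim2 (Filter.Eventually.of_forall fun j => ?_)
    rw [hpart (n + j), add_sub_cancel_right]
    exact hDb j
  refine hfin.trans ?_
  rw [hδ, mul_one_div]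
  gcongr
  norm_num
end

section
/- There exists a nondecreasing function C_W : (0,∞) → (0,∞) such that for all integers n ≥ 1 and all λ > 0, μ > 0, α > 0 satisfying R = λ/μ ≥ 1, the Wasserstein distance between the scaled stationary Erlang-A customer count and its diffusion approximation satisfies d_W(X̃(∞), Y(∞)) ≤ C_W(α/μ)·δ, where δ = 1/√R. -/
open MeasureTheory Set

namespace ErlangA

/-- half-line Gaussian-type moments -/
noncomputable def gi (k : ℕ) (s b : ℝ) : ℝ :=
  ∫ t in Ioi (0:ℝ), t ^ k * Real.exp (b * t - s * t ^ 2 / 2)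

lemma gi_integrable_all (k : ℕ) {s : ℝ} (hs : 0 < s) (b : ℝ) :
    Integrable (fun t : ℝ => t ^ k * Real.exp (b * t - s * t ^ 2 / 2)) := by
  have h1 := integrable_rpow_mul_exp_neg_mul_sq (b := s / 4) (by positivity) (s := (k : ℝ))
    (by have : (0:ℝ) ≤ k := Nat.cast_nonneg k
        linarith)
  have h2 := (h1.norm.const_mul (Real.exp (b ^ 2 / s)))
  refine h2.mono' (by fun_prop) (Filter.Eventually.of_forall fun t => ?_)
  simp only [Real.rpow_natCast, norm_mul, Real.norm_eq_abs, Real.abs_exp]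
  have h3 : b * t - s * t ^ 2 / 2 ≤ b ^ 2 / s + (-(s / 4) * t ^ 2) := by
    have : 0 ≤ (b - s * t / 2) ^ 2 / s := by positivity
    have e : (b - s * t / 2) ^ 2 / s = b ^ 2 / s - b * t + s * t ^ 2 / 4 := by
      field_simp; ring
    rw [e] at this; linarith
  calc |t ^ k| * Real.exp (b * t - s * t ^ 2 / 2)
      ≤ |t ^ k| * Real.exp (b ^ 2 / s + (-(s / 4) * t ^ 2)) := by gcongr
    _ = _ := by rw [Real.exp_add]; ring

lemma gi_integrable (k : ℕ) {s : ℝ} (hs : 0 < s) (b : ℝ) :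
    IntegrableOn (fun t : ℝ => t ^ k * Real.exp (b * t - s * t ^ 2 / 2)) (Ioi 0) :=
  (gi_integrable_all k hs b).integrableOn

lemma exp_deriv (s b t : ℝ) : HasDerivAt (fun t : ℝ => Real.exp (b * t - s * t ^ 2 / 2))
    (Real.exp (b * t - s * t ^ 2 / 2) * (b - s * t)) t := by
  apply HasDerivAt.exp
  have h1 := (hasDerivAt_id t).const_mul b
  have h2 := (((hasDerivAt_id t).pow 2).const_mul s).div_const 2
  have := h1.sub h2
  refine (this.congr_deriv ?_)
  simp; ring

lemma gi_one {s : ℝ} (hs : 0 < s) (b : ℝ) : s * gi 1 s b = 1 + b * gi 0 s b := by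
  have i0 := gi_integrable 0 hs b
  have i1 := gi_integrable 1 hs b
  have e : (fun t : ℝ => Real.exp (b * t - s * t ^ 2 / 2) * (b - s * t)) = fun t =>
      b * (t ^ 0 * Real.exp (b * t - s * t ^ 2 / 2)) -
        s * (t ^ 1 * Real.exp (b * t - s * t ^ 2 / 2)) := by
    funext t; ring
  have hd : IntegrableOn (fun t : ℝ => Real.exp (b * t - s * t ^ 2 / 2) * (b - s * t)) (Ioi 0) := by
    rw [e]; exact (i0.const_mul b).sub (i1.const_mul s)
  have hz := tendsto_zero_of_hasDerivAt_of_integrableOn_Ioi (fun t _ => exp_deriv s b t) hd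
    (by simpa using i0)
  have h := integral_Ioi_of_hasDerivAt_of_tendsto' (fun t _ => exp_deriv s b t) hd hz
  rw [e, integral_sub (i0.const_mul b) (i1.const_mul s), integral_const_mul,
    integral_const_mul] at h
  change b * gi 0 s b - s * gi 1 s b = _ at h
  simp at h
  linarith

lemma gi_two {s : ℝ} (hs : 0 < s) (b : ℝ) : s * gi 2 s b = gi 0 s b + b * gi 1 s b := by
  have i0 := gi_integrable 0 hs b
  have i1 := gi_integrable 1 hs b
  have i2 := gi_integrable 2 hs b
  have e : (fun t : ℝ => 1 * Real.exp (b * t - s * t ^ 2 / 2) +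
      t * (Real.exp (b * t - s * t ^ 2 / 2) * (b - s * t))) = fun t =>
      (t ^ 0 * Real.exp (b * t - s * t ^ 2 / 2) + b * (t ^ 1 * Real.exp (b * t - s * t ^ 2 / 2))) -
        s * (t ^ 2 * Real.exp (b * t - s * t ^ 2 / 2)) := by
    funext t; ring
  have hh : ∀ t : ℝ, HasDerivAt (fun t : ℝ => t * Real.exp (b * t - s * t ^ 2 / 2))
      (1 * Real.exp (b * t - s * t ^ 2 / 2) +
      t * (Real.exp (b * t - s * t ^ 2 / 2) * (b - s * t))) t :=
    fun t => (hasDerivAt_id t).mul (exp_deriv s b t)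
  have hd : IntegrableOn (fun t : ℝ => 1 * Real.exp (b * t - s * t ^ 2 / 2) +
      t * (Real.exp (b * t - s * t ^ 2 / 2) * (b - s * t))) (Ioi 0) := by
    rw [e]; exact (i0.add (i1.const_mul b)).sub (i2.const_mul s)
  have hz := tendsto_zero_of_hasDerivAt_of_integrableOn_Ioi (fun t _ => hh t) hd
    (by simpa using i1)
  have h := integral_Ioi_of_hasDerivAt_of_tendsto' (fun t _ => hh t) hd hz
  have ia : IntegrableOn (fun t : ℝ => t ^ 0 * Real.exp (b * t - s * t ^ 2 / 2) +
      b * (t ^ 1 * Real.exp (b * t - s * t ^ 2 / 2))) (Ioi 0) := i0.add (i1.const_mul b)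
  rw [e, integral_sub ia (i2.const_mul s),
    integral_add i0 (i1.const_mul b), integral_const_mul,
    integral_const_mul] at h
  change gi 0 s b + b * gi 1 s b - s * gi 2 s b = _ at h
  simp at h
  linarith

lemma gi_pos (k : ℕ) {s : ℝ} (hs : 0 < s) (b : ℝ) : 0 < gi k s b := by
  unfold gi
  rw [setIntegral_pos_iff_support_of_nonneg_ae]
  · have : Ioi (0:ℝ) ⊆ Function.support
        (fun t : ℝ => t ^ k * Real.exp (b * t - s * t ^ 2 / 2)) := by
      intro t ht
      have : 0 < t := ht
      exact (by positivity : t ^ k * Real.exp (b * t - s * t ^ 2 / 2) ≠ 0)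
    rw [inter_eq_self_of_subset_right this]
    simp
  · filter_upwards [ae_restrict_mem measurableSet_Ioi] with t ht
    have : (0:ℝ) < t := ht
    simp only [Pi.zero_apply]
    positivity
  · exact gi_integrable k hs b

lemma gi_mono {s : ℝ} (hs : 0 < s) {b b' : ℝ} (h : b ≤ b') : gi 0 s b ≤ gi 0 s b' := by
  refine setIntegral_mono_on (gi_integrable 0 hs b) (gi_integrable 0 hs b') measurableSet_Ioi ?_
  intro t ht
  have : (0:ℝ) < t := ht
  gcongr

/-- tangent line inequality in the tilt parameter -/
lemma gi_tangent {s : ℝ} (hs : 0 < s) (b b' : ℝ) :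
    gi 0 s b + (b' - b) * gi 1 s b ≤ gi 0 s b' := by
  have i0 := gi_integrable 0 hs b
  have i1 := gi_integrable 1 hs b
  have : gi 0 s b + (b' - b) * gi 1 s b = ∫ t in Ioi (0:ℝ),
      ((t ^ 0 * Real.exp (b * t - s * t ^ 2 / 2)) +
        (b' - b) * (t ^ 1 * Real.exp (b * t - s * t ^ 2 / 2))) := by
    rw [integral_add i0 (i1.const_mul _), integral_const_mul]; rfl
  rw [this]
  refine setIntegral_mono_on (i0.add (i1.const_mul _)) (gi_integrable 0 hs b') measurableSet_Ioi ?_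
  intro t ht
  have e : b' * t - s * t ^ 2 / 2 = (b * t - s * t ^ 2 / 2) + (b' - b) * t := by ring
  rw [e, Real.exp_add]
  have h1 := Real.add_one_le_exp ((b' - b) * t)
  have h2 := Real.exp_pos (b * t - s * t ^ 2 / 2)
  nlinarith

/-- `M₁ ≤ M₀²` -/
lemma gi_one_le_sq {s : ℝ} (hs : 0 < s) (b : ℝ) : gi 1 s b ≤ gi 0 s b ^ 2 := by
  have i0 := gi_integrable 0 hs b
  have i1 := gi_integrable 1 hs b
  have i2 := gi_integrable 2 hs b
  have p0 := gi_pos 0 hs b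
  have p1 := gi_pos 1 hs b
  have h1 := gi_one hs b
  have h2 := gi_two hs b
  set M0 := gi 0 s b with hM0
  set M1 := gi 1 s b with hM1
  set M2 := gi 2 s b with hM2
  have hn : 0 ≤ ∫ t in Ioi (0:ℝ), (M0 * t - M1) ^ 2 * Real.exp (b * t - s * t ^ 2 / 2) :=
    integral_nonneg fun t => by positivity
  have e : (fun t : ℝ => (M0 * t - M1) ^ 2 * Real.exp (b * t - s * t ^ 2 / 2)) = fun t =>
      (M0 ^ 2 * (t ^ 2 * Real.exp (b * t - s * t ^ 2 / 2)) -
        (2 * M0 * M1) * (t ^ 1 * Real.exp (b * t - s * t ^ 2 / 2))) +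
        M1 ^ 2 * (t ^ 0 * Real.exp (b * t - s * t ^ 2 / 2)) := by
    funext t; ring
  have ia : IntegrableOn (fun t : ℝ => M0 ^ 2 * (t ^ 2 * Real.exp (b * t - s * t ^ 2 / 2)) -
        (2 * M0 * M1) * (t ^ 1 * Real.exp (b * t - s * t ^ 2 / 2))) (Ioi 0) :=
    (i2.const_mul _).sub (i1.const_mul _)
  rw [e, integral_add ia (i0.const_mul _),
    integral_sub (i2.const_mul _) (i1.const_mul _), integral_const_mul, integral_const_mul,
    integral_const_mul] at hn
  change 0 ≤ M0 ^ 2 * M2 - 2 * M0 * M1 * M1 + M1 ^ 2 * M0 at hn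
  have h3 : 0 ≤ M0 * (M0 * M2 - M1 ^ 2) := by nlinarith
  have h4 : 0 ≤ M0 * M2 - M1 ^ 2 := nonneg_of_mul_nonneg_right h3 p0
  have h5 : 0 ≤ s * (M0 * M2 - M1 ^ 2) := by positivity
  have h6 : s * (M0 * M2 - M1 ^ 2) = M0 ^ 2 - M1 := by
    have : s * (M0 * M2 - M1 ^ 2) = M0 * (s * M2) - M1 * (s * M1) := by ring
    rw [this, h1, h2]; ring
  linarith

end ErlangA

namespace ErlangA

lemma lr_sum (p q y φ : ℕ → ℝ) (S Y P : ℝ) (hp0 : ∀ k, 0 ≤ p k)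
    (hp : HasSum p S) (hq : HasSum q S)
    (hlr : ∀ k, q (k + 1) * p k ≤ p (k + 1) * q k)
    (hz : ∀ k, 0 < p k ∨ q (k + 1) = 0)
    (hφ : Monotone φ) (hy : HasSum y Y) (hyq : ∀ k, y k ≤ q k * φ k)
    (hP : HasSum (fun k => p k * φ k) P) : Y ≤ P := by
  have hex : ∃ N, q N ≤ p N := by
    by_contra hne
    push Not at hne
    exact lt_irrefl S (hasSum_lt (fun k => (hne k).le) (hne 0) hp hq)
  classical
  set N := Nat.find hex with hN
  have hN1 : q N ≤ p N := Nat.find_spec hex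
  have hlt : ∀ k < N, p k ≤ q k := fun k hk => (not_le.mp (Nat.find_min hex hk)).le
  have hge : ∀ k, N ≤ k → q k ≤ p k := by
    intro k hk
    induction k, hk using Nat.le_induction with
    | base => exact hN1
    | succ k hk ih =>
      rcases hz k with h | h
      · have h1 : q (k + 1) * p k ≤ p (k + 1) * p k :=
          (hlr k).trans (mul_le_mul_of_nonneg_left ih (hp0 _))
        exact le_of_mul_le_mul_right h1 h
      · rw [h]; exact hp0 _
  have h1 : HasSum (fun k => y k - q k * φ N) (Y - S * φ N) := hy.sub (hq.mul_right _)
  have h2 : HasSum (fun k => p k * φ k - p k * φ N) (P - S * φ N) := hP.sub (hp.mul_right _)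
  have h3 := hasSum_le (fun k => ?_) h1 h2
  · linarith
  · have := hyq k
    rcases lt_or_ge k N with hk | hk
    · have a := hlt k hk
      have b := hφ hk.le
      nlinarith
    · have a := hge k hk
      have b := hφ hk
      nlinarith

/-- the cells -/
def cell (x0 δ : ℝ) : ℕ → Set ℝ
  | 0 => Iio (x0 + δ * 2)
  | (k + 1) => Ico (x0 + δ * (k + 2)) (x0 + δ * (k + 3))

lemma cell_meas (x0 δ : ℝ) (k : ℕ) : MeasurableSet (cell x0 δ k) := by
  cases k
  · exact measurableSet_Iio
  · exact measurableSet_Ico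

lemma cell_lt {x0 δ x : ℝ} {k : ℕ} (h : x ∈ cell x0 δ k) : x < x0 + δ * (k + 2) := by
  cases k with
  | zero => simpa [cell] using h
  | succ k => 
    have := h.2
    push_cast
    linarith

lemma cell_disj {x0 δ : ℝ} (hδ : 0 < δ) : Pairwise (Function.onFun Disjoint (cell x0 δ)) := by
  have key : ∀ i j : ℕ, i < j → Disjoint (cell x0 δ i) (cell x0 δ j) := by
    intro i j hij
    rw [Set.disjoint_left]
    intro x hi hj
    have h1 := cell_lt hi
    cases j with
    | zero => omega
    | succ j =>
      have h2 := hj.1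
      have : (i : ℝ) ≤ j := by exact_mod_cast Nat.lt_succ_iff.mp hij
      nlinarith
  intro i j hij
  rcases lt_or_gt_of_ne hij with h | h
  · exact key i j h
  · exact (key j i h).symm

lemma cell_union {x0 δ : ℝ} (hδ : 0 < δ) : (⋃ k, cell x0 δ k) = univ := by
  rw [eq_univ_iff_forall]
  intro x
  rw [mem_iUnion]
  rcases lt_or_ge x (x0 + δ * 2) with h | h
  · exact ⟨0, h⟩
  · have hz : 0 ≤ (x - x0) / δ - 2 := by
      rw [sub_nonneg, le_div_iff₀ hδ]; linarith
    refine ⟨⌊(x - x0) / δ - 2⌋₊ + 1, ?_, ?_⟩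
    · have := Nat.floor_le hz
      rw [le_sub_iff_add_le, le_div_iff₀ hδ] at this
      linarith
    · have := Nat.lt_floor_add_one ((x - x0) / δ - 2)
      rw [sub_lt_iff_lt_add, div_lt_iff₀ hδ] at this
      linarith

lemma cell_sub {x0 δ : ℝ} (k : ℕ) :
    Ico (x0 + δ * (k + 1)) (x0 + δ * (k + 2)) ⊆ cell x0 δ k := by
  intro x hx
  cases k with
  | zero => simpa [cell] using hx.2
  | succ k =>
    have h1 := hx.1
    have h2 := hx.2
    push_cast at h1 h2
    exact ⟨by linarith, by linarith⟩

theorem dom {x0 δ : ℝ} (hδ : 0 < δ) (p : ℕ → ℝ) (ω : ℝ → ℝ) (hω0 : ∀ x, 0 ≤ ω x)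
    (hω : Integrable ω) (hp0 : ∀ k, 0 ≤ p k) (hp : HasSum p (∫ x, ω x))
    (hlr : ∀ (k : ℕ) (x : ℝ), x0 + δ * (k + 1) ≤ x → ω (x + δ) * p k ≤ p (k + 1) * ω x)
    (hz : ∀ k : ℕ, 0 < p k ∨ ∀ x, x0 + δ * (k + 2) ≤ x → ω x = 0)
    (φ : ℝ → ℝ) (hφ : Monotone φ) (hφω : Integrable fun x => φ x * ω x) (P : ℝ)
    (hP : HasSum (fun k : ℕ => p k * φ (x0 + δ * (k + 2))) P) :
    ∫ x, φ x * ω x ≤ P := by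
  have hW : HasSum (fun k => ∫ x in cell x0 δ k, ω x) (∫ x, ω x) := by
    have := hasSum_integral_iUnion (f := ω) (μ := volume) (cell_meas x0 δ) (cell_disj hδ)
      hω.integrableOn
    rwa [cell_union hδ, setIntegral_univ] at this
  have hY : HasSum (fun k => ∫ x in cell x0 δ k, φ x * ω x) (∫ x, φ x * ω x) := by
    have := hasSum_integral_iUnion (f := fun x => φ x * ω x) (μ := volume)
      (cell_meas x0 δ) (cell_disj hδ) hφω.integrableOn
    rwa [cell_union hδ, setIntegral_univ] at this
  refine lr_sum p _ _ (fun k => φ (x0 + δ * (k + 2))) _ _ P hp0 hp hW ?_ ?_ ?_ hY ?_ hP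
  · intro k
    have e : ∫ x in cell x0 δ (k + 1), ω x =
        ∫ x in Ico (x0 + δ * (k + 1)) (x0 + δ * (k + 2)), ω (x + δ) := by
      have := (measurePreserving_add_right (volume : Measure ℝ) δ).setIntegral_preimage_emb
        (MeasurableEquiv.addRight δ).measurableEmbedding ω (cell x0 δ (k + 1))
      rw [← this]
      congr 2
      simp only [cell, preimage_add_const_Ico]
      congr 1 <;> ring
    rw [e, ← integral_mul_const, ← integral_const_mul]
    calc ∫ x in Ico (x0 + δ * (k + 1)) (x0 + δ * (k + 2)), ω (x + δ) * p k
        ≤ ∫ x in Ico (x0 + δ * (k + 1)) (x0 + δ * (k + 2)), p (k + 1) * ω x := by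
          refine setIntegral_mono_on ?_ (hω.const_mul _).integrableOn measurableSet_Ico ?_
          · exact ((hω.comp_add_right δ).mul_const _).integrableOn
          · intro x hx
            exact hlr k x hx.1
      _ ≤ ∫ x in cell x0 δ k, p (k + 1) * ω x := by
          refine setIntegral_mono_set (hω.const_mul _).integrableOn ?_ ?_
          · exact Filter.Eventually.of_forall fun x => mul_nonneg (hp0 _) (hω0 _)
          · exact (cell_sub k).eventuallyLE
  · intro k
    rcases hz k with h | h
    · exact Or.inl h
    · right
      exact setIntegral_eq_zero_of_forall_eq_zero fun x hx => h x hx.1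
  · intro i j hij
    apply hφ
    have : (i : ℝ) ≤ j := by exact_mod_cast hij
    nlinarith
  · intro k
    rw [← integral_mul_const]
    refine setIntegral_mono_on hφω.integrableOn (hω.mul_const _).integrableOn (cell_meas _ _ _) ?_
    intro x hx
    have := hφ (cell_lt hx).le
    have := hω0 x
    nlinarith

end ErlangA
namespace ErlangA

lemma scal {r c I J I' J' A δ K0 : ℝ} (hr : 0 < r) (hI : 0 < I) (hJ : 0 < J) (hI' : 0 < I')
    (hδ : 0 < δ) (hA : 0 < A) (hAr : r * A = 1 + c * J) (hAJ : A ≤ J ^ 2) (hJJ : J ≤ J')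
    (hcI : c * I' ≤ 1) (hII : I ≤ I' + 2 * δ * I * I') (hc : c < -1 ∨ I ≤ K0) :
    (1 + c * J') / (r * (I' + J')) ≤ A / (I + J) + 2 * δ * (1 + K0 ^ 2) := by
  have hJ' : 0 < J' := hJ.trans_le hJJ
  have s1 : (1 + c * J') / (r * (I' + J')) ≤ A / (I' + J) := by
    rw [div_le_div_iff₀ (by positivity) (by positivity)]
    have e : A * (r * (I' + J')) = (1 + c * J) * (I' + J') := by rw [← hAr]; ring
    rw [e]
    nlinarith [mul_nonneg (sub_nonneg.mpr hJJ) (sub_nonneg.mpr hcI)]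
  refine s1.trans ?_
  rcases le_or_gt I I' with h | h
  · have : A / (I' + J) ≤ A / (I + J) := by gcongr
    have : 0 ≤ 2 * δ * (1 + K0 ^ 2) := by positivity
    linarith
  · have key : A * (I * I') ≤ (1 + K0 ^ 2) * ((I' + J) * (I + J)) := by
      have hprod : I * I' ≤ (I' + J) * (I + J) := by nlinarith [mul_pos hI hJ, mul_pos hI' hJ]
      have hprod2 : J ^ 2 ≤ (I' + J) * (I + J) := by
        nlinarith [mul_pos hI hJ, mul_pos hI' hJ, mul_pos hI hI']
      rcases hc with hc | hc
      · have hJ1 : J ≤ 1 := by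
          have : 0 < 1 + c * J := by rw [← hAr]; positivity
          nlinarith
        have hA1 : A ≤ 1 := by nlinarith
        have : 0 ≤ K0 ^ 2 * ((I' + J) * (I + J)) := by positivity
        have : A * (I * I') ≤ 1 * (I * I') := by gcongr
        linarith
      · have h1 : I * I' ≤ K0 ^ 2 := by nlinarith
        have h2 : A * (I * I') ≤ J ^ 2 * K0 ^ 2 := by gcongr
        have h3 : J ^ 2 * K0 ^ 2 ≤ (I' + J) * (I + J) * K0 ^ 2 := by gcongr
        nlinarith [mul_pos (add_pos hI' hJ) (add_pos hI hJ)]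
    have : A / (I' + J) - A / (I + J) = A * (I - I') / ((I' + J) * (I + J)) := by
      field_simp; ring
    have h4 : A * (I - I') / ((I' + J) * (I + J)) ≤ 2 * δ * (1 + K0 ^ 2) := by
      rw [div_le_iff₀ (by positivity)]
      have : A * (I - I') ≤ A * (2 * δ * I * I') := by gcongr; linarith
      nlinarith
    linarith

/-- drift, centred at the kink -/
noncomputable def bt (r c u : ℝ) : ℝ := c + max (-u) 0 - r * max u 0

/-- log-density, centred at the kink -/
noncomputable def ld (r c u : ℝ) : ℝ := c * u - (max (-u) 0) ^ 2 / 2 - r * (max u 0) ^ 2 / 2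

/-- unnormalised density -/
noncomputable def wt (r c u : ℝ) : ℝ := Real.exp (ld r c u)

lemma posSq_deriv (u : ℝ) : HasDerivAt (fun u : ℝ => (max u 0) ^ 2 / 2) (max u 0) u := by
  rcases lt_trichotomy u 0 with h | h | h
  · have : (fun u : ℝ => (max u 0) ^ 2 / 2) =ᶠ[nhds u] fun _ => 0 := by
      filter_upwards [gt_mem_nhds h] with x hx
      rw [max_eq_right hx.le]; simp
    rw [max_eq_right h.le]
    exact (hasDerivAt_const u (0:ℝ)).congr_of_eventuallyEq this
  · subst h
    rw [max_self, hasDerivAt_iff_isLittleO_nhds_zero]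
    simp only [zero_add, max_self, smul_zero, sub_zero, zero_pow two_ne_zero, zero_div]
    have h1 : (fun h : ℝ => h ^ 2) =o[nhds 0] fun h : ℝ => h := by
      simpa using Asymptotics.isLittleO_pow_id (𝕜 := ℝ) (n := 2) (by norm_num)
    refine Asymptotics.IsBigO.trans_isLittleO ?_ h1
    refine Asymptotics.IsBigO.of_bound 1 (Filter.Eventually.of_forall fun x => ?_)
    simp only [Real.norm_eq_abs]
    rcases le_total x 0 with hx | hx
    · rw [max_eq_right hx]; norm_num; positivity
    · rw [max_eq_left hx, abs_of_nonneg (by positivity), abs_of_nonneg (by positivity)]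
      nlinarith [sq_nonneg x]
  · have : (fun u : ℝ => (max u 0) ^ 2 / 2) =ᶠ[nhds u] fun x => x ^ 2 / 2 := by
      filter_upwards [lt_mem_nhds h] with x hx
      rw [max_eq_left hx.le]
    rw [max_eq_left h.le]
    refine HasDerivAt.congr_of_eventuallyEq ?_ this
    have := ((hasDerivAt_id u).pow 2).div_const 2
    refine this.congr_deriv ?_
    simp

lemma ld_deriv (r c u : ℝ) : HasDerivAt (ld r c) (bt r c u) u := by
  have h1 := (hasDerivAt_id u).const_mul c
  have h2 := (posSq_deriv (-u)).comp u (hasDerivAt_neg u)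
  have h3 := (posSq_deriv u).const_mul r
  have := (h1.sub h2).sub h3
  have e : ld r c = fun u => (c * u - (max (-u) 0) ^ 2 / 2) - r * ((max u 0) ^ 2 / 2) := by
    funext u; unfold ld; ring
  rw [e]
  refine this.congr_deriv ?_
  unfold bt; ring

lemma bt_anti {r : ℝ} (hr : 0 < r) (c : ℝ) : Antitone (bt r c) := by
  intro x y h
  unfold bt
  have h1 : max (-y) 0 ≤ max (-x) 0 := max_le_max (by linarith) le_rfl
  have h2 : r * max x 0 ≤ r * max y 0 := by gcongr
  linarith

lemma bt_cont (r c : ℝ) : Continuous (bt r c) := by unfold bt; fun_prop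
lemma ld_cont (r c : ℝ) : Continuous (ld r c) := by unfold ld; fun_prop
lemma wt_cont (r c : ℝ) : Continuous (wt r c) := by unfold wt; exact (ld_cont r c).rexp
lemma wt_pos (r c u : ℝ) : 0 < wt r c u := Real.exp_pos _

lemma ld_step {r : ℝ} (hr : 0 < r) (c x : ℝ) {d : ℝ} (hd : 0 ≤ d) :
    ld r c (x + d) ≤ ld r c x + d * bt r c x := by
  unfold ld bt
  have a : ∀ a b : ℝ, (max b 0) ^ 2 / 2 ≥ (max a 0) ^ 2 / 2 + max a 0 * (b - a) := by
    intro a b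
    rcases le_total a 0 with ha | ha
    · rw [max_eq_right ha]
      have : 0 ≤ (max b 0) ^ 2 / 2 := by positivity
      simpa using this
    · rw [max_eq_left ha]
      rcases le_total b 0 with hb | hb
      · rw [max_eq_right hb]; nlinarith
      · rw [max_eq_left hb]; nlinarith [sq_nonneg (a - b)]
  have h1 := a x (x + d)
  have h2 := a (-x) (-(x + d))
  nlinarith

lemma wt_step {r : ℝ} (hr : 0 < r) {c x y d : ℝ} (hd : 0 ≤ d) (h : y ≤ x) :
    wt r c (x + d) * (1 - d * bt r c y) ≤ wt r c x := by
  have h1 := ld_step hr c x hd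
  have h2 : d * bt r c x ≤ d * bt r c y := by gcongr; exact bt_anti hr c h
  have h3 : wt r c (x + d) ≤ wt r c x * Real.exp (d * bt r c y) := by
    unfold wt
    rw [← Real.exp_add]
    gcongr
    linarith
  have h4 : 1 - d * bt r c y ≤ Real.exp (-(d * bt r c y)) := by
    have := Real.add_one_le_exp (-(d * bt r c y))
    linarith
  calc wt r c (x + d) * (1 - d * bt r c y)
      ≤ wt r c (x + d) * Real.exp (-(d * bt r c y)) := by
        gcongr; exact (wt_pos _ _ _).le
    _ ≤ wt r c x * Real.exp (d * bt r c y) * Real.exp (-(d * bt r c y)) := by gcongr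
    _ = wt r c x := by rw [mul_assoc, ← Real.exp_add]; simp

lemma wt_integrable {r : ℝ} (hr : 0 < r) (c : ℝ) (k : ℕ) :
    Integrable (fun u : ℝ => u ^ k * wt r c u) := by
  have hs : 0 < min r 1 := lt_min hr one_pos
  refine (gi_integrable_all k hs c).norm.mono'
    ((continuous_id.pow k).mul (wt_cont r c)).aestronglyMeasurable
    (Filter.Eventually.of_forall fun u => ?_)
  rw [norm_mul, norm_mul]
  gcongr
  simp only [wt, Real.norm_eq_abs, Real.abs_exp]
  gcongr
  unfold ld
  have h1 : min r 1 ≤ r := min_le_left _ _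
  have h2 : min r 1 ≤ 1 := min_le_right _ _
  rcases le_total u 0 with hu | hu
  · rw [max_eq_right hu, max_eq_left (by linarith : 0 ≤ -u)]; nlinarith [sq_nonneg u]
  · rw [max_eq_left hu, max_eq_right (by linarith : -u ≤ 0)]; nlinarith [sq_nonneg u]

lemma wt_Ioi (r c : ℝ) (k : ℕ) : ∫ u in Ioi (0:ℝ), u ^ k * wt r c u = gi k r c := by
  unfold gi
  refine setIntegral_congr_fun measurableSet_Ioi fun u hu => ?_
  have h : (0:ℝ) < u := hu
  simp only [wt, ld]
  rw [max_eq_left h.le, max_eq_right (by linarith : -u ≤ 0)]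
  congr 2; ring

lemma wt_Iic (r c : ℝ) (k : ℕ) :
    ∫ u in Iic (0:ℝ), u ^ k * wt r c u = (-1) ^ k * gi k 1 (-c) := by
  have := integral_comp_neg_Ioi 0 (fun u : ℝ => u ^ k * wt r c u)
  rw [neg_zero] at this
  rw [← this]
  unfold gi
  rw [← integral_const_mul]
  refine setIntegral_congr_fun measurableSet_Ioi fun u hu => ?_
  have h : (0:ℝ) < u := hu
  simp only [wt, ld]
  rw [neg_neg, max_eq_left h.le, max_eq_right (by linarith : -u ≤ 0), neg_pow]
  rw [mul_assoc]
  congr 3; ring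

lemma wt_all {r : ℝ} (hr : 0 < r) (c : ℝ) (k : ℕ) :
    ∫ u, u ^ k * wt r c u = (-1) ^ k * gi k 1 (-c) + gi k r c := by
  rw [← wt_Iic r c k, ← wt_Ioi r c k, ← integral_add_compl measurableSet_Iic (wt_integrable hr c k),
    compl_Iic]

lemma wt_pp {r : ℝ} (c : ℝ) :
    ∫ u, max u 0 * wt r c u = gi 1 r c := by
  rw [← wt_Ioi r c 1, ← integral_indicator measurableSet_Ioi]
  congr 1
  funext u
  rcases le_or_gt u 0 with h | h
  · rw [indicator_of_notMem (by simpa using h), max_eq_right h]; simp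
  · rw [indicator_of_mem (by simpa using h), max_eq_left h.le]; simp

lemma wt_pp_int {r : ℝ} (hr : 0 < r) (c : ℝ) :
    Integrable (fun u => max u 0 * wt r c u) := by
  refine (wt_integrable hr c 1).norm.mono'
    ((continuous_id.max continuous_const).mul (wt_cont r c)).aestronglyMeasurable
    (Filter.Eventually.of_forall fun u => ?_)
  rw [norm_mul, norm_mul]
  gcongr
  simp only [id, Real.norm_eq_abs, pow_one]
  rw [abs_of_nonneg (le_max_right _ _)]
  exact max_le (le_abs_self u) (abs_nonneg u)

theorem dom2 {x0 δ K : ℝ} (hδ : 0 < δ) (p : ℕ → ℝ) (ω : ℝ → ℝ) (hω0 : ∀ x, 0 ≤ ω x)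
    (hω : Integrable ω) (hp0 : ∀ k, 0 ≤ p k) (hp : HasSum p (∫ x, ω x))
    (hlr : ∀ (k : ℕ) (x : ℝ), x0 + δ * (k + 1) ≤ x → ω (x + δ) * p k ≤ p (k + 1) * ω x)
    (hz : ∀ k : ℕ, 0 < p k ∨ ∀ x, x0 + δ * (k + 2) ≤ x → ω x = 0)
    (φ : ℝ → ℝ) (hφ : Monotone φ) (hφK : ∀ x, φ (x + 2 * δ) ≤ φ x + K)
    (hφω : Integrable fun x => φ x * ω x) (P : ℝ)
    (hP : HasSum (fun k : ℕ => p k * φ (x0 + δ * k)) P) :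
    ∫ x, φ x * ω x ≤ P + K * ∫ x, ω x := by
  have hb : ∀ k : ℕ, p k * φ (x0 + δ * (k + 2)) - p k * φ (x0 + δ * k) ≤ p k * K := by
    intro k
    have h1 := hφK (x0 + δ * k)
    have e : x0 + δ * k + 2 * δ = x0 + δ * (k + 2) := by ring
    rw [e] at h1
    nlinarith [hp0 k]
  have ha : ∀ k : ℕ, 0 ≤ p k * φ (x0 + δ * (k + 2)) - p k * φ (x0 + δ * k) := by
    intro k
    have h1 : φ (x0 + δ * k) ≤ φ (x0 + δ * (k + 2)) := hφ (by nlinarith)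
    nlinarith [hp0 k]
  have hs := Summable.of_nonneg_of_le ha hb (hp.summable.mul_right K)
  have hs2 : HasSum (fun k : ℕ => p k * φ (x0 + δ * (k + 2))) _ :=
    (hs.hasSum.add hP).congr_fun (fun k => by ring)
  refine (dom hδ p ω hω0 hω hp0 hp hlr hz φ hφ hφω _ hs2).trans ?_
  have h1 := hasSum_le hb hs.hasSum (hp.mul_right K)
  linarith

end ErlangA
namespace ErlangA

/-- the stationary chain, normalised -/
structure Chain (r δ c : ℝ) (m : ℕ) (π : ℕ → ℝ) : Prop where
  hr : 0 < r
  hδ : 0 < δ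
  hc : c = 1 / δ - δ * (m + 1)
  pos : ∀ k, 0 < π k
  sum : HasSum π 1
  lo : ∀ k ≤ m, π k = δ ^ 2 * (k + 1) * π (k + 1)
  hi : ∀ j : ℕ, π (m + j) = δ ^ 2 * (m + 1 + r * j) * π (m + 1 + j)

namespace Chain

variable {r δ c : ℝ} {m : ℕ} {π : ℕ → ℝ}

lemma bt_eq (h : Chain r δ c m π) (k : ℕ) :
    π k = (1 - δ * bt r c (-δ * (m + 1) + δ * (k + 1))) * π (k + 1) := by
  have hδ := h.hδ
  have hδc : δ * c = 1 - δ ^ 2 * (m + 1) := by rw [h.hc]; field_simp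
  rcases le_total k m with hk | hk
  · rw [h.lo k hk]
    have hk' : (k : ℝ) ≤ m := by exact_mod_cast hk
    have h1 : -δ * (m + 1) + δ * (k + 1) ≤ 0 := by nlinarith
    unfold bt
    rw [max_eq_right h1, max_eq_left (by linarith)]
    congr 1
    linear_combination hδc
  · obtain ⟨j, rfl⟩ := Nat.exists_eq_add_of_le hk
    rw [h.hi j]
    have h1 : 0 ≤ -δ * (m + 1) + δ * (((m + j : ℕ) : ℝ) + 1) := by
      push_cast
      have : 0 ≤ δ * j := by positivity
      nlinarith
    unfold bt
    rw [max_eq_left h1, max_eq_right (by linarith), show m + 1 + j = m + j + 1 by ring]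
    congr 1
    push_cast
    linear_combination hδc

lemma hi_sum (h : Chain r δ c m π) : Summable fun j => π (m + 1 + j) :=
  h.sum.summable.comp_injective (add_right_injective _)

lemma hi_sum' (h : Chain r δ c m π) : Summable fun j => π (m + j) :=
  h.sum.summable.comp_injective (add_right_injective _)

lemma hi_mom (h : Chain r δ c m π) : Summable fun j : ℕ => δ * j * π (m + 1 + j) := by
  have hδ := h.hδ
  have hr := h.hr
  refine Summable.of_nonneg_of_le (fun j => ?_) (fun j => ?_) (h.hi_sum'.mul_left (1 / (r * δ)))
  · have := (h.pos (m + 1 + j)).le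
    positivity
  · rw [h.hi j]
    have := (h.pos (m + 1 + j)).le
    have e : 1 / (r * δ) * (δ ^ 2 * (m + 1 + r * j) * π (m + 1 + j)) =
      δ * j * π (m + 1 + j) + δ * (m + 1) / r * π (m + 1 + j) := by field_simp; ring
    rw [e]
    have : 0 ≤ δ * (m + 1) / r * π (m + 1 + j) := by positivity
    linarith

/-- mass at or above the kink -/
noncomputable def Pp (m : ℕ) (π : ℕ → ℝ) : ℝ := ∑' j, π (m + 1 + j)
/-- first moment above the kink -/
noncomputable def Mp (δ : ℝ) (m : ℕ) (π : ℕ → ℝ) : ℝ := ∑' j : ℕ, δ * j * π (m + 1 + j)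
/-- mass below the kink -/
noncomputable def Pm (m : ℕ) (π : ℕ → ℝ) : ℝ := ∑ k ∈ Finset.range (m + 1), π k
/-- first moment below the kink -/
noncomputable def Mm (δ : ℝ) (m : ℕ) (π : ℕ → ℝ) : ℝ :=
  ∑ k ∈ Finset.range (m + 1), δ * ((m + 1) - k) * π k

lemma mass (h : Chain r δ c m π) : Pm m π + Pp m π = 1 := by
  have := h.sum.summable.sum_add_tsum_nat_add (m + 1)
  rw [h.sum.tsum_eq] at this
  rw [← this]
  unfold Pm Pp
  congr 2
  funext j
  rw [add_comm]

lemma Pm_pos (h : Chain r δ c m π) : 0 < Pm m π :=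
  Finset.sum_pos (fun k _ => h.pos k) ⟨0, by simp⟩

lemma Mm_nonneg (h : Chain r δ c m π) : 0 ≤ Mm δ m π := by
  refine Finset.sum_nonneg fun k hk => ?_
  have h1 : (k : ℝ) ≤ m := by exact_mod_cast Nat.lt_succ_iff.mp (Finset.mem_range.mp hk)
  have := h.hδ
  have := (h.pos k).le
  have : 0 ≤ (m + 1 : ℝ) - k := by linarith
  positivity

lemma Mp_eq (h : Chain r δ c m π) : r * Mp δ m π = c * Pp m π + π m / δ := by
  have hδ := h.hδ
  have h1 : ∑' j, π (m + j) = π m + Pp m π := by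
    rw [h.hi_sum'.tsum_eq_zero_add]
    unfold Pp
    congr 2
    funext j
    congr 1; ring
  have h2 : ∑' j, π (m + j) = δ ^ 2 * (m + 1) * Pp m π + r * δ * Mp δ m π := by
    unfold Pp Mp
    rw [← tsum_mul_left, ← tsum_mul_left, ← (h.hi_sum.mul_left _).tsum_add (h.hi_mom.mul_left _)]
    congr 1
    funext j
    rw [h.hi j]; ring
  rw [h1] at h2
  rw [h.hc]
  field_simp
  linear_combination -h2

lemma Mm_eq (h : Chain r δ c m π) : Mm δ m π = π m / δ - c * Pm m π := by
  have hδ := h.hδ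
  have h1 : ∑ k ∈ Finset.range (m + 1), δ ^ 2 * k * π k = ∑ k ∈ Finset.range m, π k := by
    rw [Finset.sum_range_succ']
    simp only [Nat.cast_zero, mul_zero, zero_mul, add_zero]
    refine Finset.sum_congr rfl fun k hk => ?_
    rw [h.lo k (Finset.mem_range.mp hk).le]
    push_cast; ring
  have h2 : Pm m π = ∑ k ∈ Finset.range m, π k + π m := Finset.sum_range_succ _ _
  have h3 : δ * Mm δ m π = δ ^ 2 * (m + 1) * Pm m π - ∑ k ∈ Finset.range (m + 1), δ ^ 2 * k * π k := by
    unfold Mm Pm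
    rw [Finset.mul_sum, Finset.mul_sum, ← Finset.sum_sub_distrib]
    refine Finset.sum_congr rfl fun k _ => ?_
    ring
  rw [h1] at h3
  rw [h.hc]
  field_simp
  linear_combination h3 + h2

lemma J_le (h : Chain r δ c m π) : π m / δ * gi 0 r c ≤ Pp m π := by
  have hδ := h.hδ
  have hr := h.hr
  have hδc : δ * c = 1 - δ ^ 2 * (m + 1) := by rw [h.hc]; field_simp
  have step : ∀ j : ℕ, π (m + j) * gi 0 r (c - r * δ * j) -
      π (m + (j + 1)) * gi 0 r (c - r * δ * ((j + 1 : ℕ) : ℝ)) ≤ δ * π (m + 1 + j) := by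
    intro j
    have t := gi_tangent hr (c - r * δ * j) (c - r * δ * ((j + 1 : ℕ) : ℝ))
    have g := gi_one hr (c - r * δ * j)
    set G0 := gi 0 r (c - r * δ * j)
    set G1 := gi 1 r (c - r * δ * j)
    set G0' := gi 0 r (c - r * δ * ((j + 1 : ℕ) : ℝ))
    have e : (c - r * δ * ((j + 1 : ℕ) : ℝ) - (c - r * δ * j)) * G1 = -δ * (r * G1) := by
      push_cast; ring
    rw [e, g] at t
    have hp := h.pos (m + 1 + j)
    rw [h.hi j, show m + (j + 1) = m + 1 + j by ring]
    have h1 : δ ^ 2 * (m + 1 + r * j) * G0 - G0' ≤ δ := by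
      have : δ ^ 2 * (m + 1 + r * j) = 1 - δ * (c - r * δ * j) := by
        linear_combination hδc
      rw [this]; linarith
    nlinarith
  have tel : ∀ N : ℕ, π m * gi 0 r c - π (m + N) * gi 0 r c ≤ δ * Pp m π := by
    intro N
    have h1 := Finset.sum_le_sum (s := Finset.range N) (fun j _ => step j)
    rw [Finset.sum_range_sub' (fun j => π (m + j) * gi 0 r (c - r * δ * j)), ← Finset.mul_sum] at h1
    have h2 : ∑ j ∈ Finset.range N, π (m + 1 + j) ≤ Pp m π :=
      h.hi_sum.sum_le_tsum _ (fun j _ => (h.pos _).le)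
    have h3 : gi 0 r (c - r * δ * N) ≤ gi 0 r c := gi_mono hr (by
      have : 0 ≤ r * δ * N := by positivity
      linarith)
    have h4 := mul_le_mul_of_nonneg_left h3 (h.pos (m + N)).le
    have h5 := mul_le_mul_of_nonneg_left h2 hδ.le
    simp only [Nat.cast_zero, mul_zero, sub_zero, add_zero] at h1
    linarith
  have lim : Filter.Tendsto (fun N : ℕ => π m * gi 0 r c - π (m + N) * gi 0 r c) Filter.atTop
      (nhds (π m * gi 0 r c - 0 * gi 0 r c)) :=
    (h.hi_sum'.tendsto_atTop_zero.mul_const _).const_sub _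
  have := le_of_tendsto' lim tel
  rw [zero_mul, sub_zero] at this
  rw [div_mul_eq_mul_div, div_le_iff₀ hδ]
  linarith

lemma hlr (h : Chain r δ c m π) (k : ℕ) (x : ℝ) (hx : -δ * (m + 1) + δ * (k + 1) ≤ x) :
    wt r c (x + δ) * π k ≤ π (k + 1) * wt r c x := by
  rw [h.bt_eq k]
  have := wt_step h.hr (c := c) h.hδ.le hx
  have hp := (h.pos (k + 1)).le
  nlinarith

/-- first moment of the chain -/
lemma mean (h : Chain r δ c m π) :
    HasSum (fun k : ℕ => π k * (-δ * (m + 1) + δ * k)) (Mp δ m π - Mm δ m π) := by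
  rw [← hasSum_nat_add_iff' (m + 1)]
  have e : Mp δ m π - Mm δ m π - ∑ i ∈ Finset.range (m + 1), π i * (-δ * (m + 1) + δ * i) = Mp δ m π := by
    unfold Mm
    rw [sub_sub, ← Finset.sum_add_distrib, Finset.sum_eq_zero, sub_zero]
    intro k _; ring
  rw [e]
  refine h.hi_mom.hasSum.congr_fun fun j => ?_
  rw [add_comm j]; push_cast; ring

lemma meanp (h : Chain r δ c m π) :
    HasSum (fun k : ℕ => π k * max (-δ * (m + 1) + δ * k) 0) (Mp δ m π) := by
  have hδ := h.hδ
  rw [← hasSum_nat_add_iff' (m + 1)]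
  have e : ∑ i ∈ Finset.range (m + 1), π i * max (-δ * (m + 1) + δ * i) 0 = 0 := by
    refine Finset.sum_eq_zero fun k hk => ?_
    have h1 : (k : ℝ) ≤ m := by exact_mod_cast Nat.lt_succ_iff.mp (Finset.mem_range.mp hk)
    rw [max_eq_right (by nlinarith), mul_zero]
  rw [e, sub_zero]
  refine h.hi_mom.hasSum.congr_fun fun j => ?_
  have : 0 ≤ δ * j := by positivity
  rw [add_comm j, max_eq_left (by push_cast; linarith)]
  push_cast; ring

lemma I_le (h : Chain r δ c m π) :
    π m / δ * gi 0 1 (-c) ≤ Pm m π * (1 + 2 * δ * gi 0 1 (-c)) := by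
  classical
  have hδ := h.hδ
  have hr := h.hr
  have hI := gi_pos 0 one_pos (-c)
  have hP := h.Pm_pos
  have w0 : Integrable (wt r c) := by simpa using wt_integrable hr c 0
  have w1 : Integrable fun u => u * wt r c u := by simpa using wt_integrable hr c 1
  have E1 := gi_one one_pos (-c)
  set I := gi 0 1 (-c) with hIdef
  set ω : ℝ → ℝ := fun x => Pm m π / I * (Iio (0:ℝ)).indicator (wt r c) x with hω
  set p : ℕ → ℝ := fun k => if k ∈ Finset.range (m + 1) then π k else 0 with hp
  have i0 : ∫ x, ω x = Pm m π := by
    rw [hω, integral_const_mul, integral_indicator measurableSet_Iio, ← integral_Iic_eq_integral_Iio]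
    have := wt_Iic r c 0
    simp only [pow_zero, one_mul] at this
    rw [this]
    field_simp
    exact hIdef.symm
  have i1 : ∫ x, x * ω x = Pm m π / I * -(1 + -c * I) := by
    have e : (fun x => x * ω x) = fun x => Pm m π / I *
        (Iio (0:ℝ)).indicator (fun x => x * wt r c x) x := by
      funext x
      simp only [hω, indicator]
      split_ifs <;> ring
    rw [e, integral_const_mul, integral_indicator measurableSet_Iio, ← integral_Iic_eq_integral_Iio]
    have := wt_Iic r c 1
    simp only [pow_one] at this
    rw [this, ← E1]
    ring
  have key := dom2 (x0 := -δ * (m + 1)) (K := 2 * δ) hδ p ω ?_ ?_ ?_ ?_ ?_ ?_ (fun x => x)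
    monotone_id (fun x => le_rfl) ?_ (-Mm δ m π) ?_
  · rw [i0, i1, h.Mm_eq] at key
    have e : Pm m π / I * -(1 + -c * I) = -(Pm m π / I) + c * Pm m π := by field_simp; ring
    rw [e] at key
    have k2 : π m / δ ≤ Pm m π / I + 2 * δ * Pm m π := by linarith
    have k3 := mul_le_mul_of_nonneg_right k2 hI.le
    have e2 : (Pm m π / I + 2 * δ * Pm m π) * I = Pm m π * (1 + 2 * δ * I) := by field_simp
    linarith
  · intro x
    exact mul_nonneg (by positivity) (indicator_nonneg (fun x _ => (wt_pos r c x).le) x)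
  · exact (w0.indicator measurableSet_Iio).const_mul _
  · intro k
    simp only [hp]
    split_ifs
    · exact (h.pos k).le
    · exact le_rfl
  · rw [i0]
    have := hasSum_sum_of_ne_finset_zero (L := SummationFilter.unconditional ℕ) (f := p) (s := Finset.range (m + 1)) (fun k hk => by
      simp only [hp]; rw [if_neg hk])
    convert this using 1
    exact Finset.sum_congr rfl fun k hk => by simp only [hp]; rw [if_pos hk]
  · intro k x hx
    have hpk : ∀ k, 0 ≤ p k := by
      intro k
      simp only [hp]
      split_ifs
      · exact (h.pos k).le
      · exact le_rfl
    have hωn : ∀ x, 0 ≤ ω x := fun x =>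
      mul_nonneg (by positivity) (indicator_nonneg (fun x _ => (wt_pos r c x).le) x)
    rcases lt_or_ge (x + δ) 0 with hx0 | hx0
    · have hkm : k + 1 < m + 1 := by
        have : ((k + 1 : ℕ) : ℝ) < ((m + 1 : ℕ) : ℝ) := by
          push_cast
          by_contra hcon
          push Not at hcon
          nlinarith
        exact_mod_cast this
      have hl := h.hlr k x hx
      simp only [hω, hp]
      rw [if_pos (Finset.mem_range.mpr hkm), if_pos (Finset.mem_range.mpr (by omega)),
        indicator_of_mem (by simpa using hx0), indicator_of_mem (by simp; linarith)]
      have : 0 ≤ Pm m π / I := by positivity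
      nlinarith
    · have : ω (x + δ) = 0 := by
        simp only [hω]
        rw [indicator_of_notMem (by simpa using hx0), mul_zero]
      rw [this, zero_mul]
      exact mul_nonneg (hpk _) (hωn _)
  · intro k
    by_cases hk : k ∈ Finset.range (m + 1)
    · left
      simp only [hp]
      rw [if_pos hk]
      exact h.pos k
    · right
      intro x hx
      have : (m + 1 : ℝ) ≤ k := by
        have : m + 1 ≤ k := by simpa using hk
        exact_mod_cast this
      simp only [hω]
      rw [indicator_of_notMem (by simp; nlinarith), mul_zero]
  · have e : (fun x => x * ω x) = fun x => Pm m π / I *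
        (Iio (0:ℝ)).indicator (fun x => x * wt r c x) x := by
      funext x
      simp only [hω, indicator]
      split_ifs <;> ring
    rw [e]
    exact (w1.indicator measurableSet_Iio).const_mul _
  · have := hasSum_sum_of_ne_finset_zero (L := SummationFilter.unconditional ℕ) (f := fun k : ℕ => p k * (-δ * (m + 1) + δ * k))
      (s := Finset.range (m + 1)) (fun k hk => by
      simp only [hp]; rw [if_neg hk, zero_mul])
    convert this using 1
    unfold Mm
    rw [← Finset.sum_neg_distrib]
    refine Finset.sum_congr rfl fun k hk => ?_
    simp only [hp]; rw [if_pos hk]; ring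

/-- global domination -/
lemma gdom (h : Chain r δ c m π) {κ K : ℝ} (hκ : 0 < κ) (hκ1 : ∫ x, κ * wt r c x = 1)
    (φ : ℝ → ℝ) (hφ : Monotone φ) (hφK : ∀ x, φ (x + 2 * δ) ≤ φ x + K)
    (hφω : Integrable fun x => φ x * (κ * wt r c x)) (P : ℝ)
    (hP : HasSum (fun k : ℕ => π k * φ (-δ * (m + 1) + δ * k)) P) :
    ∫ x, φ x * (κ * wt r c x) ≤ P + K := by
  have w0 : Integrable (wt r c) := by simpa using wt_integrable h.hr c 0
  have := dom2 h.hδ π (fun x => κ * wt r c x) (fun x => (mul_pos hκ (wt_pos r c x)).le)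
    (w0.const_mul κ) (fun k => (h.pos k).le) (by rw [hκ1]; exact h.sum) (x0 := -δ * (m + 1))
    (fun k x hx => by have := h.hlr k x hx; nlinarith) (fun k => Or.inl (h.pos k)) φ hφ hφK
    hφω P hP
  rwa [hκ1, mul_one] at this

theorem main (h : Chain r δ c m π) {κ : ℝ} (hκ : 0 < κ) (hκ1 : ∫ x, κ * wt r c x = 1)
    (H : ℝ → ℝ) (hH : LipschitzWith 1 H)
    (hHs : Summable fun k : ℕ => π k * H (-δ * (m + 1) + δ * k))
    (hHi : Integrable fun x => H x * (κ * wt r c x)) :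
    |(∑' k : ℕ, π k * H (-δ * (m + 1) + δ * k)) - ∫ x, H x * (κ * wt r c x)| ≤
      (6 + 2 * gi 0 1 1 ^ 2 + 2 * r) * δ := by
  have hδ := h.hδ
  have hr := h.hr
  have hθ : 0 < π m / δ := div_pos (h.pos m) hδ
  have w1 : Integrable fun x => x * (κ * wt r c x) := by
    have := (wt_integrable hr c 1).const_mul κ
    refine this.congr (Filter.Eventually.of_forall fun x => ?_)
    simp only [pow_one]; ring
  have hIJ : κ * (gi 0 1 (-c) + gi 0 r c) = 1 := by
    have k := hκ1
    rw [integral_const_mul] at k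
    have := wt_all hr c 0
    simp only [pow_zero, one_mul] at this
    rw [this] at k
    linarith
  have hEV : ∫ x, x * (κ * wt r c x) = κ * (gi 1 r c - gi 1 1 (-c)) := by
    have := wt_all hr c 1
    simp only [pow_one] at this
    have e : (fun x => x * (κ * wt r c x)) = fun x => κ * (x * wt r c x) := by funext x; ring
    rw [e, integral_const_mul, this]; ring
  have hEVp : ∫ x, max x 0 * (κ * wt r c x) = κ * gi 1 r c := by
    have e : (fun x => max x 0 * (κ * wt r c x)) = fun x => κ * (max x 0 * wt r c x) := by
      funext x; ring
    rw [e, integral_const_mul, wt_pp]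
  have hIp := gi_pos 0 one_pos (-c)
  have hJp := gi_pos 0 hr c
  have hAp := gi_pos 1 hr c
  have hA := gi_one hr c
  have hAJ := gi_one_le_sq hr c
  have hE := gi_one one_pos (-c)
  have hJle := h.J_le
  have hIle := h.I_le
  have hMp := h.Mp_eq
  have hMm := h.Mm_eq
  have hMm0 := h.Mm_nonneg
  have hmass := h.mass
  have hPm := h.Pm_pos
  have hLip : ∀ x y, |H x - H y| ≤ |x - y| := by
    intro x y
    have := hH.dist_le_mul x y
    simpa [Real.dist_eq] using this
  have hmono1 : Monotone fun x => x + H x := by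
    intro x y hxy
    have := abs_le.mp (hLip x y)
    rw [abs_of_nonpos (by linarith)] at this
    simp only
    linarith [this.1, this.2]
  have hmono2 : Monotone fun x => x - H x := by
    intro x y hxy
    have := abs_le.mp (hLip x y)
    rw [abs_of_nonpos (by linarith)] at this
    simp only
    linarith [this.1, this.2]
  have hstep : ∀ x, |H (x + 2 * δ) - H x| ≤ 2 * δ := by
    intro x
    have := hLip (x + 2 * δ) x
    have e : x + 2 * δ - x = 2 * δ := by ring
    rw [e, abs_of_pos (a := 2 * δ) (by positivity)] at this
    exact this
  -- the mean comparison
  have hmean : (Mp δ m π - Mm δ m π) - κ * (gi 1 r c - gi 1 1 (-c)) ≤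
      (2 + 2 * gi 0 1 1 ^ 2 + 2 * r) * δ := by
    have e : (Mp δ m π - Mm δ m π) - κ * (gi 1 r c - gi 1 1 (-c)) =
        (1 - r) * (Mp δ m π - κ * gi 1 r c) := by
      rw [one_mul] at hE
      rw [hMm, hE]
      linear_combination hMp - κ * hA + c * hmass - c * hIJ
    rw [e]
    have hK0 : 0 ≤ gi 0 1 1 ^ 2 := by positivity
    rcases le_total 1 r with h1 | h1
    · have g := h.gdom hκ hκ1 (K := 2 * δ) (fun x => max x 0)
        (fun x y hxy => max_le_max hxy le_rfl)
        (fun x => max_le (by linarith [le_max_left x 0])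
          (by linarith [le_max_right x 0]))
        (by
          have := (wt_pp_int hr c).const_mul κ
          refine this.congr (Filter.Eventually.of_forall fun x => ?_)
          simp only; ring) _ h.meanp
      rw [hEVp] at g
      nlinarith [mul_nonneg hK0 hδ.le]
    · have s := scal (r := r) (c := c) (I := gi 0 1 (-c)) (J := gi 0 r c)
        (I' := Pm m π / (π m / δ)) (J' := Pp m π / (π m / δ)) (A := gi 1 r c) (δ := δ)
        (K0 := gi 0 1 1) hr hIp hJp (by positivity) hδ hAp hA hAJ ?_ ?_ ?_ ?_
      · have e1 : (1 + c * (Pp m π / (π m / δ))) /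
            (r * (Pm m π / (π m / δ) + Pp m π / (π m / δ))) = Mp δ m π := by
          rw [← add_div, hmass]
          set θ := π m / δ
          have : Mp δ m π = (c * Pp m π + θ) / r := by
            rw [← hMp]; field_simp
          rw [this]
          field_simp
          exact add_comm _ _
        have e2 : gi 1 r c / (gi 0 1 (-c) + gi 0 r c) = κ * gi 1 r c := by
          rw [div_eq_iff (by positivity)]
          linear_combination -gi 1 r c * hIJ
        rw [e1, e2] at s
        have s2 : Mp δ m π - κ * gi 1 r c ≤ 2 * δ * (1 + gi 0 1 1 ^ 2) := by linarith
        have : (1 - r) * (Mp δ m π - κ * gi 1 r c) ≤ (1 - r) * (2 * δ * (1 + gi 0 1 1 ^ 2)) := by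
          gcongr
        have : r * (2 * δ * (1 + gi 0 1 1 ^ 2)) ≥ 0 := by positivity
        nlinarith [mul_pos hr hδ]
      · rw [le_div_iff₀ hθ]; linarith
      · rw [← mul_div_assoc, div_le_iff₀ hθ]; linarith
      · have : Pm m π / (π m / δ) + 2 * δ * gi 0 1 (-c) * (Pm m π / (π m / δ)) =
          Pm m π * (1 + 2 * δ * gi 0 1 (-c)) / (π m / δ) := by ring
        rw [this, le_div_iff₀ hθ]; linarith
      · rcases lt_or_ge c (-1) with hc | hc
        · exact Or.inl hc
        · exact Or.inr (gi_mono one_pos (by linarith))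
  have g1 := h.gdom hκ hκ1 (K := 4 * δ) _ hmono1 (fun x => by
      have := abs_le.mp (hstep x); linarith [this.2])
    ((w1.add hHi).congr (Filter.Eventually.of_forall fun x => by simp only [Pi.add_apply]; ring)) _
    ((h.mean.add hHs.hasSum).congr_fun fun k => by ring)
  have g2 := h.gdom hκ hκ1 (K := 4 * δ) _ hmono2 (fun x => by
      have := abs_le.mp (hstep x); linarith [this.1])
    ((w1.sub hHi).congr (Filter.Eventually.of_forall fun x => by simp only [Pi.sub_apply]; ring)) _
    ((h.mean.sub hHs.hasSum).congr_fun fun k => by ring)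
  have e1 : ∫ x, (x + H x) * (κ * wt r c x) =
      κ * (gi 1 r c - gi 1 1 (-c)) + ∫ x, H x * (κ * wt r c x) := by
    rw [← hEV, ← integral_add w1 hHi]; congr 1; funext x; ring
  have e2 : ∫ x, (x - H x) * (κ * wt r c x) =
      κ * (gi 1 r c - gi 1 1 (-c)) - ∫ x, H x * (κ * wt r c x) := by
    rw [← hEV, ← integral_sub w1 hHi]; congr 1; funext x; ring
  rw [e1] at g1
  rw [e2] at g2
  rw [abs_le]
  constructor <;> linarith

end Chain

end ErlangA
/-- Erlang-A: there is a nondecreasing positive function `C_W` of `α/μ` such that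
the Wasserstein distance between the scaled stationary customer count and the
diffusion approximation is at most `C_W(α/μ)·δ`, for all parameters with `R ≥ 1`. -/
theorem erlangA_wasserstein :
    ∃ C : ℝ → ℝ,
      (∀ r : ℝ, 0 < r → 0 < C r) ∧
      (∀ r s : ℝ, 0 < r → r ≤ s → C r ≤ C s) ∧
      ∀ (lam mu alpha : ℝ) (n : ℕ),
        0 < lam → 0 < mu → 0 < alpha → 1 ≤ n →
      ∀ R δ xinf ζ : ℝ,
        R = lam / mu → 1 ≤ R →
        δ = 1 / Real.sqrt R →
        xinf = (if (n : ℝ) ≤ R then (n : ℝ) + (lam - (n : ℝ) * mu) / alpha else R) →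
        ζ = δ * (xinf - (n : ℝ)) →
      ∀ pi : ℕ → ℝ,
        (∀ k, 0 ≤ pi k) → (∑' k : ℕ, pi k) = 1 →
        (∀ k : ℕ, lam * pi k
            = (mu * min ((k : ℝ) + 1) (n : ℝ)
                + alpha * max ((k : ℝ) + 1 - (n : ℝ)) 0) * pi (k + 1)) →
      ∀ b : ℝ → ℝ,
        (∀ x : ℝ, b x = mu * (max (-(x + ζ)) 0 - max (-ζ) 0)
                        - alpha * (max (x + ζ) 0 - max ζ 0)) →
      ∀ kappa : ℝ, 0 < kappa →
      ∀ nu : ℝ → ℝ,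
        (∀ x : ℝ, nu x = kappa * Real.exp ((1 / mu) * ∫ y in (0:ℝ)..x, b y)) →
        (∫ x : ℝ, nu x) = 1 →
      ∀ h : ℝ → ℝ, LipschitzWith 1 h →
        (Summable fun k : ℕ => pi k * h (δ * ((k : ℝ) - xinf))) →
        (Integrable fun x : ℝ => h x * nu x) →
        |(∑' k : ℕ, pi k * h (δ * ((k : ℝ) - xinf))) - (∫ x : ℝ, h x * nu x)|
          ≤ C (alpha / mu) * δ := by
  refine ⟨fun r => 6 + 2 * ErlangA.gi 0 1 1 ^ 2 + 2 * r, fun r hr => by positivity,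
    fun r s _ hrs => by simp only; linarith, ?_⟩
  intro lam mu alpha n hlam hmu halpha hn R δ xinf ζ hR hR1 hδ hxinf hζ pi hpi0 hpi1 hrec b hb
    kappa hkappa nu hnu hnu1 h hh hs hi
  obtain ⟨m, rfl⟩ : ∃ m, n = m + 1 := ⟨n - 1, by omega⟩
  push_cast at hxinf hζ hrec
  have hRpos : 0 < R := by linarith
  have hsq : 0 < Real.sqrt R := Real.sqrt_pos.mpr hRpos
  have hδpos : 0 < δ := by rw [hδ]; positivity
  have hδ2 : δ ^ 2 = mu / lam := by
    rw [hδ, div_pow, Real.sq_sqrt hRpos.le, hR]; field_simp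
  have hδR : δ * R = 1 / δ := by
    rw [eq_div_iff hδpos.ne', hR]
    have : δ * (lam / mu) * δ = δ ^ 2 * (lam / mu) := by ring
    rw [this, hδ2]; field_simp
  set r := alpha / mu with hr
  have hrpos : 0 < r := by positivity
  set c := 1 / δ - δ * (m + 1) with hc
  have hsum : Summable pi := by
    by_contra hns
    rw [tsum_eq_zero_of_not_summable hns] at hpi1
    exact zero_ne_one hpi1
  have hd : ∀ k : ℕ, 0 < mu * min ((k : ℝ) + 1) (m + 1) + alpha * max ((k : ℝ) + 1 - (m + 1)) 0 := by
    intro k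
    have h1 : 0 < min ((k : ℝ) + 1) (m + 1) := lt_min (by positivity) (by positivity)
    have h2 : 0 ≤ max ((k : ℝ) + 1 - (m + 1)) 0 := le_max_right _ _
    positivity
  have hp0 : pi 0 ≠ 0 := by
    intro h0
    have hz : ∀ k, pi k = 0 := by
      intro k
      induction k with
      | zero => exact h0
      | succ k ih =>
        have := hrec k
        rw [ih, mul_zero] at this
        rcases mul_eq_zero.mp this.symm with h1 | h1
        · exact absurd h1 (hd k).ne'
        · exact h1
    have : pi = fun _ => 0 := funext hz
    rw [this, tsum_zero] at hpi1
    exact zero_ne_one hpi1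
  have hpos : ∀ k, 0 < pi k := by
    intro k
    induction k with
    | zero => exact lt_of_le_of_ne (hpi0 0) (Ne.symm hp0)
    | succ k ih =>
      refine lt_of_le_of_ne (hpi0 _) fun h0 => ?_
      have := hrec k
      rw [← h0, mul_zero] at this
      have := mul_pos hlam ih
      linarith
  have chain : ErlangA.Chain r δ c m pi := by
    refine ⟨hrpos, hδpos, rfl, hpos, hpi1 ▸ hsum.hasSum, ?_, ?_⟩
    · intro k hk
      have hk' : (k : ℝ) ≤ m := by exact_mod_cast hk
      have := hrec k
      rw [min_eq_left (by linarith), max_eq_right (by linarith)] at this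
      rw [hδ2]
      field_simp
      linarith
    · intro j
      have := hrec (m + j)
      have hj : (0 : ℝ) ≤ j := by positivity
      push_cast at this
      rw [min_eq_right (by linarith), max_eq_left (by linarith)] at this
      rw [hδ2, hr, show m + 1 + j = m + j + 1 by ring]
      field_simp
      linear_combination this
  have hcζ : c = -max (-ζ) 0 + r * max ζ 0 := by
    have hc2 : c = δ * (R - (m + 1)) := by rw [hc, ← hδR]; ring
    by_cases hnR : (m + 1 : ℝ) ≤ R
    · rw [if_pos hnR] at hxinf
      have hlm : r * (xinf - (m + 1)) = R - (m + 1) := by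
        rw [hxinf, hr, hR]; field_simp; ring
      have hx0 : 0 ≤ xinf - (m + 1) := by
        by_contra hcon
        push Not at hcon
        nlinarith
      have hζ0 : 0 ≤ ζ := by rw [hζ]; exact mul_nonneg hδpos.le hx0
      rw [max_eq_right (by linarith), max_eq_left hζ0, hc2, ← hlm, hζ]; ring
    · rw [if_neg hnR] at hxinf
      push Not at hnR
      have hζ0 : ζ ≤ 0 := by rw [hζ, hxinf]; nlinarith
      rw [max_eq_left (by linarith), max_eq_right hζ0, hc2, hζ, hxinf]; ring
  have hbt : ∀ y, (1 / mu) * b y = ErlangA.bt r c (y + ζ) := by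
    intro y
    rw [hb]
    unfold ErlangA.bt
    rw [hcζ, hr]
    field_simp
    ring
  set κ := kappa * Real.exp (-ErlangA.ld r c ζ) with hκ
  have hκpos : 0 < κ := by positivity
  have hnu' : ∀ x, nu x = κ * ErlangA.wt r c (x + ζ) := by
    intro x
    rw [hnu, ← intervalIntegral.integral_const_mul]
    simp_rw [hbt]
    have hder : ∀ y ∈ uIcc (0:ℝ) x, HasDerivAt (fun y => ErlangA.ld r c (y + ζ))
        (ErlangA.bt r c (y + ζ)) y := fun y _ =>
      (ErlangA.ld_deriv r c (y + ζ)).comp_add_const y ζ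
    have hcont : Continuous fun y => ErlangA.bt r c (y + ζ) := by
      unfold ErlangA.bt; fun_prop
    rw [intervalIntegral.integral_eq_sub_of_hasDerivAt hder (hcont.intervalIntegrable _ _), hκ,
      mul_assoc]
    unfold ErlangA.wt
    rw [← Real.exp_add, zero_add]
    congr 2
    ring
  have hκ1 : ∫ x, κ * ErlangA.wt r c x = 1 := by
    rw [← hnu1, ← integral_add_right_eq_self (fun x => κ * ErlangA.wt r c x) ζ]
    exact integral_congr_ae (Filter.Eventually.of_forall fun x => (hnu' x).symm)
  have hH : LipschitzWith 1 fun u => h (u - ζ) := by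
    refine LipschitzWith.of_dist_le_mul fun x y => ?_
    have := hh.dist_le_mul (x - ζ) (y - ζ)
    rwa [dist_sub_right] at this
  have hpt : ∀ k : ℕ, δ * ((k : ℝ) - xinf) = -δ * (m + 1) + δ * k - ζ := by
    intro k; rw [hζ]; ring
  simp_rw [hpt] at hs ⊢
  have hfun : (fun x => h x * nu x) = fun x =>
      (fun u => h (u - ζ) * (κ * ErlangA.wt r c u)) (x + ζ) := by
    funext x
    simp only [add_sub_cancel_right, hnu' x]
  have hHi : Integrable fun u => h (u - ζ) * (κ * ErlangA.wt r c u) := by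
    have := hi.comp_sub_right ζ
    refine this.congr (Filter.Eventually.of_forall fun x => ?_)
    simp only [hnu', sub_add_cancel]
  have hhval : ∫ x, h x * nu x = ∫ u, h (u - ζ) * (κ * ErlangA.wt r c u) := by
    rw [hfun]
    exact integral_add_right_eq_self (fun u => h (u - ζ) * (κ * ErlangA.wt r c u)) ζ
  rw [hhval]
  exact chain.main hκpos hκ1 _ hH hs hHi
end

section
/- For every λ > 0, μ > 0 and every integer n ≥ 1 with 1 ≤ R < n (where R = λ/μ), the Kolmogorov distance between the scaled stationary Erlang-C customer count and its diffusion approximation satisfies d_K(X̃(∞), Y(∞)) = sup over a ∈ ℝ of |P(X̃(∞) ≤ a) − P(Y(∞) ≤ a)| ≤ 156/√R. -/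
open MeasureTheory Set

/-- Discrete flow-balance identity. -/
lemma ec_discr (R : ℝ) (n : ℕ) (pi : ℕ → ℝ) (hnn : ∀ k, 0 ≤ pi k) (hs : Summable pi)
    (hflow : ∀ k : ℕ, R * pi k = min ((k : ℝ) + 1) (n : ℝ) * pi (k + 1))
    (h : ℕ → ℝ) (M : ℝ) (hM : ∀ k, |h k| ≤ M) :
    HasSum (fun k : ℕ => pi k * (R * h (k + 1) - min (k : ℝ) n * h k)) 0 := by
  have hg : Summable (fun k : ℕ => min (k : ℝ) n * pi k * h k) := by
    refine Summable.of_norm_bounded (hs.mul_left ((n : ℝ) * M)) ?_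
    intro k
    have h0 : 0 ≤ min (k : ℝ) n := le_min (by positivity) (by positivity)
    rw [Real.norm_eq_abs, abs_mul, abs_mul, abs_of_nonneg h0, abs_of_nonneg (hnn k)]
    have h1 : min (k : ℝ) n ≤ n := min_le_right _ _
    calc min (k : ℝ) n * pi k * |h k| ≤ n * pi k * M := by
          have := hnn k
          have := hM k
          gcongr
      _ = n * M * pi k := by ring
  obtain ⟨S, hS⟩ := hg
  have h1 := (hasSum_nat_add_iff' 1).2 hS
  have h2 := h1.sub hS
  simp only [Finset.sum_range_one, Nat.cast_zero] at h2
  have h00 : min (0 : ℝ) n = 0 := min_eq_left (by positivity)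
  rw [h00] at h2
  convert h2 using 1
  · rfl
  · funext k
    have := hflow k
    push_cast
    rw [← this]
    ring
  · ring

/-- Second moment and atoms. -/
lemma ec_moment (R δ : ℝ) (n : ℕ) (pi : ℕ → ℝ) (hR : 0 < R) (hδ : 0 < δ) (hδR : δ ^ 2 * R = 1)
    (hnn : ∀ k, 0 ≤ pi k) (hs : HasSum pi 1)
    (hflow : ∀ k : ℕ, R * pi k = min ((k : ℝ) + 1) (n : ℝ) * pi (k + 1)) :
    ∃ E, HasSum (fun k : ℕ => pi k * |δ * (R - min (k : ℝ) n)|) E ∧ E ≤ 1 := by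
  have hb : ∀ k : ℕ, |R - min (k : ℝ) n| ≤ R + n := by
    intro k
    have h0 : 0 ≤ min (k : ℝ) n := le_min (by positivity) (by positivity)
    have h1 : min (k : ℝ) n ≤ n := min_le_right _ _
    rw [abs_le]; constructor <;> linarith
  have key := ec_discr R n pi hnn hs.summable hflow (fun k => R - min (k : ℝ) n) _ hb
  have hsum : Summable (fun k : ℕ => pi k * |δ * (R - min (k : ℝ) n)|) := by
    refine Summable.of_norm_bounded (hs.summable.mul_left (δ * (R + n))) ?_
    intro k
    rw [Real.norm_eq_abs, abs_mul, abs_of_nonneg (hnn k), abs_abs, abs_mul, abs_of_pos hδ]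
    have := hb k
    have := hnn k
    calc pi k * (δ * |R - min (k : ℝ) n|) ≤ pi k * (δ * (R + n)) := by gcongr
      _ = _ := by ring
  obtain ⟨E, hE⟩ := hsum
  refine ⟨E, hE, ?_⟩
  have h3 : HasSum (fun k : ℕ => δ ^ 2 / 2 *
      (pi k * (R * (R - min ((k + 1 : ℕ) : ℝ) n) - min (k : ℝ) n * (R - min (k : ℝ) n))) + pi k)
      (δ ^ 2 / 2 * 0 + 1) := (key.mul_left _).add hs
  have := hasSum_le (f := fun k : ℕ => pi k * |δ * (R - min (k : ℝ) n)|) ?_ hE h3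
  · simpa using this
  intro k
  have h1 : min ((k + 1 : ℕ) : ℝ) n ≤ min (k : ℝ) n + 1 := by
    push_cast
    rcases le_total (k : ℝ) n with h | h
    · rw [min_eq_left h]; exact min_le_left _ _
    · rw [min_eq_right h]; exact (min_le_right _ _).trans (by linarith)
  set m := min (k : ℝ) n
  set m' := min ((k + 1 : ℕ) : ℝ) n
  have h2 : |δ * (R - m)| ≤ (1 + (δ * (R - m)) ^ 2) / 2 := by
    rw [← sq_abs]; nlinarith [sq_nonneg (|δ * (R - m)| - 1)]
  have h4 : (1 + (δ * (R - m)) ^ 2) / 2 ≤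
      δ ^ 2 / 2 * (R * (R - m') - m * (R - m)) + 1 := by
    have : δ ^ 2 / 2 * (R * (R - m') - m * (R - m)) + 1 =
      (1 + (δ * (R - m)) ^ 2) / 2 + (1 - (δ ^ 2 * R) * (m' - m)) / 2 := by ring
    rw [this, hδR]; linarith
  have h5 := mul_le_mul_of_nonneg_left (h2.trans h4) (hnn k)
  linarith

lemma ec_atom (R δ : ℝ) (n : ℕ) (pi : ℕ → ℝ) (hR : 0 < R) (hδ : 0 < δ) (hδR : δ ^ 2 * R = 1)
    (hnn : ∀ k, 0 ≤ pi k) (hs : HasSum pi 1)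
    (hflow : ∀ k : ℕ, R * pi k = min ((k : ℝ) + 1) (n : ℝ) * pi (k + 1)) (j : ℕ) :
    pi j ≤ δ := by
  obtain ⟨E, hE, hE1⟩ := ec_moment R δ n pi hR hδ hδR hnn hs hflow
  have key := ec_discr R n pi hnn hs.summable hflow (fun k => if j + 1 ≤ k then 1 else 0) 1
    (by intro k; split_ifs <;> simp)
  have hj : HasSum (fun k : ℕ => if k = j then R * pi j else 0) (R * pi j) :=
    hasSum_ite_eq j (R * pi j)
  have h2 := hasSum_le (f := fun k : ℕ => if k = j then R * pi j else 0) ?_ hj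
    (key.add (hE.mul_left (1 / δ)))
  · have h3 : 1 / δ * E ≤ 1 / δ * 1 := by gcongr
    have h4 : R * pi j ≤ 1 / δ := by linarith
    have h5 : δ ^ 2 * (R * pi j) ≤ δ ^ 2 * (1 / δ) := by gcongr
    have h6 : δ ^ 2 * (1 / δ) = δ := by field_simp
    have h7 : δ ^ 2 * (R * pi j) = pi j := by rw [← mul_assoc, hδR, one_mul]
    linarith
  intro k
  have e : 1 / δ * (pi k * |δ * (R - min (k : ℝ) n)|) = pi k * |R - min (k : ℝ) n| := by
    rw [abs_mul, abs_of_pos hδ]; field_simp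
  simp only [e]
  have hk := hnn k
  have hab := neg_abs_le (R - min (k : ℝ) n)
  have hab0 := abs_nonneg (R - min (k : ℝ) n)
  rcases lt_trichotomy k j with h | h | h
  · rw [if_neg (by omega), if_neg (by omega), if_neg (by omega)]
    have := mul_nonneg hk hab0
    linarith
  · subst h
    rw [if_pos rfl, if_pos (by omega), if_neg (by omega)]
    have := mul_nonneg hk hab0
    linarith
  · rw [if_neg (by omega), if_pos (by omega), if_pos (by omega)]
    have := mul_le_mul_of_nonneg_left hab hk
    linarith

/-- Mills-type bound on the left. -/
lemma ec_left (β : ℝ) (nu : ℝ → ℝ) (hpos : ∀ x, 0 < nu x) (hint : Integrable nu)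
    (hder : ∀ x, HasDerivAt nu (-min x β * nu x) x) (x : ℝ) :
    -min x β * (∫ t in Iic x, nu t) ≤ nu x := by
  have hc : Continuous nu := continuous_iff_continuousAt.2 fun x => (hder x).continuousAt
  have ht := (intervalIntegral_tendsto_integral_Iic x hint.integrableOn
    Filter.tendsto_id).const_mul (-min x β)
  refine le_of_tendsto ht ?_
  filter_upwards [Filter.eventually_le_atBot x] with T hT
  have hcd : Continuous (fun t => -min t β * nu t) := by fun_prop
  have h1 : ∫ t in T..x, -min t β * nu t = nu x - nu T :=
    intervalIntegral.integral_eq_sub_of_hasDerivAt (fun t _ => hder t)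
      (hcd.intervalIntegrable _ _)
  simp only [id]
  rw [← intervalIntegral.integral_const_mul]
  have h2 : ∫ t in T..x, -min x β * nu t ≤ ∫ t in T..x, -min t β * nu t := by
    refine intervalIntegral.integral_mono_on hT
      (Continuous.intervalIntegrable (by fun_prop) _ _) (hcd.intervalIntegrable _ _) ?_
    intro t ht
    have := hpos t
    have : min t β ≤ min x β := min_le_min_right _ ht.2
    gcongr
  have := hpos T
  linarith

lemma ec_right (β : ℝ) (nu : ℝ → ℝ) (hpos : ∀ x, 0 < nu x) (hint : Integrable nu)
    (hder : ∀ x, HasDerivAt nu (-min x β * nu x) x) (x : ℝ) :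
    min x β * (∫ t in Ioi x, nu t) ≤ nu x := by
  have hc : Continuous nu := continuous_iff_continuousAt.2 fun x => (hder x).continuousAt
  have ht := (intervalIntegral_tendsto_integral_Ioi x hint.integrableOn
    Filter.tendsto_id).const_mul (min x β)
  refine le_of_tendsto ht ?_
  filter_upwards [Filter.eventually_ge_atTop x] with T hT
  have hcd : Continuous (fun t => -min t β * nu t) := by fun_prop
  have h1 : ∫ t in x..T, -min t β * nu t = nu T - nu x :=
    intervalIntegral.integral_eq_sub_of_hasDerivAt (fun t _ => hder t)
      (hcd.intervalIntegrable _ _)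
  have h1' : ∫ t in x..T, min t β * nu t = nu x - nu T := by
    have : (fun t => -min t β * nu t) = fun t => -(min t β * nu t) := by funext t; ring
    rw [this, intervalIntegral.integral_neg] at h1
    linarith
  simp only [id]
  rw [← intervalIntegral.integral_const_mul]
  have h2 : ∫ t in x..T, min x β * nu t ≤ ∫ t in x..T, min t β * nu t := by
    refine intervalIntegral.integral_mono_on hT
      (Continuous.intervalIntegrable (by fun_prop) _ _)
      (Continuous.intervalIntegrable (by fun_prop) _ _) ?_
    intro t ht
    have := hpos t
    have : min x β ≤ min t β := min_le_min_right _ ht.1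
    gcongr
  have := hpos T
  linarith

lemma ec_mid (β : ℝ) (hβ : 0 < β) (nu : ℝ → ℝ) (hpos : ∀ x, 0 < nu x) (hint : Integrable nu)
    (hder : ∀ x, HasDerivAt nu (-min x β * nu x) x) (x : ℝ) (h1 : -1 ≤ x) (h2 : x ≤ 1) :
    (∫ t in Iic x, nu t) ≤ 24 * nu x := by
  have hc : Continuous nu := continuous_iff_continuousAt.2 fun x => (hder x).continuousAt
  have hd : ∀ t, HasDerivAt (fun t => nu t * Real.exp t)
      (-min t β * nu t * Real.exp t + nu t * Real.exp t) t :=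
    fun t => (hder t).mul (Real.hasDerivAt_exp t)
  have hmono : MonotoneOn (fun t => nu t * Real.exp t) (Icc (-1) 1) := by
    refine monotoneOn_of_deriv_nonneg (convex_Icc _ _) (by fun_prop)
      (fun t _ => (hd t).differentiableAt.differentiableWithinAt) ?_
    intro t ht
    rw [interior_Icc] at ht
    rw [(hd t).deriv]
    have h3 : min t β ≤ 1 := (min_le_left _ _).trans ht.2.le
    have : -min t β * nu t * Real.exp t + nu t * Real.exp t =
      (1 - min t β) * (nu t * Real.exp t) := by ring
    rw [this]
    have := hpos t
    have := Real.exp_pos t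
    exact mul_nonneg (by linarith) (by positivity)
  have he2 : Real.exp 2 ≤ 8 := by
    have h := Real.exp_one_lt_d9
    have h' : Real.exp 2 = Real.exp 1 * Real.exp 1 := by rw [← Real.exp_add]; norm_num
    have h0 := Real.exp_pos 1
    rw [h']; nlinarith
  have hle : ∀ t, -1 ≤ t → t ≤ x → nu t ≤ 8 * nu x := by
    intro t ht1 htx
    have h3 : nu t * Real.exp t ≤ nu x * Real.exp x :=
      hmono ⟨ht1, htx.trans h2⟩ ⟨h1, h2⟩ htx
    have h4 : Real.exp x = Real.exp t * Real.exp (x - t) := by rw [← Real.exp_add]; ring_nf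
    have h5 : Real.exp (x - t) ≤ 8 := (Real.exp_le_exp.2 (by linarith)).trans he2
    rw [h4] at h3
    have h6 : nu t ≤ nu x * Real.exp (x - t) := by
      have := Real.exp_pos t
      refine le_of_mul_le_mul_right ?_ this
      linarith
    have := mul_le_mul_of_nonneg_left h5 (hpos x).le
    linarith
  have hL := ec_left β nu hpos hint hder (-1)
  rw [min_eq_left (by linarith)] at hL
  have hsplit := intervalIntegral.integral_Iic_sub_Iic (f := nu) (μ := volume) (a := -1) (b := x)
    hint.integrableOn hint.integrableOn
  have h7 : ∫ t in (-1)..x, nu t ≤ ∫ t in (-1)..x, 8 * nu x :=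
    intervalIntegral.integral_mono_on h1 (hc.intervalIntegrable _ _)
      (continuous_const.intervalIntegrable _ _) (fun t ht => hle t ht.1 ht.2)
  rw [intervalIntegral.integral_const, smul_eq_mul] at h7
  have h8 := hle (-1) le_rfl h1
  have := hpos x
  nlinarith

/-- Facts about the Stein solution. -/
lemma ec_stein (β : ℝ) (hβ : 0 < β) (nu : ℝ → ℝ) (hpos : ∀ x, 0 < nu x) (hint : Integrable nu)
    (hone : ∫ x, nu x = 1)
    (hder : ∀ x, HasDerivAt nu (-min x β * nu x) x) (a p : ℝ) (hp : p = ∫ t in Iic a, nu t) :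
    0 ≤ p ∧ p ≤ 1 ∧ ∃ f : ℝ → ℝ, (∀ y, |min y β * f y| ≤ 1) ∧ (∀ y, y ≤ β → |f y| ≤ 24) ∧ Continuous f ∧
      ∀ y, HasDerivWithinAt f ((if y < a then 1 else 0) - p + min y β * f y) (Ici y) y := by
  have hc : Continuous nu := continuous_iff_continuousAt.2 fun x => (hder x).continuousAt
  set F : ℝ → ℝ := fun x => ∫ t in Iic x, nu t with hF
  have hFd : ∀ x, HasDerivAt F (nu x) x := by
    intro x
    have h1 : F = fun x => F 0 + ∫ t in (0:ℝ)..x, nu t := by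
      funext y
      rw [← intervalIntegral.integral_Iic_sub_Iic hint.integrableOn hint.integrableOn]
      simp [hF]
    rw [h1]
    exact (intervalIntegral.integral_hasDerivAt_right (hc.intervalIntegrable _ _)
      (hc.stronglyMeasurableAtFilter _ _) hc.continuousAt).const_add _
  have hFc : Continuous F := continuous_iff_continuousAt.2 fun x => (hFd x).continuousAt
  have hF0 : ∀ x, 0 ≤ F x := fun x => integral_nonneg fun t => (hpos t).le
  have hG : ∀ x, ∫ t in Ioi x, nu t = 1 - F x := by
    intro x
    have := intervalIntegral.integral_Iic_add_Ioi (b := x) (f := nu) (μ := volume)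
      hint.integrableOn hint.integrableOn
    rw [hone] at this
    simp only [hF]; linarith
  have hF1 : ∀ x, F x ≤ 1 := by
    intro x
    have h : 0 ≤ ∫ t in Ioi x, nu t := integral_nonneg fun t => (hpos t).le
    rw [hG] at h; linarith
  have hFm : Monotone F := monotone_of_hasDerivAt_nonneg hFd fun x => (hpos x).le
  have hpF : p = F a := hp
  refine ⟨hpF ▸ hF0 a, hpF ▸ hF1 a, fun y => (F (min y a) - p * F y) / nu y, ?_⟩
  have hL : ∀ y, -min y β * F y ≤ nu y := ec_left β nu hpos hint hder
  have hRt : ∀ y, min y β * (1 - F y) ≤ nu y := by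
    intro y; rw [← hG]; exact ec_right β nu hpos hint hder y
  have hGb : ∀ y, 0 ≤ F (min y a) - p * F y ∧ F (min y a) - p * F y ≤ F y ∧
      F (min y a) - p * F y ≤ 1 - F y := by
    intro y
    have a0 := hF0 a
    have a1 := hF1 a
    have y0 := hF0 y
    have y1 := hF1 y
    rcases le_total y a with h | h
    · have := hFm h
      rw [min_eq_left h, hpF]
      refine ⟨?_, ?_, ?_⟩ <;> nlinarith
    · have := hFm h
      rw [min_eq_right h, hpF]
      refine ⟨?_, ?_, ?_⟩ <;> nlinarith
  refine ⟨?_, ?_, ?_, ?_⟩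
  · intro y
    obtain ⟨g0, g1, g2⟩ := hGb y
    rw [← mul_div_assoc, abs_div, abs_of_pos (hpos y), div_le_one (hpos y), abs_mul,
      abs_of_nonneg g0]
    rcases le_total 0 y with h | h
    · have hm : 0 ≤ min y β := le_min h hβ.le
      rw [abs_of_nonneg hm]
      exact (mul_le_mul_of_nonneg_left g2 hm).trans (hRt y)
    · have hm : min y β ≤ 0 := (min_le_left _ _).trans h
      rw [abs_of_nonpos hm]
      exact (mul_le_mul_of_nonneg_left g1 (by linarith)).trans (hL y)
  · intro y hy
    obtain ⟨g0, g1, g2⟩ := hGb y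
    rw [abs_div, abs_of_pos (hpos y), div_le_iff₀ (hpos y), abs_of_nonneg g0]
    have hny := hpos y
    rcases le_total y (-1) with h | h
    · have := hL y
      rw [min_eq_left hy] at this
      have y0 := hF0 y
      nlinarith
    rcases le_total y 1 with h' | h'
    · exact g1.trans (ec_mid β hβ nu hpos hint hder y h h')
    · have := hRt y
      rw [min_eq_left hy] at this
      have y1 := hF1 y
      nlinarith
  · exact Continuous.div (by fun_prop) hc fun y => (hpos y).ne'
  · intro y
    have hny := (hpos y).ne'
    have hFmin : HasDerivWithinAt (fun y => F (min y a)) ((if y < a then 1 else 0) * nu y)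
        (Ici y) y := by
      split_ifs with h
      · rw [one_mul]
        refine ((hFd y).congr_of_eventuallyEq ?_).hasDerivWithinAt
        filter_upwards [eventually_lt_nhds h] with t ht
        rw [min_eq_left ht.le]
      · rw [zero_mul]
        refine (hasDerivWithinAt_const y (Ici y) (F a)).congr ?_ ?_
        · intro t ht
          rw [min_eq_right ((not_lt.1 h).trans ht)]
        · rw [min_eq_right (not_lt.1 h)]
    have := (hFmin.sub ((hFd y).hasDerivWithinAt.const_mul p)).div (hder y).hasDerivWithinAt hny
    refine this.congr_deriv ?_
    simp only [Pi.sub_apply]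
    field_simp
    ring

/-- One-step error. -/
lemma ec_step (β δ a p : ℝ) (hδ : 0 < δ) (hp0 : 0 ≤ p) (hp1 : p ≤ 1) (f : ℝ → ℝ)
    (hf1 : ∀ y, |min y β * f y| ≤ 1) (hf2 : ∀ y, y ≤ β → |f y| ≤ 24) (hfc : Continuous f)
    (hfd : ∀ y, HasDerivWithinAt f ((if y < a then 1 else 0) - p + min y β * f y) (Ici y) y)
    (x : ℝ) (hx : x + δ ≤ β ∨ β ≤ x) :
    |f (x + δ) - f x - δ * (min x β * f x) - δ * ((if x ≤ a then 1 else 0) - p)| ≤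
      δ * (δ * (2 * |min x β| + 24) + if x ≤ a ∧ a < x + δ then 3 else 0) := by
  have hlip : ∀ y, x ≤ y → |f y - f x| ≤ 2 * (y - x) := by
    intro y hy
    refine norm_image_sub_le_of_norm_deriv_right_le_segment (hfc.continuousOn (s := Icc x y))
      (fun t _ => hfd t) (C := 2) ?_ y ⟨hy, le_rfl⟩
    intro t _
    rw [Real.norm_eq_abs]
    have := abs_le.1 (hf1 t)
    rw [abs_le]
    split_ifs <;> constructor <;> linarith
  set c : ℝ := (if x ≤ a then 1 else 0) - p with hcdef
  have hmain := norm_image_sub_le_of_norm_deriv_right_le_segment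
    (f := fun y => f y - (min x β * f x + c) * y)
    (f' := fun y => ((if y < a then 1 else 0) - p + min y β * f y) - (min x β * f x + c) * 1)
    (a := x) (b := x + δ)
    (C := δ * (2 * |min x β| + 24) + if x ≤ a ∧ a < x + δ then 3 else 0)
    (by fun_prop)
    (fun y _ => (hfd y).sub ((hasDerivWithinAt_id y (Ici y)).const_mul _)) ?_ (x + δ)
    ⟨by linarith, le_rfl⟩
  · rw [Real.norm_eq_abs] at hmain
    convert hmain using 1
    · congr 1; ring
    · ring
  intro y hy
  rw [Real.norm_eq_abs]
  have hnn : 0 ≤ δ * (2 * |min x β| + 24) := by positivity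
  by_cases hI : x ≤ a ∧ a < x + δ
  · rw [if_pos hI, hcdef]
    have h1 := abs_le.1 (hf1 x)
    have h2 := abs_le.1 (hf1 y)
    rw [abs_le]
    split_ifs <;> constructor <;> linarith
  · rw [if_neg hI, hcdef]
    have hcc : (if y < a then (1:ℝ) else 0) = if x ≤ a then 1 else 0 := by
      by_cases hxa : x ≤ a
      · have : ¬ a < x + δ := fun h => hI ⟨hxa, h⟩
        rw [if_pos hxa, if_pos (by linarith [hy.2])]
      · rw [if_neg hxa, if_neg (by linarith [hy.1])]
    rw [hcc]
    have e : (if x ≤ a then (1:ℝ) else 0) - p + min y β * f y -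
        (min x β * f x + ((if x ≤ a then 1 else 0) - p)) * 1 =
        min x β * (f y - f x) + (min y β - min x β) * f y := by ring
    rw [e, add_zero]
    have h1 : |min x β * (f y - f x)| ≤ |min x β| * (2 * δ) := by
      rw [abs_mul]
      have := hlip y hy.1
      have h3 := hy.2
      gcongr
      linarith
    have h2 : |(min y β - min x β) * f y| ≤ δ * 24 := by
      rcases hx with h | h
      · have hyb : y ≤ β := by linarith [hy.2]
        have hxb : x ≤ β := by linarith
        rw [min_eq_left hyb, min_eq_left hxb, abs_mul, abs_of_nonneg (by linarith [hy.1])]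
        have := hf2 y hyb
        have h3 := hy.2
        gcongr
        linarith
      · rw [min_eq_right h, min_eq_right (h.trans hy.1)]
        simp only [sub_self, zero_mul, abs_zero]
        positivity
    have := abs_add_le (min x β * (f y - f x)) ((min y β - min x β) * f y)
    linarith

/-- Erlang-C: Kolmogorov distance between the scaled stationary customer count
and the diffusion approximation is at most `156 / √R`, universally in the
parameters satisfying `1 ≤ R < n`. -/
theorem erlangC_kolmogorov
    (lam mu : ℝ) (n : ℕ)
    (hlam : 0 < lam) (hmu : 0 < mu) (hn : 1 ≤ n)
    (R δ ζ : ℝ)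
    (hR : R = lam / mu) (hR1 : 1 ≤ R) (hRn : R < (n : ℝ))
    (hδ : δ = 1 / Real.sqrt R) (hζ : ζ = δ * (R - (n : ℝ)))
    (pi : ℕ → ℝ)
    (hpi_nonneg : ∀ k, 0 ≤ pi k)
    (hpi_sum : (∑' k : ℕ, pi k) = 1)
    (hflow : ∀ k : ℕ, lam * pi k = mu * min ((k : ℝ) + 1) (n : ℝ) * pi (k + 1))
    (b : ℝ → ℝ)
    (hb : ∀ x : ℝ, b x = if x ≤ -ζ then -(mu * x) else mu * ζ)
    (kappa : ℝ) (hkappa : 0 < kappa)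
    (nu : ℝ → ℝ)
    (hnu : ∀ x : ℝ, nu x = kappa * Real.exp ((1 / mu) * ∫ y in (0:ℝ)..x, b y))
    (hnu_norm : (∫ x : ℝ, nu x) = 1) :
    ∀ a : ℝ,
      |(∑' k : ℕ, if δ * ((k : ℝ) - R) ≤ a then pi k else 0)
          - (∫ x in Set.Iic a, nu x)| ≤ 156 / Real.sqrt R := by
  intro a
  have hR0 : 0 < R := by linarith
  have hsq : 0 < Real.sqrt R := Real.sqrt_pos.2 hR0
  have hδ0 : 0 < δ := by rw [hδ]; positivity
  have hδR : δ ^ 2 * R = 1 := by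
    rw [hδ, div_pow, Real.sq_sqrt hR0.le]; field_simp
  have hs : HasSum pi 1 := by
    have : Summable pi := by
      by_contra h
      rw [tsum_eq_zero_of_not_summable h] at hpi_sum
      norm_num at hpi_sum
    rw [← hpi_sum]; exact this.hasSum
  have hflow' : ∀ k : ℕ, R * pi k = min ((k : ℝ) + 1) (n : ℝ) * pi (k + 1) := by
    intro k
    have := hflow k
    rw [hR]
    field_simp
    linarith
  obtain ⟨β, hβd⟩ : ∃ β, β = -ζ := ⟨_, rfl⟩
  have hβe : β = δ * ((n : ℝ) - R) := by rw [hβd, hζ]; ring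
  have hβ : 0 < β := by rw [hβe]; exact mul_pos hδ0 (by linarith)
  have hb' : b = fun x => mu * (-min x β) := by
    funext x
    rw [hb x, ← hβd]
    split_ifs with h
    · rw [min_eq_left h]; ring
    · rw [min_eq_right (not_le.1 h).le, hβd]; ring
  have hpos : ∀ x, 0 < nu x := by intro x; rw [hnu x]; positivity
  have hbc : Continuous b := by rw [hb']; fun_prop
  have hder : ∀ x, HasDerivAt nu (-min x β * nu x) x := by
    intro x
    have h1 : HasDerivAt (fun x => ∫ y in (0:ℝ)..x, b y) (b x) x :=
      intervalIntegral.integral_hasDerivAt_right (hbc.intervalIntegrable _ _)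
        (hbc.stronglyMeasurableAtFilter _ _) hbc.continuousAt
    have h2 := ((h1.const_mul (1 / mu)).exp).const_mul kappa
    have h3 : nu = fun x => kappa * Real.exp ((1 / mu) * ∫ y in (0:ℝ)..x, b y) := funext hnu
    rw [← h3] at h2
    refine h2.congr_deriv ?_
    rw [hnu x]
    have : b x = mu * (-min x β) := by rw [hb']
    rw [this]
    field_simp
  have hint : Integrable nu := by
    by_contra h
    rw [integral_undef h] at hnu_norm
    norm_num at hnu_norm
  obtain ⟨p, hp⟩ : ∃ p, p = ∫ t in Iic a, nu t := ⟨_, rfl⟩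
  obtain ⟨hp0, hp1, f, hf1, hf2, hfc, hfd⟩ := ec_stein β hβ nu hpos hint hnu_norm hder a p hp
  rw [← hp]
  -- boundedness of `f`
  have hfb : ∀ y, |f y| ≤ 24 + 1 / β := by
    intro y
    have hib : 0 < 1 / β := by positivity
    rcases le_total y β with h | h
    · linarith [hf2 y h]
    · have := hf1 y
      rw [min_eq_right h, abs_mul, abs_of_pos hβ] at this
      have : |f y| ≤ 1 / β := by rw [le_div_iff₀ hβ]; linarith
      linarith
  have hmin : ∀ k : ℕ, min (δ * ((k : ℝ) - R)) β = -(δ * (R - min (k : ℝ) n)) := by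
    intro k
    rw [hβe, ← mul_min_of_nonneg _ _ hδ0.le, min_sub_sub_right]
    ring
  have hid := ec_discr R n pi hpi_nonneg hs.summable hflow'
    (fun k => f (δ * ((k : ℝ) - R))) _ (fun k => hfb _)
  obtain ⟨E, hE, hE1⟩ := ec_moment R δ n pi hR0 hδ0 hδR hpi_nonneg hs hflow'
  obtain ⟨j, hj⟩ : ∃ j : ℕ, j = ⌊a / δ + R⌋₊ := ⟨_, rfl⟩
  have hatom := ec_atom R δ n pi hR0 hδ0 hδR hpi_nonneg hs hflow' j
  have hsI : Summable (fun k : ℕ => if δ * ((k : ℝ) - R) ≤ a then pi k else 0) := by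
    refine Summable.of_nonneg_of_le (fun k => ?_) (fun k => ?_) hs.summable
    · have := hpi_nonneg k
      split_ifs <;> simp [this]
    · have := hpi_nonneg k
      split_ifs <;> simp [this]
  obtain ⟨P, hP⟩ := hsI
  rw [hP.tsum_eq]
  -- signed sum
  have hA : HasSum (fun k : ℕ => pi k * (f (δ * ((k : ℝ) - R) + δ) - f (δ * ((k : ℝ) - R))
      - δ * (min (δ * ((k : ℝ) - R)) β * f (δ * ((k : ℝ) - R)))
      - δ * ((if δ * ((k : ℝ) - R) ≤ a then 1 else 0) - p))) (-(δ * (P - p))) := by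
    have := (hid.mul_left (δ ^ 2)).sub ((hP.sub (hs.mul_left p)).mul_left δ)
    convert this using 1
    · rfl
    · funext k
      rw [hmin k]
      have e1 : δ * ((k : ℝ) - R) + δ = δ * (((k + 1 : ℕ) : ℝ) - R) := by push_cast; ring
      rw [e1]
      have e2 : δ ^ 2 * (pi k * (R * f (δ * (((k + 1 : ℕ) : ℝ) - R)) -
          min (k : ℝ) n * f (δ * ((k : ℝ) - R)))) =
          pi k * ((δ ^ 2 * R) * f (δ * (((k + 1 : ℕ) : ℝ) - R)) -
          δ ^ 2 * min (k : ℝ) n * f (δ * ((k : ℝ) - R))) := by ring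
      have e3 : δ * (-(δ * (R - min (k : ℝ) n)) * f (δ * ((k : ℝ) - R))) =
          (δ ^ 2 * min (k : ℝ) n - δ ^ 2 * R) * f (δ * ((k : ℝ) - R)) := by ring
      rw [e2, e3, hδR]
      split_ifs <;> ring
    · ring
  have hB : HasSum (fun k : ℕ => δ * (δ * (2 * (pi k * |δ * (R - min (k : ℝ) n)|) + 24 * pi k) +
      if k = j then 3 * pi j else 0)) (δ * (δ * (2 * E + 24 * 1) + 3 * pi j)) :=
    ((((hE.mul_left 2).add (hs.mul_left 24)).mul_left δ).add
      (hasSum_ite_eq j (3 * pi j))).mul_left δ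
  have hbound : ∀ k : ℕ, |pi k * (f (δ * ((k : ℝ) - R) + δ) - f (δ * ((k : ℝ) - R))
      - δ * (min (δ * ((k : ℝ) - R)) β * f (δ * ((k : ℝ) - R)))
      - δ * ((if δ * ((k : ℝ) - R) ≤ a then 1 else 0) - p))| ≤
      δ * (δ * (2 * (pi k * |δ * (R - min (k : ℝ) n)|) + 24 * pi k) +
      if k = j then 3 * pi j else 0) := by
    intro k
    have hk := hpi_nonneg k
    rw [abs_mul, abs_of_nonneg hk]
    have hst := ec_step β δ a p hδ0 hp0 hp1 f hf1 hf2 hfc hfd (δ * ((k : ℝ) - R)) (by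
      rcases lt_or_ge k n with h | h
      · left
        have : (k : ℝ) + 1 ≤ n := by exact_mod_cast h
        rw [hβe]
        nlinarith
      · right
        have : (n : ℝ) ≤ k := by exact_mod_cast h
        rw [hβe]
        gcongr)
    refine (mul_le_mul_of_nonneg_left hst hk).trans ?_
    rw [hmin k, abs_neg]
    have hind : pi k * (if δ * ((k : ℝ) - R) ≤ a ∧ a < δ * ((k : ℝ) - R) + δ then (3:ℝ) else 0) ≤
        if k = j then 3 * pi j else 0 := by
      by_cases h : δ * ((k : ℝ) - R) ≤ a ∧ a < δ * ((k : ℝ) - R) + δ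
      · have hkj : k = j := by
          rw [hj, eq_comm]
          have h1 : (k : ℝ) ≤ a / δ + R := by
            have : (k : ℝ) - R ≤ a / δ := by rw [le_div_iff₀ hδ0]; linarith [h.1]
            linarith
          have h2 : a / δ + R < k + 1 := by
            have : a / δ < (k : ℝ) - R + 1 := by rw [div_lt_iff₀ hδ0]; linarith [h.2]
            linarith
          rw [Nat.floor_eq_iff (le_trans (by positivity) h1)]
          exact ⟨h1, h2⟩
        rw [if_pos h, if_pos hkj, hkj]; linarith
      · rw [if_neg h, mul_zero]
        have := hpi_nonneg j
        split_ifs <;> positivity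
    have := mul_le_mul_of_nonneg_left hind hδ0.le
    linarith
  have hup := hasSum_le (fun k => (le_abs_self _).trans (hbound k)) hA hB
  have hlo := hasSum_le (fun k => (neg_le_abs _).trans (hbound k)) hA.neg hB
  have hfin : δ * |P - p| ≤ δ * (156 * δ) := by
    have h1 : δ * |P - p| ≤ δ * (δ * (2 * E + 24 * 1) + 3 * pi j) := by
      rw [← abs_of_pos hδ0, ← abs_mul, abs_of_pos hδ0, abs_le]
      constructor <;> linarith
    refine h1.trans (mul_le_mul_of_nonneg_left ?_ hδ0.le)
    nlinarith
  have := le_of_mul_le_mul_left hfin hδ0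
  rw [hδ] at this
  calc |P - p| ≤ 156 * (1 / Real.sqrt R) := this
    _ = 156 / Real.sqrt R := by ring
end

section
/- There exists a nondecreasing function C_K : (0,∞) → (0,∞) such that for all integers n ≥ 1 and all λ > 0, μ > 0, α > 0 satisfying R = λ/μ ≥ 1, the Kolmogorov distance between the scaled stationary Erlang-A customer count and its diffusion approximation satisfies d_K(X̃(∞), Y(∞)) ≤ C_K(α/μ)·δ, where δ = 1/√R. -/
open MeasureTheory Set

lemma ea_cmp_left (p m q q' : ℝ → ℝ) (hp : ∀ t, 0 < p t)
    (hd : ∀ t, HasDerivAt p (m t * p t) t) (hq : ∀ t, HasDerivAt q (q' t) t)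
    (w t : ℝ) (hwt : w ≤ t) (h : ∀ y, w ≤ y → y ≤ t → q' y ≤ m y) :
    p w ≤ p t * Real.exp (q w - q t) := by
  have hder : ∀ y, HasDerivAt (fun y => Real.log (p y) - q y) (m y - q' y) y := by
    intro y
    have := ((hd y).log (hp y).ne').sub (hq y)
    rw [mul_div_cancel_right₀ _ (hp y).ne'] at this
    exact this
  have hmono : MonotoneOn (fun y => Real.log (p y) - q y) (Icc w t) := by
    apply monotoneOn_of_deriv_nonneg (convex_Icc _ _)
    · exact fun y _ => (hder y).continuousAt.continuousWithinAt
    · exact fun y _ => (hder y).differentiableAt.differentiableWithinAt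
    · intro y hy
      rw [interior_Icc] at hy
      rw [(hder y).deriv]
      linarith [h y hy.1.le hy.2.le]
  have h1 := hmono (left_mem_Icc.2 hwt) (right_mem_Icc.2 hwt) hwt
  simp only at h1
  rw [← Real.exp_log (hp w), ← Real.exp_log (hp t), ← Real.exp_add, Real.exp_le_exp]
  linarith

lemma ea_cmp_right (p m q q' : ℝ → ℝ) (hp : ∀ t, 0 < p t)
    (hd : ∀ t, HasDerivAt p (m t * p t) t) (hq : ∀ t, HasDerivAt q (q' t) t)
    (w t : ℝ) (hwt : t ≤ w) (h : ∀ y, t ≤ y → y ≤ w → m y ≤ q' y) :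
    p w ≤ p t * Real.exp (q w - q t) := by
  have hder : ∀ y, HasDerivAt (fun y => Real.log (p y) - q y) (m y - q' y) y := by
    intro y
    have := ((hd y).log (hp y).ne').sub (hq y)
    rw [mul_div_cancel_right₀ _ (hp y).ne'] at this
    exact this
  have hmono : AntitoneOn (fun y => Real.log (p y) - q y) (Icc t w) := by
    apply antitoneOn_of_deriv_nonpos (convex_Icc _ _)
    · exact fun y _ => (hder y).continuousAt.continuousWithinAt
    · exact fun y _ => (hder y).differentiableAt.differentiableWithinAt
    · intro y hy
      rw [interior_Icc] at hy
      rw [(hder y).deriv]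
      linarith [h y hy.1.le hy.2.le]
  have h1 := hmono (left_mem_Icc.2 hwt) (right_mem_Icc.2 hwt) hwt
  simp only at h1
  rw [← Real.exp_log (hp w), ← Real.exp_log (hp t), ← Real.exp_add, Real.exp_le_exp]
  linarith

/-- Mills bound, left. -/
lemma ea_mills_left (p m : ℝ → ℝ) (hp : ∀ t, 0 < p t)
    (hd : ∀ t, HasDerivAt p (m t * p t) t) (hm : Antitone m) (hi : Integrable p) (t : ℝ) :
    (∫ w in Iic t, p w) * m t ≤ p t := by
  rcases le_or_gt (m t) 0 with h0 | h0
  · have : 0 ≤ ∫ w in Iic t, p w := integral_nonneg fun w => (hp w).le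
    nlinarith [hp t]
  have hq : ∀ y, HasDerivAt (fun y => m t * y) (m t) y := fun y => by
    simpa using (hasDerivAt_id y).const_mul (m t)
  have key : ∀ w ∈ Iic t, p w ≤ (p t * Real.exp (-(m t * t))) * Real.exp (m t * w) := by
    intro w hw
    have := ea_cmp_left p m _ _ hp hd hq w t hw (fun y _ hy => hm hy)
    rw [sub_eq_add_neg, Real.exp_add] at this
    linarith
  have hint : IntegrableOn (fun w => (p t * Real.exp (-(m t * t))) * Real.exp (m t * w)) (Iic t) :=
    (integrableOn_exp_mul_Iic h0 t).const_mul _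
  have h2 := setIntegral_mono_on hi.integrableOn hint measurableSet_Iic key
  rw [integral_const_mul, integral_exp_mul_Iic h0, Real.exp_neg] at h2
  have h3 : p t * (Real.exp (m t * t))⁻¹ * (Real.exp (m t * t) / m t) = p t / m t := by
    field_simp
  rw [h3, le_div_iff₀ h0] at h2
  exact h2

lemma ea_mills_right (p m : ℝ → ℝ) (hp : ∀ t, 0 < p t)
    (hd : ∀ t, HasDerivAt p (m t * p t) t) (hm : Antitone m) (hi : Integrable p) (t : ℝ) :
    (∫ w in Ioi t, p w) * (-m t) ≤ p t := by
  rcases le_or_gt 0 (m t) with h0 | h0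
  · have : 0 ≤ ∫ w in Ioi t, p w := integral_nonneg fun w => (hp w).le
    nlinarith [hp t]
  have hq : ∀ y, HasDerivAt (fun y => m t * y) (m t) y := fun y => by
    simpa using (hasDerivAt_id y).const_mul (m t)
  have key : ∀ w ∈ Ioi t, p w ≤ (p t * Real.exp (-(m t * t))) * Real.exp (m t * w) := by
    intro w hw
    have := ea_cmp_right p m _ _ hp hd hq w t (le_of_lt hw) (fun y hy _ => hm hy)
    rw [sub_eq_add_neg, Real.exp_add] at this
    linarith
  have hint : IntegrableOn (fun w => (p t * Real.exp (-(m t * t))) * Real.exp (m t * w)) (Ioi t) :=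
    (integrableOn_exp_mul_Ioi h0 t).const_mul _
  have h2 := setIntegral_mono_on hi.integrableOn hint measurableSet_Ioi key
  rw [integral_const_mul, integral_exp_mul_Ioi h0, Real.exp_neg] at h2
  have h3 : p t * (Real.exp (m t * t))⁻¹ * (-Real.exp (m t * t) / m t) = p t / (-m t) := by
    field_simp
  rw [h3, le_div_iff₀ (by linarith)] at h2
  exact h2

/-- Gaussian bound. -/
lemma ea_gauss (p : ℝ → ℝ) (S : Set ℝ) (hS : MeasurableSet S) (hi : Integrable p) (t c : ℝ)
    (hc : 0 < c) (hpt : 0 < p t)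
    (h : ∀ w ∈ S, p w ≤ p t * Real.exp (Real.sqrt c * |w - t| - c * (w - t) ^ 2 / 2)) :
    (∫ w in S, p w) * Real.sqrt c ≤ p t * (Real.exp 1 * Real.sqrt (4 * Real.pi)) := by
  have key : ∀ w ∈ S, p w ≤ (p t * Real.exp 1) * Real.exp (-(c / 4) * (w - t) ^ 2) := by
    intro w hw
    refine (h w hw).trans ?_
    rw [mul_assoc, ← Real.exp_add]
    refine mul_le_mul_of_nonneg_left (Real.exp_le_exp.2 ?_) hpt.le
    have h1 := Real.sq_sqrt hc.le
    have h2 := sq_abs (w - t)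
    rw [← h2, ← h1, Real.sqrt_sq (Real.sqrt_nonneg _)]
    nlinarith [sq_nonneg (Real.sqrt c * |w - t| / 2 - 1)]
  have hg : Integrable (fun w : ℝ => Real.exp (-(c / 4) * (w - t) ^ 2)) :=
    (integrable_exp_neg_mul_sq (by positivity : 0 < c / 4)).comp_sub_right t
  have hint := hg.const_mul (p t * Real.exp 1)
  have h2 := setIntegral_mono_on hi.integrableOn hint.integrableOn hS key
  have h3 : ∫ w in S, (p t * Real.exp 1) * Real.exp (-(c / 4) * (w - t) ^ 2)
      ≤ ∫ w, (p t * Real.exp 1) * Real.exp (-(c / 4) * (w - t) ^ 2) :=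
    setIntegral_le_integral hint (Filter.Eventually.of_forall fun w => by positivity)
  have h5 : ∫ w, (p t * Real.exp 1) * Real.exp (-(c / 4) * (w - t) ^ 2)
      = p t * Real.exp 1 * Real.sqrt (Real.pi / (c / 4)) := by
    rw [integral_const_mul, integral_sub_right_eq_self (fun w : ℝ => Real.exp (-(c / 4) * w ^ 2)),
      integral_gaussian]
  rw [h5] at h3
  have h4 : Real.sqrt (Real.pi / (c / 4)) * Real.sqrt c = Real.sqrt (4 * Real.pi) := by
    rw [← Real.sqrt_mul (by positivity)]
    congr 1
    field_simp
  calc _ ≤ (p t * Real.exp 1 * Real.sqrt (Real.pi / (c / 4))) * Real.sqrt c :=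
        mul_le_mul_of_nonneg_right (h2.trans h3) (Real.sqrt_nonneg _)
    _ = _ := by rw [mul_assoc, h4]; ring

/-- local Stein estimate -/
lemma ea_loc (g m : ℝ → ℝ) (h x y : ℝ) (hxy : x ≤ y) (hh : |h| ≤ 1)
    (hg : ∀ t, HasDerivAt g (h - m t * g t) t)
    (hb : ∀ t ∈ Icc x y, |m t * g t| ≤ 1) : |g y - g x| ≤ 2 * (y - x) := by
  have := Convex.norm_image_sub_le_of_norm_hasDerivWithin_le (f := g)
    (f' := fun t => h - m t * g t) (s := Icc x y) (C := 2) (x := x) (y := y)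
    (fun t _ => (hg t).hasDerivWithinAt)
    (fun t ht => by
      rw [Real.norm_eq_abs]
      refine (abs_sub _ _).trans ?_
      linarith [hb t ht]) (convex_Icc _ _) (left_mem_Icc.2 hxy) (right_mem_Icc.2 hxy)
  rwa [Real.norm_eq_abs, Real.norm_eq_abs, abs_of_nonneg (sub_nonneg.2 hxy)] at this

lemma ea_loc2 (g m : ℝ → ℝ) (h x c D : ℝ) (hh : |h| ≤ 1)
    (hg : ∀ t, HasDerivAt g (h - m t * g t) t)
    (hb : ∀ t ∈ Icc x (x + 1), |m t * g t| ≤ 1)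
    (hm : ∀ t ∈ Icc x (x + 1), |m t - m x| ≤ c)
    (hD : ∀ t ∈ Icc x (x + 1), c * |g t| ≤ D) :
    |h - m x * g x - (g (x + 1) - g x)| ≤ D + 2 * |m x| := by
  obtain ⟨ξ, hξ, he⟩ := exists_hasDerivAt_eq_slope g (fun t => h - m t * g t)
    (lt_add_one x) (fun t _ => (hg t).continuousAt.continuousWithinAt) (fun t _ => hg t)
  have hξ' : ξ ∈ Icc x (x + 1) := ⟨hξ.1.le, hξ.2.le⟩
  have he' : g (x + 1) - g x = h - m ξ * g ξ := by rw [he]; simp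
  have h1 : |g ξ - g x| ≤ 2 * (ξ - x) := ea_loc g m h x ξ hξ.1.le hh hg
    (fun t ht => hb t ⟨ht.1, ht.2.trans hξ'.2⟩)
  have h1' : |g ξ - g x| ≤ 2 := by linarith [hξ.2]
  rw [he']
  have : h - m x * g x - (h - m ξ * g ξ) = (m ξ - m x) * g ξ + m x * (g ξ - g x) := by ring
  rw [this]
  refine (abs_add_le _ _).trans (add_le_add ?_ ?_)
  · rw [abs_mul]
    exact (mul_le_mul_of_nonneg_right (hm ξ hξ') (abs_nonneg _)).trans (hD ξ hξ')
  · rw [abs_mul, mul_comm]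
    exact mul_le_mul_of_nonneg_right h1' (abs_nonneg _)

/-- Discrete Stein identity. -/
lemma ea_stein (R : ℝ) (d g pi : ℕ → ℝ) (hd0 : d 0 = 0)
    (hrec : ∀ k, R * pi k = d (k + 1) * pi (k + 1))
    (hs : Summable fun k => g (k + 1) * pi k) :
    (Summable fun k => d k * g k * pi k) ∧
      ∑' k, d k * g k * pi k = R * ∑' k, g (k + 1) * pi k := by
  have he : (fun k => d (k + 1) * g (k + 1) * pi (k + 1)) = fun k => R * (g (k + 1) * pi k) := by
    funext k
    linear_combination (-g (k + 1)) * hrec k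
  have h1 : Summable fun k => d (k + 1) * g (k + 1) * pi (k + 1) := by
    rw [he]; exact hs.mul_left R
  have h2 : Summable fun k => d k * g k * pi k :=
    (summable_nat_add_iff (f := fun k => d k * g k * pi k) 1).1 h1
  refine ⟨h2, ?_⟩
  rw [h2.tsum_eq_zero_add, he, tsum_mul_left, hd0]
  ring

/-- First absolute moment of `d - R`. -/
lemma ea_moment (R L : ℝ) (hR : 0 < R) (hL : 0 ≤ L) (d pi : ℕ → ℝ) (hd0 : d 0 = 0)
    (hd : ∀ k, 0 ≤ d k) (hdL : ∀ k, d (k + 1) ≤ d k + L)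
    (hpi : ∀ k, 0 ≤ pi k) (hsum : Summable pi) (h1 : ∑' k, pi k = 1)
    (hrec : ∀ k, R * pi k = d (k + 1) * pi (k + 1)) :
    (Summable fun k => d k * pi k) ∧ (Summable fun k => |d k - R| * pi k) ∧
      ∑' k, |d k - R| * pi k ≤ Real.sqrt (R * L) := by
  have hA := ea_stein R d (fun _ => 1) pi hd0 hrec (by simpa using hsum)
  simp only [mul_one, one_mul, h1] at hA
  have hB0 : Summable fun k => d (k + 1) * pi k := by
    refine Summable.of_nonneg_of_le (fun k => mul_nonneg (hd _) (hpi _))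
      (fun k => ?_) (hA.1.add (hsum.mul_left L))
    have := mul_le_mul_of_nonneg_right (hdL k) (hpi k)
    linarith
  have hB := ea_stein R d d pi hd0 hrec hB0
  have hle : ∑' k, d (k + 1) * pi k ≤ R + L := by
    calc _ ≤ ∑' k, (d k * pi k + L * pi k) := by
          refine hB0.tsum_le_tsum (fun k => ?_) (hA.1.add (hsum.mul_left L))
          have := mul_le_mul_of_nonneg_right (hdL k) (hpi k)
          linarith
      _ = _ := by rw [hA.1.tsum_add (hsum.mul_left L), tsum_mul_left, hA.2, h1]; ring
  have hsq : (fun k => (d k - R) ^ 2 * pi k)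
      = fun k => (d k * d k * pi k - (2 * R) * (d k * pi k)) + R ^ 2 * pi k := by
    funext k; ring
  have hS2 : Summable fun k => (d k - R) ^ 2 * pi k := by
    rw [hsq]; exact (hB.1.sub (hA.1.mul_left _)).add (hsum.mul_left _)
  have hV : ∑' k, (d k - R) ^ 2 * pi k ≤ R * L := by
    rw [hsq, (hB.1.sub (hA.1.mul_left _)).tsum_add (hsum.mul_left _),
      hB.1.tsum_sub (hA.1.mul_left _), tsum_mul_left, tsum_mul_left, hB.2, hA.2, h1]
    nlinarith
  have hSa : Summable fun k => |d k - R| * pi k := by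
    refine Summable.of_nonneg_of_le (fun k => mul_nonneg (abs_nonneg _) (hpi _))
      (fun k => ?_) (hA.1.add (hsum.mul_left R))
    have h := abs_sub (d k) R
    rw [abs_of_nonneg (hd k), abs_of_pos hR] at h
    have := mul_le_mul_of_nonneg_right h (hpi k)
    linarith
  refine ⟨hA.1, hSa, ?_⟩
  set E := ∑' k, |d k - R| * pi k with hE
  apply Real.le_sqrt_of_sq_le
  refine le_trans ?_ hV
  have hle2 : ∑' k, ((2 * E) * (|d k - R| * pi k) - E ^ 2 * pi k)
      ≤ ∑' k, (d k - R) ^ 2 * pi k := by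
    refine ((hSa.mul_left _).sub (hsum.mul_left _)).tsum_le_tsum (fun k => ?_) hS2
    have h := mul_nonneg (sq_nonneg (|d k - R| - E)) (hpi k)
    rw [← sq_abs (d k - R)]
    nlinarith
  rw [(hSa.mul_left _).tsum_sub (hsum.mul_left _), tsum_mul_left, tsum_mul_left, h1, ← hE] at hle2
  nlinarith

/-- Point masses are small. -/
lemma ea_point (R L : ℝ) (hR : 0 < R) (hL : 0 ≤ L) (d pi : ℕ → ℝ) (hd0 : d 0 = 0)
    (hd : ∀ k, 0 ≤ d k) (hdL : ∀ k, d (k + 1) ≤ d k + L)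
    (hpi : ∀ k, 0 ≤ pi k) (hsum : Summable pi) (h1 : ∑' k, pi k = 1)
    (hrec : ∀ k, R * pi k = d (k + 1) * pi (k + 1)) (j : ℕ) :
    R * pi j ≤ Real.sqrt (R * L) := by
  obtain ⟨hA, hS, hE⟩ := ea_moment R L hR hL d pi hd0 hd hdL hpi hsum h1 hrec
  let g : ℕ → ℝ := fun k => if j + 1 ≤ k then 1 else 0
  have hg0 : ∀ k, 0 ≤ g k := fun k => by dsimp only [g]; split_ifs <;> norm_num
  have hg1 : ∀ k, g k ≤ 1 := fun k => by dsimp only [g]; split_ifs <;> norm_num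
  have hs1 : Summable fun k => g (k + 1) * pi k :=
    Summable.of_nonneg_of_le (fun k => mul_nonneg (hg0 _) (hpi _))
      (fun k => mul_le_of_le_one_left (hpi k) (hg1 _)) hsum
  have hs0 : Summable fun k => g k * pi k :=
    Summable.of_nonneg_of_le (fun k => mul_nonneg (hg0 _) (hpi _))
      (fun k => mul_le_of_le_one_left (hpi k) (hg1 _)) hsum
  obtain ⟨hst, he⟩ := ea_stein R d g pi hd0 hrec hs1
  have hdiff : ∑' k, (g (k + 1) * pi k - g k * pi k) = pi j := by
    rw [tsum_eq_single j]
    · simp [g]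
    · intro k hk
      dsimp only [g]
      split_ifs <;> first | omega | simp
  rw [hs1.tsum_sub hs0] at hdiff
  have : R * pi j = ∑' k, (d k * g k * pi k - R * (g k * pi k)) := by
    rw [hst.tsum_sub (hs0.mul_left _), tsum_mul_left, he, ← hdiff]; ring
  rw [this]
  refine le_trans (Summable.tsum_le_tsum (fun k => ?_) (hst.sub (hs0.mul_left _)) hS) hE
  have h2 : (d k - R) * g k ≤ |d k - R| := by
    calc _ ≤ |d k - R| * g k := mul_le_mul_of_nonneg_right (le_abs_self _) (hg0 k)
      _ ≤ _ := mul_le_of_le_one_right (abs_nonneg _) (hg1 k)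
  have := mul_le_mul_of_nonneg_right h2 (hpi k)
  linarith

/-- The death rate (in units of `mu`). -/
noncomputable def eaD (r : ℝ) (n : ℕ) (t : ℝ) : ℝ := min t n + r * max (t - n) 0

lemma eaD_left (r : ℝ) (n : ℕ) (t : ℝ) (h : t ≤ n) : eaD r n t = t := by
  rw [eaD, min_eq_left h, max_eq_right (by linarith)]; ring

lemma eaD_right (r : ℝ) (n : ℕ) (t : ℝ) (h : (n : ℝ) ≤ t) : eaD r n t = n + r * (t - n) := by
  rw [eaD, min_eq_right h, max_eq_left (by linarith)]

lemma eaD_mono (r : ℝ) (hr : 0 < r) (n : ℕ) : Monotone (eaD r n) := by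
  intro x y h
  unfold eaD
  gcongr

lemma ea_cont (R r : ℝ) (hR : 1 ≤ R) (hr : 0 < r) (n : ℕ) (p : ℝ → ℝ)
    (hp : ∀ t, 0 < p t) (hi : Integrable p) (h1 : ∫ t, p t = 1)
    (hd : ∀ t, HasDerivAt p ((1 - eaD r n t / R) * p t) t) :
    ∃ F : ℝ → ℝ, (∀ t, F t = ∫ w in Iic t, p w) ∧ (∀ t, HasDerivAt F (p t) t) ∧
      (∀ t, 0 ≤ F t) ∧ (∀ t, F t ≤ 1) ∧ Monotone F ∧
      (∀ t, F t * (1 - F t) * |1 - eaD r n t / R| ≤ p t) ∧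
      (∀ t : ℝ, t ≤ n → F t * (1 - F t) * Real.sqrt (1 / R)
        ≤ p t * (Real.exp 1 * Real.sqrt (4 * Real.pi))) ∧
      (∀ t, (n : ℝ) ≤ t → F t * (1 - F t) * Real.sqrt (r / R)
        ≤ p t * (Real.exp 1 * Real.sqrt (4 * Real.pi))) := by
  have hR0 : 0 < R := by linarith
  have hcont : Continuous p := continuous_iff_continuousAt.2 fun t => (hd t).continuousAt
  set m : ℝ → ℝ := fun t => 1 - eaD r n t / R with hm
  have hanti : Antitone m := by
    intro x y h
    have := eaD_mono r hr n h
    simp only [hm]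
    gcongr
  set F : ℝ → ℝ := fun t => ∫ w in Iic t, p w with hF
  have hG : ∀ t, ∫ w in Ioi t, p w = 1 - F t := by
    intro t
    have := integral_add_compl (μ := volume) (s := Iic t) measurableSet_Iic hi
    rw [compl_Iic, h1] at this
    simp only [hF]
    linarith
  have hF0 : ∀ t, 0 ≤ F t := fun t => integral_nonneg fun w => (hp w).le
  have hF1 : ∀ t, F t ≤ 1 := fun t => by
    have : 0 ≤ ∫ w in Ioi t, p w := integral_nonneg fun w => (hp w).le
    rw [hG] at this
    linarith
  have hFd : ∀ t, HasDerivAt F (p t) t := by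
    intro t
    have e : F = fun t => F 0 + ∫ w in (0:ℝ)..t, p w := by
      funext t
      rw [← intervalIntegral.integral_Iic_sub_Iic hi.integrableOn hi.integrableOn]
      simp only [hF]; ring
    rw [e]
    exact (intervalIntegral.integral_hasDerivAt_right (hcont.intervalIntegrable _ _)
      (hcont.stronglyMeasurableAtFilter _ _) hcont.continuousAt).const_add _
  have hFm : Monotone F := by
    apply monotone_of_deriv_nonneg (fun t => (hFd t).differentiableAt)
    intro t; rw [(hFd t).deriv]; exact (hp t).le
  have hML : ∀ t, F t * m t ≤ p t := fun t => ea_mills_left p m hp hd hanti hi t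
  have hMR : ∀ t, (1 - F t) * (-m t) ≤ p t := fun t => by
    have := ea_mills_right p m hp hd hanti hi t
    rwa [hG] at this
  have hK : 1 ≤ Real.exp 1 * Real.sqrt (4 * Real.pi) := by
    have a1 : 1 ≤ Real.exp 1 := Real.one_le_exp (by norm_num)
    have a2 : 1 ≤ Real.sqrt (4 * Real.pi) := by
      rw [Real.one_le_sqrt]; linarith [Real.pi_gt_three]
    nlinarith
  set K := Real.exp 1 * Real.sqrt (4 * Real.pi) with hKdef
  have hpK : ∀ t, p t ≤ p t * K := fun t => le_mul_of_one_le_right (hp t).le hK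
  have hq : ∀ t c y, HasDerivAt (fun w => m t * w - c * (w - t) ^ 2 / 2) (m t - c * (y - t)) y := by
    intro t c y
    have a := (hasDerivAt_id y).const_mul (m t)
    have b := ((((hasDerivAt_id y).sub_const t).pow 2).const_mul c).div_const 2
    refine (a.sub b).congr_deriv ?_
    simp
    ring
  refine ⟨F, fun _ => rfl, hFd, hF0, hF1, hFm, ?_, ?_, ?_⟩
  · intro t
    have e1 := hF0 t
    have e2 := hF1 t
    have e3 := hML t
    have e4 := hMR t
    have e5 := hp t
    change F t * (1 - F t) * |m t| ≤ p t
    rcases le_total 0 (m t) with h | h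
    · rw [abs_of_nonneg h]
      nlinarith [mul_nonneg e1 h]
    · rw [abs_of_nonpos h]
      have : 0 ≤ (1 - F t) * (-m t) := mul_nonneg (by linarith) (by linarith)
      nlinarith
  · intro t ht
    have e1 := hF0 t
    have e2 := hF1 t
    have hc : 0 < 1 / R := by positivity
    have hsc := Real.sqrt_pos.2 hc
    rcases le_or_gt (-Real.sqrt (1 / R)) (m t) with h | h
    · have := ea_gauss p (Iic t) measurableSet_Iic hi t (1 / R) hc (hp t) (by
        intro w hw
        have hw' : w ≤ t := hw
        refine (ea_cmp_left p m _ _ hp hd (hq t (1 / R)) w t hw' ?_).trans ?_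
        · intro y hy1 hy2
          simp only [hm, eaD_left r n t ht, eaD_left r n y (hy2.trans ht)]
          apply le_of_eq
          ring
        · apply mul_le_mul_of_nonneg_left _ (hp t).le
          apply Real.exp_le_exp.2
          rw [abs_of_nonpos (by linarith)]
          nlinarith)
      change F t * _ ≤ _ at this
      have e3 : 0 ≤ F t * Real.sqrt (1 / R) := by positivity
      nlinarith
    · have e4 := hMR t
      have : (1 - F t) * Real.sqrt (1 / R) ≤ p t := by nlinarith
      have e3 : 0 ≤ (1 - F t) * Real.sqrt (1 / R) := mul_nonneg (by linarith) hsc.le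
      nlinarith [hpK t]
  · intro t ht
    have e1 := hF0 t
    have e2 := hF1 t
    have hc : 0 < r / R := by positivity
    have hsc := Real.sqrt_pos.2 hc
    rcases le_or_gt (m t) (Real.sqrt (r / R)) with h | h
    · have := ea_gauss p (Ioi t) measurableSet_Ioi hi t (r / R) hc (hp t) (by
        intro w hw
        have hw' : t ≤ w := le_of_lt hw
        refine (ea_cmp_right p m _ _ hp hd (hq t (r / R)) w t hw' ?_).trans ?_
        · intro y hy1 hy2
          simp only [hm, eaD_right r n t ht, eaD_right r n y (ht.trans hy1)]
          apply le_of_eq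
          ring
        · apply mul_le_mul_of_nonneg_left _ (hp t).le
          apply Real.exp_le_exp.2
          rw [abs_of_nonneg (by linarith)]
          nlinarith)
      rw [hG] at this
      have e3 : 0 ≤ (1 - F t) * Real.sqrt (r / R) := mul_nonneg (by linarith) hsc.le
      nlinarith
    · have e4 := hML t
      have : F t * Real.sqrt (r / R) ≤ p t := by nlinarith
      have e3 : 0 ≤ F t * Real.sqrt (r / R) := mul_nonneg (by linarith) hsc.le
      nlinarith [hpK t]

lemma ea_core (R r : ℝ) (hR : 1 ≤ R) (hr : 0 < r) (n : ℕ) (p : ℝ → ℝ)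
    (hp : ∀ t, 0 < p t) (hi : Integrable p) (h1 : ∫ t, p t = 1)
    (hd : ∀ t, HasDerivAt p ((1 - eaD r n t / R) * p t) t)
    (pi : ℕ → ℝ) (hpi : ∀ k, 0 ≤ pi k) (hsum : Summable pi) (hpi1 : ∑' k, pi k = 1)
    (hrec : ∀ k : ℕ, R * pi k = eaD r n ((k + 1 : ℕ) : ℝ) * pi (k + 1)) (s : ℝ) :
    |(∑' k : ℕ, if (k : ℝ) ≤ s then pi k else 0) - ∫ w in Iic s, p w|
      ≤ (Real.exp 1 * Real.sqrt (4 * Real.pi) + 6) * (1 + r) * (1 / Real.sqrt R) := by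
  have hR0 : 0 < R := by linarith
  obtain ⟨F, hF, hFd, hF0, hF1, hFm, hB, hL, hRt⟩ := ea_cont R r hR hr n p hp hi h1 hd
  rw [← hF]
  set K := Real.exp 1 * Real.sqrt (4 * Real.pi) with hK
  have hK0 : 0 ≤ K := by positivity
  set m : ℝ → ℝ := fun t => 1 - eaD r n t / R with hm
  set δ := 1 / Real.sqrt R with hδ
  have hδ0 : 0 < δ := by positivity
  set d : ℕ → ℝ := fun k => eaD r n (k : ℝ) with hdd
  have hd0 : d 0 = 0 := by
    simp only [hdd]; rw [eaD_left] <;> simp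
  have hdn : ∀ k, 0 ≤ d k := fun k => by
    rw [← hd0]; exact eaD_mono r hr n (by simp)
  have hdL : ∀ k, d (k + 1) ≤ d k + (1 + r) := by
    intro k
    simp only [hdd]
    rcases le_or_gt (k + 1) n with h | h
    · have h' : ((k + 1 : ℕ) : ℝ) ≤ n := by exact_mod_cast h
      rw [eaD_left r n _ h', eaD_left r n _ (by push_cast at h'; linarith)]
      push_cast; linarith
    · have h' : (n : ℝ) ≤ k := by exact_mod_cast Nat.lt_succ_iff.1 h
      rw [eaD_right r n _ h', eaD_right r n _ (by push_cast; linarith)]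
      push_cast; linarith
  obtain ⟨hdS, hES, hE⟩ := ea_moment R (1 + r) hR0 (by linarith) d pi hd0 hdn hdL hpi hsum hpi1 hrec
  have hpt := ea_point R (1 + r) hR0 (by linarith) d pi hd0 hdn hdL hpi hsum hpi1 hrec
  have hsq : Real.sqrt (R * (1 + r)) ≤ R * ((1 + r) * δ) := by
    apply Real.sqrt_le_iff.2
    refine ⟨by positivity, ?_⟩
    have : (R * ((1 + r) * δ)) ^ 2 = R * (1 + r) ^ 2 := by
      rw [hδ]
      have := Real.sq_sqrt hR0.le
      field_simp
      rw [this]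
    rw [this]
    nlinarith [mul_pos hR0 hr]
  -- solutions
  set g1 : ℝ → ℝ := fun t => F t * (1 - F s) / p t with hg1
  set g2 : ℝ → ℝ := fun t => F s * (1 - F t) / p t with hg2
  have hg1d : ∀ t, HasDerivAt g1 ((1 - F s) - m t * g1 t) t := by
    intro t
    have hpne := (hp t).ne'
    refine (((hFd t).mul_const (1 - F s)).div (hd t) hpne).congr_deriv ?_
    simp only [hg1, hm]
    field_simp
  have hg2d : ∀ t, HasDerivAt g2 (-F s - m t * g2 t) t := by
    intro t
    have hpne := (hp t).ne'
    refine ((((hFd t).const_sub 1).const_mul (F s)).div (hd t) hpne).congr_deriv ?_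
    simp only [hg2, hm]
    field_simp
  have hg1b : ∀ t, t ≤ s → |g1 t| ≤ F t * (1 - F t) / p t := by
    intro t ht
    have a1 := hF0 t
    have a2 := hF1 s
    have a3 := hFm ht
    have a4 := hp t
    simp only [hg1]
    rw [abs_of_nonneg (div_nonneg (mul_nonneg a1 (by linarith)) a4.le)]
    gcongr
  have hg2b : ∀ t, s ≤ t → |g2 t| ≤ F t * (1 - F t) / p t := by
    intro t ht
    have a1 := hF0 s
    have a2 := hF1 t
    have a3 := hFm ht
    have a4 := hp t
    simp only [hg2]
    rw [abs_of_nonneg (div_nonneg (mul_nonneg a1 (by linarith)) a4.le)]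
    have : 0 ≤ 1 - F t := by linarith
    gcongr
  have hmg : ∀ t x, |x| ≤ F t * (1 - F t) / p t → |m t * x| ≤ 1 := by
    intro t x hx
    rw [abs_mul]
    calc |m t| * |x| ≤ |m t| * (F t * (1 - F t) / p t) := by gcongr
      _ = (F t * (1 - F t) * |m t|) / p t := by ring
      _ ≤ 1 := by rw [div_le_one (hp t)]; exact hB t
  have hgK : ∀ c t x, 0 < c → F t * (1 - F t) * Real.sqrt c ≤ p t * K →
      |x| ≤ F t * (1 - F t) / p t → |x| ≤ K / Real.sqrt c := by
    intro c t x hc h hx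
    have hsc := Real.sqrt_pos.2 hc
    refine hx.trans ?_
    rw [div_le_div_iff₀ (hp t) hsc]
    linarith
  set D := K * ((1 + r) * δ) with hD
  have hcD : ∀ c x, 0 < c → Real.sqrt c ≤ (1 + r) * δ → |x| ≤ K / Real.sqrt c → c * |x| ≤ D := by
    intro c x hc h hx
    have hsc := Real.sqrt_pos.2 hc
    have h2 := Real.sq_sqrt hc.le
    rw [le_div_iff₀ hsc] at hx
    calc c * |x| = (|x| * Real.sqrt c) * Real.sqrt c := by rw [← h2, Real.sqrt_sq hsc.le]; ring
      _ ≤ K * ((1 + r) * δ) := by gcongr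
  have hc1 : 0 < 1 / R := by positivity
  have hc2 : 0 < r / R := by positivity
  have hs1 : Real.sqrt (1 / R) ≤ (1 + r) * δ := by
    rw [Real.sqrt_div (by norm_num), Real.sqrt_one]
    nlinarith
  have hs2 : Real.sqrt (r / R) ≤ (1 + r) * δ := by
    rw [Real.sqrt_div hr.le, hδ, div_eq_mul_one_div]
    have : Real.sqrt r ≤ 1 + r := Real.sqrt_le_iff.2 ⟨by linarith, by nlinarith⟩
    gcongr
  -- on each unit interval there is a slope
  have hslope : ∀ k : ℕ, ∃ c, (∀ t ∈ Icc (k : ℝ) (k + 1), |m t - m k| ≤ c) ∧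
      ∀ t ∈ Icc (k : ℝ) (k + 1), ∀ x, |x| ≤ F t * (1 - F t) / p t → c * |x| ≤ D := by
    intro k
    rcases le_or_gt (k + 1) n with h | h
    · have h' : (k : ℝ) + 1 ≤ n := by exact_mod_cast h
      refine ⟨1 / R, fun t ht => ?_, fun t ht x hx => ?_⟩
      · simp only [hm]
        rw [eaD_left r n t (ht.2.trans h'), eaD_left r n k (by linarith)]
        have : 1 - t / R - (1 - k / R) = -((t - k) / R) := by ring
        rw [this, abs_neg, abs_of_nonneg (div_nonneg (by linarith [ht.1]) hR0.le)]
        gcongr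
        linarith [ht.2]
      · exact hcD _ _ hc1 hs1 (hgK _ t x hc1 (hL t (ht.2.trans h')) hx)
    · have h' : (n : ℝ) ≤ k := by exact_mod_cast Nat.lt_succ_iff.1 h
      refine ⟨r / R, fun t ht => ?_, fun t ht x hx => ?_⟩
      · simp only [hm]
        rw [eaD_right r n t (h'.trans ht.1), eaD_right r n k h']
        have : 1 - (n + r * (t - n)) / R - (1 - (n + r * (k - n)) / R) = -(r * (t - k) / R) := by
          ring
        rw [this, abs_neg, abs_of_nonneg
          (div_nonneg (mul_nonneg hr.le (by linarith [ht.1])) hR0.le)]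
        gcongr
        nlinarith [ht.2]
      · exact hcD _ _ hc2 hs2 (hgK _ t x hc2 (hRt t (h'.trans ht.1)) hx)
  set g : ℝ → ℝ := fun t => if t ≤ s then g1 t else g2 t with hg
  have hgs : g1 s = g2 s := rfl
  have hgle : ∀ t, t ≤ s → g t = g1 t := fun t h => if_pos h
  have hggt : ∀ t, s ≤ t → g t = g2 t := fun t h => by
    rcases h.eq_or_lt with h | h
    · subst h; rw [hgle _ le_rfl, hgs]
    · exact if_neg (not_le.2 h)
  have hgb : ∀ t, |g t| ≤ F t * (1 - F t) / p t := by
    intro t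
    rcases le_total t s with h | h
    · rw [hgle t h]; exact hg1b t h
    · rw [hggt t h]; exact hg2b t h
  set hh : ℕ → ℝ := fun k => (if (k : ℝ) ≤ s then 1 else 0) - F s with hhh
  have hFs1 : |1 - F s| ≤ 1 := by
    rw [abs_le]; constructor <;> linarith [hF0 s, hF1 s]
  have hFs2 : |-F s| ≤ 1 := by
    rw [abs_le]; constructor <;> linarith [hF0 s, hF1 s]
  have hhb : ∀ k, |hh k| ≤ 1 := by
    intro k
    simp only [hhh]
    split_ifs
    · exact hFs1
    · rw [zero_sub]; exact hFs2
  have hterm : ∀ k : ℕ, |hh k - m k * g k - (g (k + 1) - g k)|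
      ≤ D + 2 * |m k| + if k = ⌊s⌋₊ then 4 else 0 := by
    intro k
    obtain ⟨c, hc, hcx⟩ := hslope k
    have hnn : (0 : ℝ) ≤ if k = ⌊s⌋₊ then 4 else 0 := by split_ifs <;> norm_num
    rcases le_or_gt ((k : ℝ) + 1) s with h | h
    · have := ea_loc2 g1 m (1 - F s) k c D hFs1 hg1d
        (fun t ht => hmg t _ (hg1b t (ht.2.trans h))) hc
        (fun t ht => hcx t ht _ (hg1b t (ht.2.trans h)))
      rw [hgle _ h, hgle k (by linarith)]
      have e : hh k = 1 - F s := by simp only [hhh]; rw [if_pos (by linarith)]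
      rw [e]
      linarith
    · rcases lt_or_ge s (k : ℝ) with h2 | h2
      · have := ea_loc2 g2 m (-F s) k c D hFs2 hg2d
          (fun t ht => hmg t _ (hg2b t (h2.le.trans ht.1))) hc
          (fun t ht => hcx t ht _ (hg2b t (h2.le.trans ht.1)))
        rw [hggt _ (h.le), hggt k h2.le]
        have e : hh k = - F s := by simp only [hhh]; rw [if_neg (by linarith)]; ring
        rw [e]
        linarith
      · have hk : k = ⌊s⌋₊ := by
          symm
          rw [Nat.floor_eq_iff (le_trans (Nat.cast_nonneg k) h2)]
          exact ⟨h2, h⟩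
        rw [if_pos hk]
        have b1 := ea_loc g1 m (1 - F s) k s h2 hFs1 hg1d (fun t ht => hmg t _ (hg1b t ht.2))
        have b2 := ea_loc g2 m (-F s) s (k + 1) h.le hFs2 hg2d
          (fun t ht => hmg t _ (hg2b t ht.1))
        have b3 : |g (k + 1) - g k| ≤ 2 := by
          rw [hggt _ h.le, hgle _ h2]
          have : g2 (k + 1) - g1 k = (g2 (k + 1) - g2 s) + (g1 s - g1 k) := by rw [hgs]; ring
          rw [this]
          refine (abs_add_le _ _).trans ?_
          linarith
        have b4 := hmg k _ (hgb k)
        have b5 := hhb k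
        have b6 := abs_sub (hh k - m k * g k) (g (k + 1) - g k)
        have b7 := abs_sub (hh k) (m k * g k)
        have : 0 ≤ D := by positivity
        linarith [abs_nonneg (m k)]
  -- boundedness of g
  set Bd := K / Real.sqrt (1 / R) + K / Real.sqrt (r / R) with hBd
  have hgBd : ∀ t, |g t| ≤ Bd := by
    intro t
    have q1 : 0 ≤ K / Real.sqrt (1 / R) := by positivity
    have q2 : 0 ≤ K / Real.sqrt (r / R) := by positivity
    rcases le_total t (n : ℝ) with h | h
    · linarith [hgK _ t _ hc1 (hL t h) (hgb t)]
    · linarith [hgK _ t _ hc2 (hRt t h) (hgb t)]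
  have hbs : ∀ (f : ℕ → ℝ) (B : ℝ), (∀ k, |f k| ≤ B) → Summable fun k => f k * pi k := by
    intro f B hf
    refine Summable.of_norm_bounded (hsum.mul_left B) (fun k => ?_)
    rw [Real.norm_eq_abs, abs_mul, abs_of_nonneg (hpi k)]
    exact mul_le_mul_of_nonneg_right (hf k) (hpi k)
  have hS1 : Summable fun k : ℕ => g ((k + 1 : ℕ) : ℝ) * pi k := hbs _ Bd (fun k => hgBd _)
  obtain ⟨hS2, hst⟩ := ea_stein R d (fun k => g (k : ℝ)) pi hd0 hrec hS1
  have hS3 : Summable fun k => hh k * pi k := hbs _ 1 hhb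
  have hTe : (fun k : ℕ => (hh k - m k * g k - (g (k + 1) - g k)) * pi k)
      = fun k : ℕ => (hh k * pi k - g ((k + 1 : ℕ) : ℝ) * pi k)
        + (1 / R) * (d k * g k * pi k) := by
    funext k
    simp only [hm, hdd]
    push_cast
    ring
  have hTsum : ∑' k : ℕ, (hh k - m k * g k - (g (k + 1) - g k)) * pi k = ∑' k, hh k * pi k := by
    rw [hTe, (hS3.sub hS1).tsum_add (hS2.mul_left _), hS3.tsum_sub hS1, tsum_mul_left, hst]
    field_simp
    ring
  have hhs : ∑' k, hh k * pi k = (∑' k : ℕ, if (k : ℝ) ≤ s then pi k else 0) - F s := by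
    have e : (fun k => hh k * pi k)
        = fun k : ℕ => (if (k : ℝ) ≤ s then pi k else 0) - F s * pi k := by
      funext k; simp only [hhh]; split_ifs <;> ring
    have hi' : Summable fun k : ℕ => if (k : ℝ) ≤ s then pi k else 0 := by
      refine Summable.of_nonneg_of_le (fun k => ?_) (fun k => ?_) hsum
      · split_ifs
        · exact hpi k
        · exact le_rfl
      · split_ifs
        · exact le_rfl
        · exact hpi k
    rw [e, hi'.tsum_sub (hsum.mul_left _), tsum_mul_left, hpi1, mul_one]
  rw [← hhs, ← hTsum]
  have hme : ∀ k : ℕ, |m k| = (1 / R) * |d k - R| := by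
    intro k
    have e : m k = -((1 / R) * (d k - R)) := by
      simp only [hm, hdd]
      field_simp
      ring
    rw [e, abs_neg, abs_mul, abs_of_pos hc1]
  set j := ⌊s⌋₊ with hj
  have hU1 : HasSum (fun k => D * pi k) D := by
    simpa [hpi1] using (hsum.hasSum.mul_left D)
  have hU2 : HasSum (fun k => (2 / R) * (|d k - R| * pi k)) ((2 / R) * ∑' k, |d k - R| * pi k) :=
    hES.hasSum.mul_left _
  have hU3 : HasSum (fun k => if k = j then 4 * pi j else 0) (4 * pi j) := hasSum_ite_eq j _
  have hU := (hU1.add hU2).add hU3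
  have hfin := tsum_of_norm_bounded hU (f := fun k : ℕ =>
    (hh k - m k * g k - (g (k + 1) - g k)) * pi k) (fun k => by
      rw [Real.norm_eq_abs, abs_mul, abs_of_nonneg (hpi k)]
      refine (mul_le_mul_of_nonneg_right (hterm k) (hpi k)).trans (le_of_eq ?_)
      rw [hme]
      split_ifs with hkj
      · rw [hkj]; ring
      · ring)
  rw [Real.norm_eq_abs] at hfin
  refine hfin.trans ?_
  have z1 : (2 / R) * ∑' k, |d k - R| * pi k ≤ 2 * ((1 + r) * δ) := by
    calc _ ≤ (2 / R) * (R * ((1 + r) * δ)) := by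
          apply mul_le_mul_of_nonneg_left (hE.trans hsq); positivity
      _ = _ := by field_simp
  have z2 : pi j ≤ (1 + r) * δ := by
    have := (hpt j).trans hsq
    exact le_of_mul_le_mul_left this hR0
  calc _ ≤ K * ((1 + r) * δ) + 2 * ((1 + r) * δ) + 4 * ((1 + r) * δ) := by
        rw [hD]; gcongr
    _ = _ := by ring

/-- Erlang-A: there is a nondecreasing positive function `C_K` of `α/μ` such that
the Kolmogorov distance between the scaled stationary customer count and the
diffusion approximation is at most `C_K(α/μ)·δ`, for all parameters with `R ≥ 1`. -/
theorem erlangA_kolmogorov :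
    ∃ C : ℝ → ℝ,
      (∀ r : ℝ, 0 < r → 0 < C r) ∧
      (∀ r s : ℝ, 0 < r → r ≤ s → C r ≤ C s) ∧
      ∀ (lam mu alpha : ℝ) (n : ℕ),
        0 < lam → 0 < mu → 0 < alpha → 1 ≤ n →
      ∀ R δ xinf ζ : ℝ,
        R = lam / mu → 1 ≤ R →
        δ = 1 / Real.sqrt R →
        xinf = (if (n : ℝ) ≤ R then (n : ℝ) + (lam - (n : ℝ) * mu) / alpha else R) →
        ζ = δ * (xinf - (n : ℝ)) →
      ∀ pi : ℕ → ℝ,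
        (∀ k, 0 ≤ pi k) → (∑' k : ℕ, pi k) = 1 →
        (∀ k : ℕ, lam * pi k
            = (mu * min ((k : ℝ) + 1) (n : ℝ)
                + alpha * max ((k : ℝ) + 1 - (n : ℝ)) 0) * pi (k + 1)) →
      ∀ b : ℝ → ℝ,
        (∀ x : ℝ, b x = mu * (max (-(x + ζ)) 0 - max (-ζ) 0)
                        - alpha * (max (x + ζ) 0 - max ζ 0)) →
      ∀ kappa : ℝ, 0 < kappa →
      ∀ nu : ℝ → ℝ,
        (∀ x : ℝ, nu x = kappa * Real.exp ((1 / mu) * ∫ y in (0:ℝ)..x, b y)) →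
        (∫ x : ℝ, nu x) = 1 →
      ∀ a : ℝ,
        |(∑' k : ℕ, if δ * ((k : ℝ) - xinf) ≤ a then pi k else 0)
            - (∫ x in Set.Iic a, nu x)| ≤ C (alpha / mu) * δ := by
  refine ⟨fun r => (Real.exp 1 * Real.sqrt (4 * Real.pi) + 6) * (1 + r), ?_, ?_, ?_⟩
  · intro r hr; positivity
  · intro r s hr hrs
    dsimp only
    gcongr
  intro lam mu alpha n hlam hmu halpha hn R δ xinf ζ hR hR1 hδ hx hζ pi hpi hpi1 hrec b hb kappa hk
    nu hnu hnu1 a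
  have hR0 : 0 < R := by linarith
  have hδ0 : 0 < δ := by rw [hδ]; positivity
  have hlamR : lam = R * mu := by rw [hR]; field_simp
  have hδ2 : δ ^ 2 = 1 / R := by rw [hδ, div_pow, Real.sq_sqrt hR0.le]; norm_num
  have hsum : Summable pi := by
    by_contra h
    rw [tsum_eq_zero_of_not_summable h] at hpi1
    norm_num at hpi1
  have hbc : Continuous b := by
    have : b = fun x => mu * (max (-(x + ζ)) 0 - max (-ζ) 0)
                        - alpha * (max (x + ζ) 0 - max ζ 0) := funext hb
    rw [this]; fun_prop
  have hnuI : Integrable nu := by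
    by_contra h
    rw [integral_undef h] at hnu1
    norm_num at hnu1
  have hnud : ∀ x, HasDerivAt nu ((1 / mu) * b x * nu x) x := by
    intro x
    have e : nu = fun x => kappa * Real.exp ((1 / mu) * ∫ y in (0:ℝ)..x, b y) := funext hnu
    have h1 := intervalIntegral.integral_hasDerivAt_right (hbc.intervalIntegrable 0 x)
      (hbc.stronglyMeasurableAtFilter _ _) hbc.continuousAt
    have h2 := ((h1.const_mul (1 / mu)).exp).const_mul kappa
    rw [e]
    refine h2.congr_deriv ?_
    ring
  -- drift identity
  have hdrift : ∀ t : ℝ, (1 / mu) * b (δ * (t - xinf)) * δ = 1 - eaD (alpha / mu) n t / R := by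
    intro t
    have hxz : δ * (t - xinf) + ζ = δ * (t - n) := by rw [hζ]; ring
    rw [hb, hxz]
    have hp1 : max (δ * (t - n)) 0 = δ * max (t - n) 0 := by
      rw [mul_max_of_nonneg _ _ hδ0.le, mul_zero]
    have hp2 : max (-(δ * (t - n))) 0 = δ * (n - min t n) := by
      rcases le_total t n with h | h
      · rw [min_eq_left h, max_eq_left (by nlinarith)]; ring
      · rw [min_eq_right h, max_eq_right (by nlinarith)]; ring
    have hz : mu * max (-ζ) 0 - alpha * max ζ 0 = δ * (n * mu - lam) := by
      rw [hζ, hx]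
      split_ifs with h
      · have h0 : 0 ≤ lam - n * mu := by rw [hlamR]; nlinarith
        have h3 : 0 ≤ δ * (n + (lam - n * mu) / alpha - n) := by
          have : 0 ≤ (lam - n * mu) / alpha := by positivity
          apply mul_nonneg hδ0.le; linarith
        rw [max_eq_right (by linarith), max_eq_left h3]
        field_simp
        ring
      · have h3 : δ * (R - n) ≤ 0 := by
          apply mul_nonpos_of_nonneg_of_nonpos hδ0.le; linarith
        rw [max_eq_left (by linarith), max_eq_right h3, hlamR]
        ring
    rw [hp1, hp2, eaD]
    have e : (1 / mu) * (mu * (δ * (n - min t n) - max (-ζ) 0)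
        - alpha * (δ * max (t - n) 0 - max ζ 0)) * δ
        = (1 / mu) * (mu * (n - min t n) - alpha * max (t - n) 0 - (n * mu - lam)) * δ ^ 2 := by
      linear_combination (-(1 / mu) * δ) * hz
    rw [e, hδ2, hlamR]
    field_simp
    ring
  set p : ℝ → ℝ := fun t => δ * nu (δ * (t - xinf)) with hpdef
  have hnupos : ∀ x, 0 < nu x := fun x => by rw [hnu]; positivity
  have hp : ∀ t, 0 < p t := fun t => mul_pos hδ0 (hnupos _)
  have hi : Integrable p := by
    have h1 : Integrable (fun t => nu (δ * t)) := hnuI.comp_mul_left' hδ0.ne'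
    exact (h1.comp_sub_right xinf).const_mul δ
  have hind : ∀ s, ∫ w in Iic s, p w = ∫ x in Iic (δ * (s - xinf)), nu x := by
    intro s
    rw [← integral_indicator measurableSet_Iic, ← integral_indicator measurableSet_Iic]
    have e : (Iic s).indicator p
        = fun t => δ * (fun y => (Iic (δ * (s - xinf))).indicator nu (δ * y)) (t - xinf) := by
      funext t
      by_cases h : t ≤ s
      · rw [indicator_of_mem (by exact h)]
        simp only [hpdef]
        rw [indicator_of_mem]
        have : t - xinf ≤ s - xinf := by linarith
        exact mul_le_mul_of_nonneg_left this hδ0.le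
      · rw [indicator_of_notMem (by exact h)]
        simp only []
        rw [indicator_of_notMem, mul_zero]
        intro h2
        have h3 : δ * (t - xinf) ≤ δ * (s - xinf) := h2
        have := le_of_mul_le_mul_left h3 hδ0
        exact h (by linarith)
    rw [e, integral_const_mul, integral_sub_right_eq_self
      (fun y => (Iic (δ * (s - xinf))).indicator nu (δ * y)), Measure.integral_comp_mul_left,
      abs_of_pos (inv_pos.2 hδ0), smul_eq_mul, ← mul_assoc, mul_inv_cancel₀ hδ0.ne', one_mul]
  have h1 : ∫ t, p t = 1 := by
    simp only [hpdef]
    rw [integral_const_mul, integral_sub_right_eq_self (fun y => nu (δ * y)),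
      Measure.integral_comp_mul_left,
      abs_of_pos (inv_pos.2 hδ0), smul_eq_mul, ← mul_assoc, mul_inv_cancel₀ hδ0.ne', one_mul, hnu1]
  have hd : ∀ t, HasDerivAt p ((1 - eaD (alpha / mu) n t / R) * p t) t := by
    intro t
    have h1 : HasDerivAt (fun t => δ * (t - xinf)) δ t := by
      simpa using ((hasDerivAt_id t).sub_const xinf).const_mul δ
    refine (((hnud (δ * (t - xinf))).comp t h1).const_mul δ).congr_deriv ?_
    rw [← hdrift]
    simp only [hpdef]
    ring
  have hrec' : ∀ k : ℕ, R * pi k = eaD (alpha / mu) n ((k + 1 : ℕ) : ℝ) * pi (k + 1) := by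
    intro k
    have := hrec k
    rw [hlamR] at this
    rw [eaD]
    push_cast
    field_simp
    linarith
  have := ea_core R (alpha / mu) hR1 (by positivity) n p hp hi h1 hd pi hpi hsum hpi1 hrec'
    (a / δ + xinf)
  rw [hind, ← hδ] at this
  have ea : δ * (a / δ + xinf - xinf) = a := by field_simp; ring
  rw [ea] at this
  have ek : ∀ k : ℕ, (δ * ((k : ℝ) - xinf) ≤ a) = ((k : ℝ) ≤ a / δ + xinf) := by
    intro k
    rw [← sub_le_iff_le_add, le_div_iff₀ hδ0, mul_comm]
  simp only [ek]
  exact this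
end
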